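/- For finite groups F and F', the lamplighter groups ℤ ≀ F and ℤ ≀ F' are quasi-isometric if and only if there exist positive integers d, s, r such that |F| = d^s and |F'| = d^r. -/

import Mathlib

open Set

noncomputable section

/-- `φ` is a `(κ, C)`-quasi-isometry from `(X, dX)` to `(Y, dY)`. -/
def IsQI {X Y : Type*} (dX : X → X → ℝ) (dY : Y → Y → ℝ)
    (κ C : ℝ) (φ : X → Y) : Prop :=
  (∀ a b, (1 / κ) * dX a b - C ≤ dY (φ a) (φ b) ∧ dY (φ a) (φ b) ≤ κ * dX a b + C) ∧
  ∀ y, ∃ x, dY (φ x) y ≤ C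

/-- The word metric on a group with respect to a generating set `S`. -/
def wordDist {G : Type*} [Group G] (S : Set G) (g h : G) : ℝ :=
  sInf {r : ℝ | ∃ l : List G, (∀ x ∈ l, x ∈ S ∨ x⁻¹ ∈ S) ∧ l.prod = g⁻¹ * h ∧
    r = l.length}

/-- Two groups are quasi-isometric: there are finite generating sets and a
quasi-isometry between the corresponding word metrics. -/
def GroupsQI (G H : Type*) [Group G] [Group H] : Prop :=
  ∃ (S : Set G) (T : Set H), S.Finite ∧ T.Finite ∧
    Subgroup.closure S = ⊤ ∧ Subgroup.closure T = ⊤ ∧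
    ∃ (κ C : ℝ) (φ : G → H), 1 ≤ κ ∧ 0 ≤ C ∧ IsQI (wordDist S) (wordDist T) κ C φ

/-- The group of finitely supported functions `ℤ → F` (the "states of the lamps"). -/
def LampState (F : Type*) [Group F] : Subgroup (ℤ → F) where
  carrier := {f | {i : ℤ | f i ≠ 1}.Finite}
  one_mem' := by simp
  mul_mem' := by
    intro a b ha hb
    refine (ha.union hb).subset ?_
    intro i hi
    by_contra hcon
    simp only [Set.mem_union, Set.mem_setOf_eq, not_or, not_not] at hcon
    exact hi (by simp [Pi.mul_apply, hcon.1, hcon.2])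
  inv_mem' := by
    intro a ha
    refine ha.subset ?_
    intro i hi
    simp only [Set.mem_setOf_eq, Pi.inv_apply, ne_eq, inv_eq_one] at hi
    exact hi

/-- The shift by `k` as an automorphism of `LampState F`. -/
def lampShift (F : Type*) [Group F] (k : ℤ) : LampState F ≃* LampState F where
  toFun f := ⟨fun i => (f : ℤ → F) (i - k), by
    refine ((f.2 : {i : ℤ | (f : ℤ → F) i ≠ 1}.Finite).image (fun i => i + k)).subset ?_
    intro i hi
    exact ⟨i - k, hi, by ring⟩⟩
  invFun f := ⟨fun i => (f : ℤ → F) (i + k), by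
    refine ((f.2 : {i : ℤ | (f : ℤ → F) i ≠ 1}.Finite).image (fun i => i - k)).subset ?_
    intro i hi
    exact ⟨i + k, hi, by ring⟩⟩
  left_inv f := by
    apply Subtype.ext
    funext i
    simp
  right_inv f := by
    apply Subtype.ext
    funext i
    simp
  map_mul' f g := by
    apply Subtype.ext
    funext i
    rfl

/-- The shift action of `ℤ` on the lamp states. -/
def lampShiftHom (F : Type*) [Group F] : Multiplicative ℤ →* MulAut (LampState F) where
  toFun k := lampShift F k.toAdd
  map_one' := by
    refine MulEquiv.ext fun f => Subtype.ext (funext fun i => ?_)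
    simp [lampShift]
  map_mul' a b := by
    refine MulEquiv.ext fun f => Subtype.ext (funext fun i => ?_)
    simp [lampShift, MulAut.mul_apply, sub_sub]

/-- The lamplighter group `ℤ ≀ F = (⊕_{i∈ℤ} F) ⋊ ℤ`, with `ℤ` acting by shifting. -/
abbrev Lamplighter (F : Type*) [Group F] : Type _ :=
  LampState F ⋊[lampShiftHom F] Multiplicative ℤ

set_option linter.unusedSectionVars false

namespace Lamp

open scoped BigOperators

section

variable {F F' : Type} [Group F'] [Group F]

/-- The lamp configuration of an element of the lamplighter group. -/
def lamp (p : Lamplighter F) (i : ℤ) : F := (p.left : ℤ → F) i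

/-- The position of the lamplighter. -/
def pos (p : Lamplighter F) : ℤ := p.right.toAdd

lemma lamp_finite (p : Lamplighter F) : {i | lamp p i ≠ 1}.Finite := p.left.2

/-- The element of the lamplighter group with given configuration and position. -/
def mkPt (f : ℤ → F) (hf : {i | f i ≠ 1}.Finite) (k : ℤ) : Lamplighter F :=
  ⟨⟨f, hf⟩, Multiplicative.ofAdd k⟩

@[simp] lemma lamp_mkPt (f : ℤ → F) (hf) (k : ℤ) : lamp (mkPt f hf k) = f := rfl
@[simp] lemma pos_mkPt (f : ℤ → F) (hf) (k : ℤ) : pos (mkPt f hf k) = k := rfl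

lemma ext_pt {p q : Lamplighter F} (h : ∀ i, lamp p i = lamp q i) (h' : pos p = pos q) :
    p = q := by
  apply SemidirectProduct.ext
  · exact Subtype.ext (funext h)
  · exact h'

@[simp] lemma lamp_mul (p q : Lamplighter F) (i : ℤ) :
    lamp (p * q) i = lamp p i * lamp q (i - pos p) := rfl
@[simp] lemma pos_mul (p q : Lamplighter F) : pos (p * q) = pos p + pos q := rfl
@[simp] lemma lamp_one (i : ℤ) : lamp (1 : Lamplighter F) i = 1 := rfl
@[simp] lemma pos_one : pos (1 : Lamplighter F) = 0 := rfl
lemma diff_finite (p q : Lamplighter F) : {i | lamp p i ≠ lamp q i}.Finite := by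
  refine ((lamp_finite p).union (lamp_finite q)).subset fun i hi => ?_
  by_contra hc
  simp only [mem_union, mem_ofPred_eq, not_or, not_not] at hc
  exact hi (by rw [hc.1, hc.2])

/-- The lowest point of the region in which `p` and `q` differ. -/
def lo (p q : Lamplighter F) : ℤ :=
  (insert (pos p) (insert (pos q) (diff_finite p q).toFinset)).min' (Finset.insert_nonempty _ _)

/-- The highest point of the region in which `p` and `q` differ. -/
def hi (p q : Lamplighter F) : ℤ :=
  (insert (pos p) (insert (pos q) ((diff_finite p q).toFinset.image (· + 1)))).max'
    (Finset.insert_nonempty _ _)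

/-- The length of the region in which `p` and `q` differ. -/
def len (p q : Lamplighter F) : ℤ := hi p q - lo p q

lemma le_lo {p q : Lamplighter F} {x : ℤ} :
    x ≤ lo p q ↔ x ≤ pos p ∧ x ≤ pos q ∧ ∀ i < x, lamp p i = lamp q i := by
  rw [lo, Finset.le_min'_iff]
  simp only [Finset.mem_insert, Finite.mem_toFinset, mem_ofPred_eq, forall_eq_or_imp]
  refine and_congr_right fun _ => and_congr_right fun _ => ?_
  constructor
  · intro h i hi
    by_contra hc
    exact absurd (h i hc) (by omega)
  · intro h i hi
    by_contra hc
    exact hi (h i (by omega))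

lemma hi_le {p q : Lamplighter F} {x : ℤ} :
    hi p q ≤ x ↔ pos p ≤ x ∧ pos q ≤ x ∧ ∀ i, x ≤ i → lamp p i = lamp q i := by
  rw [hi, Finset.max'_le_iff]
  simp only [Finset.mem_insert, Finset.mem_image, Finite.mem_toFinset, mem_ofPred_eq,
    forall_eq_or_imp]
  refine and_congr_right fun _ => and_congr_right fun _ => ?_
  constructor
  · intro h i hi
    by_contra hc
    exact absurd (h (i + 1) ⟨i, hc, rfl⟩) (by omega)
  · rintro h _ ⟨i, hi, rfl⟩
    by_contra hc
    exact hi (h i (by omega))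

lemma lo_le_left (p q : Lamplighter F) : lo p q ≤ pos p := (le_lo.1 le_rfl).1
lemma lo_le_right (p q : Lamplighter F) : lo p q ≤ pos q := (le_lo.1 le_rfl).2.1
lemma left_le_hi (p q : Lamplighter F) : pos p ≤ hi p q := (hi_le.1 le_rfl).1
lemma right_le_hi (p q : Lamplighter F) : pos q ≤ hi p q := (hi_le.1 le_rfl).2.1
lemma lamp_eq_of_lt {p q : Lamplighter F} {i : ℤ} (h : i < lo p q) : lamp p i = lamp q i :=
  (le_lo.1 le_rfl).2.2 i h
lemma lamp_eq_of_le {p q : Lamplighter F} {i : ℤ} (h : hi p q ≤ i) : lamp p i = lamp q i :=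
  (hi_le.1 le_rfl).2.2 i h

lemma lo_comm (p q : Lamplighter F) : lo p q = lo q p :=
  le_antisymm
    (le_lo.2 ⟨lo_le_right p q, lo_le_left p q, fun _ h => (lamp_eq_of_lt h).symm⟩)
    (le_lo.2 ⟨lo_le_right q p, lo_le_left q p, fun _ h => (lamp_eq_of_lt h).symm⟩)

lemma hi_comm (p q : Lamplighter F) : hi p q = hi q p :=
  le_antisymm
    (hi_le.2 ⟨right_le_hi q p, left_le_hi q p, fun _ h => (lamp_eq_of_le h).symm⟩)
    (hi_le.2 ⟨right_le_hi p q, left_le_hi p q, fun _ h => (lamp_eq_of_le h).symm⟩)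

lemma len_comm (p q : Lamplighter F) : len p q = len q p := by
  rw [len, len, lo_comm, hi_comm]

lemma lo_tri (p q r : Lamplighter F) : min (lo p q) (lo q r) ≤ lo p r := by
  refine le_lo.2 ⟨?_, ?_, fun i h => ?_⟩
  · have := lo_le_left p q; omega
  · have := lo_le_right q r; omega
  · exact (lamp_eq_of_lt (by omega)).trans (lamp_eq_of_lt (by omega : i < lo q r))

lemma hi_tri (p q r : Lamplighter F) : hi p r ≤ max (hi p q) (hi q r) := by
  refine hi_le.2 ⟨?_, ?_, fun i h => ?_⟩
  · have := left_le_hi p q; omega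
  · have := right_le_hi q r; omega
  · exact (lamp_eq_of_le (by omega)).trans (lamp_eq_of_le (by omega : hi q r ≤ i))

lemma lo_le_hi (p q : Lamplighter F) : lo p q ≤ hi p q :=
  (lo_le_left p q).trans (left_le_hi p q)

lemma len_nonneg (p q : Lamplighter F) : 0 ≤ len p q := by
  have := lo_le_hi p q; unfold len; omega

lemma abs_pos_le_len (p q : Lamplighter F) : |pos p - pos q| ≤ len p q := by
  have h1 := lo_le_left p q
  have h2 := lo_le_right p q
  have h3 := left_le_hi p q
  have h4 := right_le_hi p q
  unfold len
  rw [abs_le]; omega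

lemma len_tri (p q r : Lamplighter F) : len p r ≤ len p q + len q r := by
  have h1 := lo_tri p q r
  have h2 := hi_tri p q r
  have h3 := lo_le_right p q
  have h4 := right_le_hi p q
  have h5 := lo_le_left q r
  have h6 := left_le_hi q r
  unfold len
  omega

@[simp] lemma lo_self (p : Lamplighter F) : lo p p = pos p :=
  le_antisymm (lo_le_left p p) (le_lo.2 ⟨le_rfl, le_rfl, fun _ _ => rfl⟩)
@[simp] lemma hi_self (p : Lamplighter F) : hi p p = pos p :=
  le_antisymm (hi_le.2 ⟨le_rfl, le_rfl, fun _ _ => rfl⟩) (left_le_hi p p)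
@[simp] lemma len_self (p : Lamplighter F) : len p p = 0 := by simp [len]

lemma lo_mul (g p q : Lamplighter F) : lo (g * p) (g * q) = lo p q + pos g := by
  apply eq_of_forall_le_iff
  intro x
  rw [← sub_le_iff_le_add, le_lo, le_lo]
  simp only [pos_mul, lamp_mul, mul_right_inj]
  refine and_congr (by omega) (and_congr (by omega) ⟨fun h i hi => ?_, fun h i hi => ?_⟩)
  · simpa using h (i + pos g) (by omega)
  · exact h (i - pos g) (by omega)

lemma hi_mul (g p q : Lamplighter F) : hi (g * p) (g * q) = hi p q + pos g := by
  apply eq_of_forall_ge_iff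
  intro x
  rw [← le_sub_iff_add_le, hi_le, hi_le]
  simp only [pos_mul, lamp_mul, mul_right_inj]
  refine and_congr (by omega) (and_congr (by omega) ⟨fun h i hi => ?_, fun h i hi => ?_⟩)
  · simpa using h (i + pos g) (by omega)
  · exact h (i - pos g) (by omega)

lemma len_mul (g p q : Lamplighter F) : len (g * p) (g * q) = len p q := by
  rw [len, len, lo_mul, hi_mul]; ring

/-- A pair of mutually quasi-inverse coarse Lipschitz maps. -/
structure QIPair (K : ℤ) (φ : Lamplighter F → Lamplighter F')
    (ψ : Lamplighter F' → Lamplighter F) : Prop where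
  one_le : 1 ≤ K
  len_left : ∀ p q, len (φ p) (φ q) ≤ K * len p q + K
  len_right : ∀ p q, len (ψ p) (ψ q) ≤ K * len p q + K
  inv_left : ∀ p, len (ψ (φ p)) p ≤ K
  inv_right : ∀ p, len (φ (ψ p)) p ≤ K

lemma QIPair.symm {K : ℤ} {φ : Lamplighter F → Lamplighter F'}
    {ψ : Lamplighter F' → Lamplighter F} (h : QIPair K φ ψ) : QIPair K ψ φ :=
  ⟨h.one_le, h.len_right, h.len_left, h.inv_right, h.inv_left⟩

lemma QIPair.lower {K : ℤ} {φ : Lamplighter F → Lamplighter F'}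
    {ψ : Lamplighter F' → Lamplighter F} (h : QIPair K φ ψ) (p q : Lamplighter F) :
    len p q ≤ K * len (φ p) (φ q) + 3 * K := by
  have h1 := len_tri p (ψ (φ p)) q
  have h2 := len_tri (ψ (φ p)) (ψ (φ q)) q
  have h3 := h.len_right (φ p) (φ q)
  have h4 := h.inv_left p
  have h5 := h.inv_left q
  rw [len_comm] at h4
  linarith

/-- Move the lamplighter by `k`, leaving the lamps unchanged. -/
def mv (p : Lamplighter F) (k : ℤ) : Lamplighter F := mkPt (lamp p) (lamp_finite p) (pos p + k)

@[simp] lemma lamp_mv (p : Lamplighter F) (k i : ℤ) : lamp (mv p k) i = lamp p i := rfl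
@[simp] lemma pos_mv (p : Lamplighter F) (k : ℤ) : pos (mv p k) = pos p + k := rfl
@[simp] lemma mv_mv (p : Lamplighter F) (k l : ℤ) : mv (mv p k) l = mv p (k + l) :=
  ext_pt (fun _ => rfl) (by simp [add_assoc])
@[simp] lemma mv_zero (p : Lamplighter F) : mv p 0 = p := ext_pt (fun _ => rfl) (by simp)

lemma len_mv (p : Lamplighter F) (k : ℤ) : len p (mv p k) ≤ |k| := by
  have h1 : min (pos p) (pos p + k) ≤ lo p (mv p k) :=
    le_lo.2 ⟨by simp, by simp, fun _ _ => rfl⟩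
  have h2 : hi p (mv p k) ≤ max (pos p) (pos p + k) :=
    hi_le.2 ⟨by simp, by simp, fun _ _ => rfl⟩
  unfold len
  rcases abs_cases k with h | h <;> omega

/-- Move the lamplighter down by `s`, rewriting the lamps it passes by the word `x`. -/
def dn (q : Lamplighter F) (x : ℕ → F) (s : ℕ) : Lamplighter F :=
  mkPt (fun j => if pos q - s ≤ j ∧ j < pos q then x (pos q - 1 - j).toNat else lamp q j)
    (by
      refine ((lamp_finite q).union (finite_Ico (pos q - s) (pos q))).subset fun i hi => ?_
      simp only [mem_ofPred_eq, ne_eq, mem_union, mem_Ico] at hi ⊢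
      split_ifs at hi with h
      · exact Or.inr h
      · exact Or.inl hi) (pos q - s)

@[simp] lemma pos_dn (q : Lamplighter F) (x : ℕ → F) (s : ℕ) : pos (dn q x s) = pos q - s := rfl
lemma lamp_dn (q : Lamplighter F) (x : ℕ → F) (s : ℕ) (j : ℤ) : lamp (dn q x s) j =
    if pos q - s ≤ j ∧ j < pos q then x (pos q - 1 - j).toNat else lamp q j := rfl

lemma lamp_dn_of_mem {q : Lamplighter F} (x : ℕ → F) {s : ℕ} {j : ℤ} (h : pos q - s ≤ j)
    (h' : j < pos q) : lamp (dn q x s) j = x (pos q - 1 - j).toNat := if_pos ⟨h, h'⟩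

lemma lamp_dn_of_not_mem {q : Lamplighter F} (x : ℕ → F) {s : ℕ} {j : ℤ}
    (h : ¬ (pos q - s ≤ j ∧ j < pos q)) : lamp (dn q x s) j = lamp q j := if_neg h

/-- Concatenation of words. -/
def cat (a : ℕ) (x y : ℕ → F) (i : ℕ) : F := if i < a then x i else y (i - a)

@[simp] lemma dn_zero (q : Lamplighter F) (x : ℕ → F) : dn q x 0 = q :=
  ext_pt (fun i => by rw [lamp_dn, if_neg]; push_cast; omega) (by simp)

lemma dn_congr (q : Lamplighter F) {x y : ℕ → F} {s : ℕ} (h : ∀ i < s, x i = y i) :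
    dn q x s = dn q y s :=
  ext_pt (fun i => by
    rw [lamp_dn, lamp_dn]
    split_ifs with h1
    · exact h _ (by omega)
    · rfl) rfl

lemma dn_dn (q : Lamplighter F) (x y : ℕ → F) (a b : ℕ) :
    dn (dn q x a) y b = dn q (cat a x y) (a + b) := by
  refine ext_pt (fun i => ?_) (by simp; ring)
  by_cases h1 : pos q - a ≤ i ∧ i < pos q
  · rw [lamp_dn_of_not_mem _ (by rw [pos_dn]; omega), lamp_dn_of_mem _ h1.1 h1.2,
      lamp_dn_of_mem _ (by omega) h1.2, cat, if_pos (by omega)]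
  · by_cases h2 : pos q - a - b ≤ i ∧ i < pos q - a
    · rw [lamp_dn_of_mem _ (by rw [pos_dn]; omega) (by rw [pos_dn]; omega),
        lamp_dn_of_mem _ (by omega) (by omega), cat, if_neg (by omega), pos_dn]
      congr 1
      omega
    · rw [lamp_dn_of_not_mem _ (by rw [pos_dn]; omega), lamp_dn_of_not_mem _ h1,
        lamp_dn_of_not_mem _ (by omega)]

lemma dn_cat (q : Lamplighter F) (x y : ℕ → F) {a s : ℕ} (h : s ≤ a) :
    dn q (cat a x y) s = dn q x s :=
  dn_congr q fun i hi => by rw [cat, if_pos (by omega)]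

lemma lo_dn (q : Lamplighter F) (x : ℕ → F) (s : ℕ) : lo (dn q x s) q = pos q - s :=
  le_antisymm (by simpa using lo_le_left (dn q x s) q)
    (le_lo.2 ⟨by simp, by omega, fun i hi => by rw [lamp_dn, if_neg]; omega⟩)

lemma hi_dn (q : Lamplighter F) (x : ℕ → F) (s : ℕ) : hi (dn q x s) q = pos q :=
  le_antisymm (hi_le.2 ⟨by simp, le_rfl, fun i hi => by rw [lamp_dn, if_neg]; omega⟩)
    (right_le_hi (dn q x s) q)

@[simp] lemma len_dn (q : Lamplighter F) (x : ℕ → F) (s : ℕ) : len (dn q x s) q = s := by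
  rw [len, lo_dn, hi_dn]; ring
@[simp] lemma len_dn' (q : Lamplighter F) (x : ℕ → F) (s : ℕ) : len q (dn q x s) = s := by
  rw [len_comm, len_dn]

/-- The word read off `p` below the position of `q`. -/
def word (q p : Lamplighter F) (i : ℕ) : F := lamp p (pos q - 1 - i)

lemma eq_dn {p q : Lamplighter F} (h1 : pos p ≤ lo p q) (h2 : hi p q ≤ pos q) {s : ℕ}
    (hs : pos p = pos q - s) : p = dn q (word q p) s := by
  refine ext_pt (fun i => ?_) (by simpa using hs)
  rw [lamp_dn]
  split_ifs with h
  · rw [word]; congr 1; omega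
  · by_cases hi : i < pos q - s
    · exact lamp_eq_of_lt (by omega)
    · exact lamp_eq_of_le (by omega)

lemma dn_dn_sub (q : Lamplighter F) (x : ℕ → F) {a b : ℕ} (h : a ≤ b) :
    dn q x b = dn (dn q x a) (fun i => x (a + i)) (b - a) := by
  rw [dn_dn, Nat.add_sub_cancel' h]
  exact dn_congr q fun i _ => by
    unfold cat
    split_ifs with h
    · rfl
    · congr 1; omega

lemma len_dn_dn (q : Lamplighter F) (x : ℕ → F) {a b : ℕ} (h : a ≤ b) :
    len (dn q x a) (dn q x b) = b - a := by
  rw [dn_dn_sub q x h, len_dn']; omega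

end

section

variable {F F' : Type} [Group F'] [Fintype F'] [Group F] [Fintype F]

/-- Extend a finite word by the identity. -/
def extw {L : ℕ} (v : Fin L → F) (i : ℕ) : F := if h : i < L then v ⟨i, h⟩ else 1

/-- The average of a function over words of length `L`. -/
def EL (L : ℕ) (G : (ℕ → F) → ℝ) : ℝ := Finset.univ.expect fun v : Fin L → F => G (extw v)

lemma EL_mono {L : ℕ} {G G' : (ℕ → F) → ℝ} (h : ∀ x, G x ≤ G' x) : EL L G ≤ EL L G' :=
  Finset.expect_le_expect fun _ _ => h _

lemma EL_add (L : ℕ) (G G' : (ℕ → F) → ℝ) : EL L (fun x => G x + G' x) = EL L G + EL L G' :=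
  Finset.expect_add_distrib _ _ _

lemma EL_sub (L : ℕ) (G G' : (ℕ → F) → ℝ) : EL L (fun x => G x - G' x) = EL L G - EL L G' :=
  Finset.expect_sub_distrib _ _ _

lemma EL_mul (L : ℕ) (c : ℝ) (G : (ℕ → F) → ℝ) : EL L (fun x => c * G x) = c * EL L G :=
  (Finset.mul_expect _ _ _).symm

@[simp] lemma EL_const (L : ℕ) (c : ℝ) : EL (F := F) L (fun _ => c) = c :=
  Fintype.expect_const _

lemma EL_sum {ι : Type*} (s : Finset ι) (L : ℕ) (G : ι → (ℕ → F) → ℝ) :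
    EL L (fun x => ∑ i ∈ s, G i x) = ∑ i ∈ s, EL L (G i) := by
  simp only [EL]
  exact Finset.expect_sum_comm _ _ _

lemma extw_append {a b : ℕ} (v : Fin a → F) (w : Fin b → F) :
    extw (Fin.appendEquiv a b (v, w)) = cat a (extw v) (extw w) := by
  funext i
  simp only [extw, cat, Fin.appendEquiv]
  by_cases h : i < a
  · rw [if_pos h, dif_pos (by omega), dif_pos h]
    exact Fin.append_left v w ⟨i, h⟩
  · rw [if_neg h]
    by_cases h' : i < a + b
    · rw [dif_pos h', dif_pos (by omega)]
      have := Fin.append_right v w ⟨i - a, by omega⟩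
      rw [← this]
      exact congrArg (Fin.append v w) (Fin.ext (by simp; omega))
    · rw [dif_neg h', dif_neg (by omega)]

lemma EL_split (a b : ℕ) (G : (ℕ → F) → ℝ) :
    EL (a + b) G = EL a fun x => EL b fun y => G (cat a x y) := by
  simp only [EL]
  rw [← Fintype.expect_equiv (Fin.appendEquiv a b)
    (fun p : (Fin a → F) × (Fin b → F) => G (cat a (extw p.1) (extw p.2)))
    (fun v => G (extw v)) (fun p => by rw [← extw_append])]
  rw [← Finset.univ_product_univ, Finset.expect_product]

/-- A function depending only on the first `a` letters. -/
lemma EL_of_le {a L : ℕ} (h : a ≤ L) {G : (ℕ → F) → ℝ}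
    (hG : ∀ x y, (∀ i < a, x i = y i) → G x = G y) : EL L G = EL a G := by
  obtain ⟨b, rfl⟩ := Nat.exists_eq_add_of_le h
  rw [EL_split]
  congr 1
  funext x
  rw [show (fun y => G (cat a x y)) = fun _ => G x from funext fun y => hG _ _ fun i hi => by
    rw [cat, if_pos hi], EL_const]

lemma EL_comm (a b : ℕ) (G : (ℕ → F) → (ℕ → F') → ℝ) :
    EL a (fun x => EL b fun y => G x y) = EL b fun y => EL a fun x => G x y :=
  Finset.expect_comm _ _ _

open Classical in
/-- The probability of a property of words of length `L`. -/
def Pr (L : ℕ) (P : (ℕ → F) → Prop) : ℝ := EL L fun x => if P x then 1 else 0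

lemma Pr_mono {L : ℕ} {P Q : (ℕ → F) → Prop} (h : ∀ x, P x → Q x) : Pr L P ≤ Pr L Q := by
  classical
  refine EL_mono fun x => ?_
  by_cases hp : P x
  · simp [hp, h x hp]
  · rw [if_neg hp]; split_ifs <;> norm_num

lemma Pr_congr {L : ℕ} {P Q : (ℕ → F) → Prop} (h : ∀ x, P x ↔ Q x) : Pr L P = Pr L Q :=
  le_antisymm (Pr_mono fun x => (h x).1) (Pr_mono fun x => (h x).2)

lemma EL_nonneg {L : ℕ} {G : (ℕ → F) → ℝ} (h : ∀ x, 0 ≤ G x) : 0 ≤ EL L G :=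
  Finset.expect_nonneg fun _ _ => h _

lemma Pr_nonneg (L : ℕ) (P : (ℕ → F) → Prop) : 0 ≤ Pr L P :=
  EL_nonneg fun x => by split_ifs <;> norm_num

lemma Pr_le_one (L : ℕ) (P : (ℕ → F) → Prop) : Pr L P ≤ 1 := by
  classical
  calc Pr L P ≤ EL (F := F) L (fun _ => 1) := EL_mono fun x => by split_ifs <;> norm_num
    _ = 1 := EL_const _ _

lemma Pr_or (L : ℕ) (P Q : (ℕ → F) → Prop) : Pr L (fun x => P x ∨ Q x) ≤ Pr L P + Pr L Q := by
  classical
  rw [Pr, Pr, Pr, ← EL_add]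
  refine EL_mono fun x => ?_
  by_cases hp : P x <;> by_cases hq : Q x <;> simp [hp, hq]

lemma Pr_not (L : ℕ) (P : (ℕ → F) → Prop) : Pr L (fun x => ¬ P x) = 1 - Pr L P := by
  classical
  rw [eq_sub_iff_add_eq, Pr, Pr, ← EL_add, ← EL_const (F := F) L 1]
  congr 1
  funext x
  by_cases hp : P x <;> simp [hp]

lemma Pr_exists {ι : Type*} (s : Finset ι) (L : ℕ) (P : ι → (ℕ → F) → Prop) :
    Pr L (fun x => ∃ i ∈ s, P i x) ≤ ∑ i ∈ s, Pr L (P i) := by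
  classical
  simp only [Pr]
  rw [← EL_sum]
  refine EL_mono fun x => ?_
  split_ifs with h
  · obtain ⟨i, hi, hp⟩ := h
    calc (1 : ℝ) = if P i x then 1 else 0 := by rw [if_pos hp]
      _ ≤ _ := Finset.single_le_sum (f := fun i => if P i x then (1 : ℝ) else 0)
        (fun j _ => by split_ifs <;> norm_num) hi
  · exact Finset.sum_nonneg fun j _ => by split_ifs <;> norm_num

lemma Pr_le_EL {L : ℕ} {P : (ℕ → F) → Prop} {G : (ℕ → F) → ℝ} {d : ℝ} (hG : ∀ x, 0 ≤ G x)
    (h : ∀ x, P x → d ≤ G x) : d * Pr L P ≤ EL L G := by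
  classical
  rw [Pr, ← EL_mul]
  refine EL_mono fun x => ?_
  by_cases hp : P x
  · simpa [hp] using h x hp
  · simpa [hp] using hG x

lemma EL_le_of_Pr {L : ℕ} {P : (ℕ → F) → Prop} {G : (ℕ → F) → ℝ} {d M : ℝ}
    (hM : ∀ x, G x ≤ M) (h : ∀ x, ¬ P x → G x ≤ d) (hd : 0 ≤ d) :
    EL L G ≤ d + M * Pr L P := by
  classical
  rw [Pr, ← EL_mul]
  refine le_of_le_of_eq ?_ (congrArg (· + _) (EL_const (F := F) L d))
  rw [← EL_add]
  refine EL_mono fun x => ?_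
  by_cases hp : P x
  · simpa [hp] using (hM x).trans (by linarith)
  · simpa [hp] using h x hp

lemma exists_of_Pr_pos {L : ℕ} {P : (ℕ → F) → Prop} (h : 0 < Pr L P) : ∃ x, P x := by
  classical
  by_contra! hc
  rw [Pr] at h
  simp [hc] at h

lemma Pr_split (a b : ℕ) (P : (ℕ → F) → Prop) :
    Pr (a + b) P = EL a fun x => Pr b fun y => P (cat a x y) := EL_split _ _ _

lemma Pr_of_le {a L : ℕ} (h : a ≤ L) {P : (ℕ → F) → Prop}
    (hP : ∀ x y, (∀ i < a, x i = y i) → (P x ↔ P y)) : Pr L P = Pr a P := by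
  classical
  exact EL_of_le h fun x y hxy => by simp only [hP x y hxy]

/-- Probabilities as cardinalities. -/
lemma Pr_eq_card (L : ℕ) (P : (ℕ → F) → Prop) :
    Pr L P * (Fintype.card F : ℝ) ^ L = (Nat.card {v : Fin L → F // P (extw v)} : ℝ) := by
  classical
  rw [Pr, EL, Fintype.expect_eq_sum_div_card, Nat.card_eq_fintype_card, Fintype.card_subtype]
  rw [Finset.sum_boole]
  have : (Fintype.card (Fin L → F) : ℝ) = (Fintype.card F : ℝ) ^ L := by simp
  rw [this, div_mul_cancel₀]
  have : 0 < Fintype.card F := Fintype.card_pos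
  positivity

end

section

variable {F F' : Type} [Group F] [Group F'] [Fintype F] [Fintype F']

lemma card_le_of_window {I : Type*} [Fintype I] (P A : I → ℤ) (base : I → ℤ → F) (l : ℕ)
    (s : Finset (Lamplighter F)) (h : ∀ e ∈ s, ∃ i, pos e = P i ∧
      ∀ j, ¬ (A i ≤ j ∧ j < A i + l) → lamp e j = base i j) :
    s.card ≤ Fintype.card I * Fintype.card F ^ l := by
  classical
  rcases s.eq_empty_or_nonempty with rfl | ⟨e0, he0⟩
  · simp
  have : Nonempty I := ⟨(h e0 he0).choose⟩
  choose! g hg1 hg2 using h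
  have : s.card ≤ (Finset.univ : Finset (I × (Fin l → F))).card := by
    refine Finset.card_le_card_of_injOn (fun e => (g e, fun k => lamp e (A (g e) + k)))
      (fun _ _ => Finset.mem_coe.2 (Finset.mem_univ _)) fun e he e' he' heq => ?_
    obtain ⟨h1, h2⟩ := Prod.mk.inj heq
    refine ext_pt (fun j => ?_) (by rw [hg1 e he, hg1 e' he', h1])
    by_cases hj : A (g e) ≤ j ∧ j < A (g e) + l
    · have h3 := congrFun h2 ⟨(j - A (g e)).toNat, by omega⟩
      simp only [← h1] at h3
      rwa [Int.toNat_of_nonneg (by omega), add_sub_cancel] at h3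
    · rw [hg2 e he j hj, hg2 e' he' j (by rwa [← h1]), h1]
  simpa using this

lemma card_ball_le (p : Lamplighter F) (x : ℕ) (s : Finset (Lamplighter F))
    (h : ∀ e ∈ s, len p e ≤ x) : s.card ≤ (x + 1) ^ 2 * Fintype.card F ^ x := by
  have := card_le_of_window (I := Fin (x + 1) × Fin (x + 1))
    (fun i => pos p - i.1 + i.2) (fun i => pos p - i.1) (fun _ => lamp p) x s
    (fun e he => by
      have h1 := lo_le_left p e
      have h2 := lo_le_right p e
      have h3 := left_le_hi p e
      have h4 := right_le_hi p e
      have h5 := h e he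
      unfold len at h5
      refine ⟨(⟨(pos p - lo p e).toNat, by omega⟩, ⟨(pos e - lo p e).toNat, by omega⟩), ?_, ?_⟩
      · simp only
        omega
      · intro j hj
        simp only at hj
        by_cases hlt : j < lo p e
        · exact (lamp_eq_of_lt hlt).symm
        · exact (lamp_eq_of_le (by omega)).symm)
  simpa [sq] using this

/-- A bound for the multiplicity of a quasi-isometry with constant `K`. -/
def mult (F : Type) [Fintype F] (K : ℤ) : ℕ :=
  ((3 * K).toNat + 1) ^ 2 * Fintype.card F ^ (3 * K).toNat

lemma mult_pos (F : Type) [Group F] [Fintype F] (K : ℤ) : 0 < mult F K := by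
  have : 0 < Fintype.card F := Fintype.card_pos
  unfold mult
  positivity

lemma QIPair.card_fiber_le {K : ℤ} {φ : Lamplighter F → Lamplighter F'}
    {ψ : Lamplighter F' → Lamplighter F} (h : QIPair K φ ψ) (s : Finset (Lamplighter F))
    (e : Lamplighter F') (hs : ∀ p ∈ s, φ p = e) : s.card ≤ mult F K := by
  rcases s.eq_empty_or_nonempty with rfl | ⟨p, hp⟩
  · simp
  · refine card_ball_le p _ s fun p' hp' => ?_
    have := h.lower p p'
    rw [hs p hp, hs p' hp', len_self] at this
    omega

lemma QIPair.card_le [DecidableEq (Lamplighter F')] {K : ℤ} {φ : Lamplighter F → Lamplighter F'}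
    {ψ : Lamplighter F' → Lamplighter F} (h : QIPair K φ ψ) (s : Finset (Lamplighter F)) :
    s.card ≤ mult F K * (s.image φ).card :=
  Finset.card_le_mul_card_image s _ fun e _ =>
    h.card_fiber_le _ e fun _ hp => (Finset.mem_filter.1 hp).2

lemma dn_injective (q : Lamplighter F) (L : ℕ) :
    Function.Injective fun v : Fin L → F => dn q (extw v) L := by
  intro v w hvw
  funext k
  have := congrArg (fun p => lamp p (pos q - 1 - k)) hvw
  simp only at this
  rw [lamp_dn_of_mem _ (by omega) (by omega), lamp_dn_of_mem _ (by omega) (by omega)] at this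
  have hk : (pos q - 1 - (pos q - 1 - (k : ℤ))).toNat = k := by omega
  simpa [extw, hk] using this

lemma Pr_dn_le (q : Lamplighter F) (L : ℕ) (S : Lamplighter F → Prop) (N : ℕ)
    (h : ∀ s : Finset (Lamplighter F), (∀ p ∈ s, S p ∧ ∃ x, p = dn q x L) → s.card ≤ N) :
    Pr L (fun x => S (dn q x L)) * (Fintype.card F : ℝ) ^ L ≤ N := by
  classical
  rw [Pr_eq_card, Nat.card_eq_fintype_card, Fintype.card_subtype]
  norm_cast
  rw [← Finset.card_image_of_injective _ (dn_injective q L)]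
  refine h _ fun p hp => ?_
  obtain ⟨v, hv, rfl⟩ := Finset.mem_image.1 hp
  exact ⟨(Finset.mem_filter.1 hv).2, _, rfl⟩

/-- The ratio of logarithms of the orders of the lamp groups. -/
def rate (F F' : Type) [Fintype F] [Fintype F'] : ℝ :=
  Real.log (Fintype.card F) / Real.log (Fintype.card F')

lemma rate_pos (hF : 2 ≤ Fintype.card F) (hF' : 2 ≤ Fintype.card F') : 0 < rate F F' :=
  div_pos (Real.log_pos (by exact_mod_cast hF)) (Real.log_pos (by exact_mod_cast hF'))

lemma rate_mul_rate (hF : 2 ≤ Fintype.card F) (hF' : 2 ≤ Fintype.card F') :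
    rate F F' * rate F' F = 1 := by
  have h1 : 0 < Real.log (Fintype.card F) := Real.log_pos (by exact_mod_cast hF)
  have h2 : 0 < Real.log (Fintype.card F') := Real.log_pos (by exact_mod_cast hF')
  unfold rate
  field_simp

lemma rpow_rate (hF : 2 ≤ Fintype.card F) (hF' : 2 ≤ Fintype.card F') :
    (Fintype.card F' : ℝ) ^ rate F F' = Fintype.card F := by
  have h1 : (1 : ℝ) < Fintype.card F := by exact_mod_cast hF
  have h2 : (1 : ℝ) < Fintype.card F' := by exact_mod_cast hF'
  have h3 := Real.log_pos h2
  rw [Real.rpow_def_of_pos (by linarith), rate, mul_div_cancel₀ _ h3.ne',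
    Real.exp_log (by linarith)]

lemma tendsto_sq_mul_rpow {a b ε : ℝ} (hb : 1 < b) (hε : 0 < ε) :
    Filter.Tendsto (fun L : ℕ => (a * L + 1) ^ 2 * b ^ (-ε * L)) Filter.atTop (nhds 0) := by
  set r : ℝ := b ^ (-ε) with hr
  have hr0 : 0 ≤ r := Real.rpow_nonneg (by linarith) _
  have hr1 : r < 1 := Real.rpow_lt_one_of_one_lt_of_neg hb (by linarith)
  have h2 := (tendsto_pow_const_mul_const_pow_of_lt_one 2 hr0 hr1).const_mul (a ^ 2)
  have h1 := (tendsto_pow_const_mul_const_pow_of_lt_one 1 hr0 hr1).const_mul (2 * a)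
  have h0 := tendsto_pow_atTop_nhds_zero_of_lt_one hr0 hr1
  have := (h2.add h1).add h0
  simp only [mul_zero, add_zero] at this
  refine this.congr fun L => ?_
  rw [Real.rpow_mul (by linarith), ← hr, Real.rpow_natCast]
  ring

/-- The images of a point and of a typical point below it are far apart. -/
theorem QIPair.lower_bound {K : ℤ} {φ : Lamplighter F → Lamplighter F'}
    {ψ : Lamplighter F' → Lamplighter F} (h : QIPair K φ ψ) (hF : 2 ≤ Fintype.card F)
    (hF' : 2 ≤ Fintype.card F') {ε η : ℝ} (hε : 0 < ε) (hη : 0 < η) :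
    ∃ L0 : ℕ, ∀ L ≥ L0, ∀ q,
      Pr L (fun x => (len (φ q) (φ (dn q x L)) : ℝ) ≤ (rate F F' - ε) * L) ≤ η := by
  classical
  have hm : (1 : ℝ) < Fintype.card F' := by exact_mod_cast hF'
  have hc := rate_pos hF hF'
  have hM : (0 : ℝ) < mult F K := by exact_mod_cast mult_pos F K
  have ht := (tendsto_sq_mul_rpow (a := rate F F') hm hε).eventually_lt_const
    (show (0 : ℝ) < η / mult F K by positivity)
  obtain ⟨L0, hL0⟩ := Filter.eventually_atTop.1 ht
  refine ⟨L0, fun L hL q => ?_⟩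
  have hL1 := hL0 L hL
  by_cases hneg : (rate F F' - ε) * L < 0
  · have : Pr L (fun x => (len (φ q) (φ (dn q x L)) : ℝ) ≤ (rate F F' - ε) * L) ≤
        Pr (F := F) L (fun _ => False) := Pr_mono fun x hx => by
      have : (0 : ℝ) ≤ len (φ q) (φ (dn q x L)) := by exact_mod_cast len_nonneg _ _
      linarith
    refine this.trans ?_
    simp only [Pr, if_false, EL_const]
    exact hη.le
  push Not at hneg
  set x : ℕ := ⌊(rate F F' - ε) * L⌋₊ with hx
  have hxle : (x : ℝ) ≤ (rate F F' - ε) * L := Nat.floor_le hneg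
  have key := Pr_dn_le q L (fun p => (len (φ q) (φ p) : ℝ) ≤ (rate F F' - ε) * L)
    (mult F K * ((x + 1) ^ 2 * Fintype.card F' ^ x)) (fun s hs => by
      refine (h.card_le s).trans (Nat.mul_le_mul_left _ (card_ball_le (φ q) x _ fun e he => ?_))
      obtain ⟨p, hp, rfl⟩ := Finset.mem_image.1 he
      have h1 := (hs p hp).1
      have h2 := len_nonneg (φ q) (φ p)
      have h3 : ((len (φ q) (φ p)).toNat : ℝ) ≤ (rate F F' - ε) * L := by
        have : (((len (φ q) (φ p)).toNat : ℤ) : ℝ) = len (φ q) (φ p) := by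
          rw [Int.toNat_of_nonneg h2]
        rw [← this] at h1
        exact_mod_cast h1
      have h4 := Nat.le_floor h3
      omega)
  push_cast at key
  have hn : (0 : ℝ) < (Fintype.card F : ℝ) ^ L := by
    have : (0 : ℝ) < Fintype.card F := by exact_mod_cast Fintype.card_pos
    positivity
  rw [← le_div_iff₀ hn] at key
  refine key.trans ?_
  rw [div_le_iff₀ hn]
  have h5 : (Fintype.card F' : ℝ) ^ x ≤
      (Fintype.card F' : ℝ) ^ (-ε * L) * (Fintype.card F : ℝ) ^ L := by
    rw [← rpow_rate hF hF', ← Real.rpow_natCast, ← Real.rpow_natCast, ← Real.rpow_mul (by linarith),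
      ← Real.rpow_add (by linarith)]
    exact Real.rpow_le_rpow_of_exponent_le hm.le (by linarith)
  have h6 : ((x : ℝ) + 1) ^ 2 ≤ (rate F F' * L + 1) ^ 2 := by
    have : (0 : ℝ) ≤ ε * L := by positivity
    exact pow_le_pow_left₀ (by positivity) (by linarith) 2
  rw [lt_div_iff₀ hM] at hL1
  calc (mult F K : ℝ) * (((x : ℝ) + 1) ^ 2 * (Fintype.card F' : ℝ) ^ x)
      ≤ mult F K * ((rate F F' * L + 1) ^ 2 *
        ((Fintype.card F' : ℝ) ^ (-ε * L) * (Fintype.card F : ℝ) ^ L)) := by gcongr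
    _ = ((rate F F' * L + 1) ^ 2 * (Fintype.card F' : ℝ) ^ (-ε * L) * mult F K) *
        (Fintype.card F : ℝ) ^ L := by ring
    _ ≤ η * (Fintype.card F : ℝ) ^ L := by gcongr

end

section

variable {F F' : Type} [Group F'] [Fintype F'] [Group F] [Fintype F]

/-- Four points almost on a geodesic: the middle segment is monotone. -/
lemma four_points (e0 e1 e2 e3 : Lamplighter F) (d : ℤ)
    (hsum : len e0 e1 + len e1 e2 + len e2 e3 ≤ len e0 e3 + d)
    (h01 : 3 * d < len e0 e1) (h12 : 3 * d < len e1 e2) (h23 : 3 * d < len e2 e3) :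
    (pos e1 - d ≤ lo e1 e2 ∧ hi e1 e2 ≤ pos e2 + d ∧ hi e0 e1 ≤ pos e1 + d ∧
      pos e2 - d ≤ lo e2 e3) ∨
    (hi e1 e2 ≤ pos e1 + d ∧ pos e2 - d ≤ lo e1 e2 ∧ pos e1 - d ≤ lo e0 e1 ∧
      hi e2 e3 ≤ pos e2 + d) := by
  have a1 := lo_tri e0 e1 e3
  have a2 := lo_tri e1 e2 e3
  have a3 := hi_tri e0 e1 e3
  have a4 := hi_tri e1 e2 e3
  have b1 := lo_le_right e0 e1
  have b2 := lo_le_left e1 e2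
  have b3 := lo_le_right e1 e2
  have b4 := lo_le_left e2 e3
  have c1 := right_le_hi e0 e1
  have c2 := left_le_hi e1 e2
  have c3 := right_le_hi e1 e2
  have c4 := left_le_hi e2 e3
  unfold len at *
  generalize lo e0 e1 = l01 at *
  generalize lo e1 e2 = l12 at *
  generalize lo e2 e3 = l23 at *
  generalize hi e0 e1 = h01' at *
  generalize hi e1 e2 = h12' at *
  generalize hi e2 e3 = h23' at *
  omega

lemma Pr_prefix_le (k L : ℕ) (h : k ≤ L) (x : ℕ → F) :
    Pr L (fun y => ∀ i < k, y i = x i) ≤ ((Fintype.card F : ℝ) ^ k)⁻¹ := by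
  rw [Pr_of_le h (fun y z hyz => forall₂_congr fun i hi => by rw [hyz i hi])]
  have hn : (0 : ℝ) < (Fintype.card F : ℝ) ^ k := by
    have : (0 : ℝ) < Fintype.card F := by exact_mod_cast Fintype.card_pos
    positivity
  rw [← one_div, le_div_iff₀ hn, Pr_eq_card]
  have : Subsingleton {v : Fin k → F // ∀ i < k, extw v i = x i} :=
    ⟨fun v w => Subtype.ext (funext fun i => by
      have h1 := v.2 i i.2
      have h2 := w.2 i i.2
      simp only [extw, i.2, dif_pos] at h1 h2
      exact h1.trans h2.symm)⟩
  exact_mod_cast Finite.card_le_one_iff_subsingleton.2 this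

lemma le_len_dn_of_ne (q : Lamplighter F) {x y : ℕ → F} {s i : ℕ} (hi' : i < s)
    (h : x i ≠ y i) : (s : ℤ) - i ≤ len (dn q x s) (dn q y s) := by
  have h1 := lo_le_left (dn q x s) (dn q y s)
  have h2 : pos q - i ≤ hi (dn q x s) (dn q y s) := by
    by_contra hc
    apply h
    have := lamp_eq_of_le (p := dn q x s) (q := dn q y s) (i := pos q - 1 - i) (by omega)
    rw [lamp_dn_of_mem _ (by omega) (by omega), lamp_dn_of_mem _ (by omega) (by omega)] at this
    rwa [show (pos q - 1 - (pos q - 1 - (i : ℤ))).toNat = i by omega] at this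
  rw [pos_dn] at h1
  unfold len
  omega

lemma QIPair.lower_lt {K : ℤ} {φ : Lamplighter F → Lamplighter F'}
    {ψ : Lamplighter F' → Lamplighter F} (h : QIPair K φ ψ) {p q : Lamplighter F} {d : ℤ}
    (hd : K * d + 3 * K < len p q) : d < len (φ p) (φ q) := by
  have h1 := h.lower p q
  have h2 := h.one_le
  by_contra hc
  push Not at hc
  have : K * len (φ p) (φ q) ≤ K * d := mul_le_mul_of_nonneg_left hc (by omega)
  omega

lemma QIPair.abs_pos_sub_le {K : ℤ} {φ : Lamplighter F → Lamplighter F'}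
    {ψ : Lamplighter F' → Lamplighter F} (h : QIPair K φ ψ) (q : Lamplighter F) (x : ℕ → F)
    {s L : ℕ} (hs : s ≤ L) : |pos (φ (dn q x s)) - pos (φ q)| ≤ K * L + K := by
  have h1 := abs_pos_le_len (φ (dn q x s)) (φ q)
  have h2 := h.len_left (dn q x s) q
  have h3 := h.one_le
  rw [len_dn] at h2
  have : K * (s : ℤ) ≤ K * L := mul_le_mul_of_nonneg_left (by exact_mod_cast hs) (by omega)
  omega

/-- If the bottoms of a tree of height `L` are mostly close to each other compared with their
distance to the top, then the images of branches are mostly not straight. -/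
theorem QIPair.tree {K : ℤ} {φ : Lamplighter F → Lamplighter F'}
    {ψ : Lamplighter F' → Lamplighter F} (h : QIPair K φ ψ) (q : Lamplighter F)
    {s L k : ℕ} {d R η : ℤ} {b : ℕ} {θ : ℝ} (hθ : 0 ≤ θ) (hsL : 3 * s ≤ L) (hd : 0 ≤ d) (hη : 0 < η)
    (hb : K * L + K ≤ b * η) (hs : k + K * (η + 2 * d) + 3 * K < s)
    (hs3 : K * (3 * d) + 3 * K < s) (S : (ℕ → F) → Prop)
    (hdef : ∀ x, S x → len (φ q) (φ (dn q x s)) + len (φ (dn q x s)) (φ (dn q x (L - s))) +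
      len (φ (dn q x (L - s))) (φ (dn q x L)) ≤ len (φ q) (φ (dn q x L)) + d)
    (hfar : ∀ x, S x → R + 2 * (K * s + K) + 4 * d + η ≤ len (φ q) (φ (dn q x L)))
    (hclose : ∀ x, S x → Pr L (fun y => ¬ (|pos (φ (dn q x L)) - pos (φ (dn q y L))| ≤ η →
      pos (φ (dn q x L)) - R ≤ lo (φ (dn q x L)) (φ (dn q y L)) ∧
      hi (φ (dn q x L)) (φ (dn q y L)) ≤ pos (φ (dn q x L)) + R)) ≤ θ) :
    Pr L S ≤ 2 * (2 * b + 1) ^ 2 * (θ + ((Fintype.card F : ℝ) ^ k)⁻¹) := by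
  classical
  have hK := h.one_le
  have hksr : (k : ℤ) < s := by
    have : 0 ≤ K * (η + 2 * d) := by positivity
    omega
  have hfour : ∀ x, S x → _ := fun x hx =>
    four_points (φ q) (φ (dn q x s)) (φ (dn q x (L - s))) (φ (dn q x L)) d (hdef x hx)
      (h.lower_lt (by rw [len_dn']; omega))
      (h.lower_lt (by rw [len_dn_dn _ _ (by omega)]; omega))
      (h.lower_lt (by rw [len_dn_dn _ _ (by omega)]; omega))
  set W : (ℕ → F) → ℤ := fun x => pos (φ (dn q x L)) - pos (φ q) with hW
  set Z : (ℕ → F) → ℤ := fun x => pos (φ (dn q x s)) - pos (φ q) with hZ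
  set up : (ℕ → F) → Prop := fun x =>
    pos (φ (dn q x s)) - d ≤ lo (φ (dn q x s)) (φ (dn q x (L - s))) ∧
    hi (φ (dn q x s)) (φ (dn q x (L - s))) ≤ pos (φ (dn q x (L - s))) + d ∧
    hi (φ q) (φ (dn q x s)) ≤ pos (φ (dn q x s)) + d ∧
    pos (φ (dn q x (L - s))) - d ≤ lo (φ (dn q x (L - s))) (φ (dn q x L)) with hup
  set I := (Finset.Icc (-b : ℤ) b ×ˢ Finset.Icc (-b : ℤ) b) ×ˢ (Finset.univ : Finset Bool)
  set P : (ℤ × ℤ) × Bool → (ℕ → F) → Prop := fun i x =>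
    S x ∧ W x / η = i.1.1 ∧ Z x / η = i.1.2 ∧ decide (up x) = i.2 with hP
  have hcover : ∀ x, S x → ∃ i ∈ I, P i x := by
    intro x hx
    refine ⟨((W x / η, Z x / η), decide (up x)), ?_, hx, rfl, rfl, rfl⟩
    have h1 := abs_le.1 (h.abs_pos_sub_le q x (le_refl L))
    have h2 := abs_le.1 (h.abs_pos_sub_le q x (show s ≤ L by omega))
    simp only [I, Finset.mem_product, Finset.mem_Icc, Finset.mem_univ, and_true]
    refine ⟨⟨Int.le_ediv_of_mul_le hη ?_, ?_⟩, Int.le_ediv_of_mul_le hη ?_, ?_⟩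
    · simp only [hW]; linarith
    · exact Int.lt_add_one_iff.1 (Int.ediv_lt_of_lt_mul hη (by simp only [hW]; linarith))
    · simp only [hZ]; linarith
    · exact Int.lt_add_one_iff.1 (Int.ediv_lt_of_lt_mul hη (by simp only [hZ]; linarith))
  have hclass : ∀ i ∈ I, Pr L (P i) ≤ θ + ((Fintype.card F : ℝ) ^ k)⁻¹ := by
    intro i _
    by_contra! hlt
    have hpos : 0 < Pr L (P i) := by
      have : (0 : ℝ) ≤ ((Fintype.card F : ℝ) ^ k)⁻¹ := by positivity
      linarith
    obtain ⟨x, hx⟩ := exists_of_Pr_pos hpos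
    have h1 := Pr_or L (fun y => ¬ (|pos (φ (dn q x L)) - pos (φ (dn q y L))| ≤ η →
      pos (φ (dn q x L)) - R ≤ lo (φ (dn q x L)) (φ (dn q y L)) ∧
      hi (φ (dn q x L)) (φ (dn q y L)) ≤ pos (φ (dn q x L)) + R)) (fun y => ∀ i < k, y i = x i)
    have h2 := Pr_prefix_le k L (by omega) x
    have h3 := hclose x hx.1
    obtain ⟨y, hy, hy'⟩ : ∃ y, P i y ∧ ¬ (¬ (|pos (φ (dn q x L)) - pos (φ (dn q y L))| ≤ η →
      pos (φ (dn q x L)) - R ≤ lo (φ (dn q x L)) (φ (dn q y L)) ∧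
      hi (φ (dn q x L)) (φ (dn q y L)) ≤ pos (φ (dn q x L)) + R) ∨ ∀ i < k, y i = x i) := by
      by_contra hc
      have := Pr_mono (L := L) fun y (hy : P i y) => by_contra fun hn => hc ⟨y, hy, hn⟩
      linarith
    rw [not_or, not_not] at hy'
    obtain ⟨hy1, hy2⟩ := hy'
    push Not at hy2
    obtain ⟨j, hjk, hj⟩ := hy2
    obtain ⟨hSx, hWx, hZx, hux⟩ := hx
    obtain ⟨hSy, hWy, hZy, huy⟩ := hy
    have hbin : ∀ a c : ℤ, a / η = c / η → |a - c| ≤ η := by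
      intro a c hac
      have e1 := Int.mul_ediv_add_emod a η
      have e2 := Int.mul_ediv_add_emod c η
      have e3 := Int.emod_nonneg a hη.ne'
      have e4 := Int.emod_nonneg c hη.ne'
      have e5 := Int.emod_lt_of_pos a hη
      have e6 := Int.emod_lt_of_pos c hη
      rw [hac] at e1
      rw [abs_le]
      constructor <;> linarith
    have hWxy := hbin (W x) (W y) (hWx.trans hWy.symm)
    have hZxy := hbin (Z x) (Z y) (hZx.trans hZy.symm)
    simp only [hW, hZ, sub_sub_sub_cancel_right] at hWxy hZxy
    have hcl := hy1 hWxy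
    rw [abs_le] at hWxy hZxy
    have hupxy : up x ↔ up y := by
      have := hux.trans huy.symm
      simpa using this
    have hcontra : len (φ (dn q x s)) (φ (dn q y s)) ≤ η + 2 * d := by
      have fx := hfour x hSx
      have fy := hfour y hSy
      have gx := hfar x hSx
      have wx : 3 * d < len (φ (dn q x s)) (φ (dn q x (L - s))) :=
        h.lower_lt (by rw [len_dn_dn _ _ (by omega)]; omega)
      have wy : 3 * d < len (φ (dn q y s)) (φ (dn q y (L - s))) :=
        h.lower_lt (by rw [len_dn_dn _ _ (by omega)]; omega)
      have t1 := len_tri (φ q) (φ (dn q x s)) (φ (dn q x L))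
      have t2 := len_tri (φ (dn q x s)) (φ (dn q x (L - s))) (φ (dn q x L))
      have u1 := h.len_left q (dn q x s)
      have u2 := h.len_left (dn q x (L - s)) (dn q x L)
      rw [len_dn'] at u1
      rw [len_dn_dn _ _ (by omega)] at u2
      rw [Nat.cast_sub (by omega), sub_sub_cancel] at u2
      have v1 := lo_le_right (φ (dn q x (L - s))) (φ (dn q x L))
      have v2 := right_le_hi (φ (dn q x (L - s))) (φ (dn q x L))
      have hlo : min (pos (φ (dn q x s))) (pos (φ (dn q y s))) - d ≤
          lo (φ (dn q x s)) (φ (dn q y s)) := by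
        by_cases hu : up x
        · have hu' := hupxy.1 hu
          have r1 := lo_tri (φ (dn q x s)) (φ (dn q x (L - s))) (φ (dn q x L))
          have r2 := lo_tri (φ (dn q y s)) (φ (dn q y (L - s))) (φ (dn q y L))
          have r3 := lo_tri (φ (dn q x s)) (φ (dn q x L)) (φ (dn q y s))
          have r4 := lo_tri (φ (dn q x L)) (φ (dn q y L)) (φ (dn q y s))
          rw [lo_comm (φ (dn q y L)) (φ (dn q y s))] at r4
          simp only [hup] at hu hu'
          unfold len at *
          omega
        · have hu' := mt hupxy.2 hu
          replace fx := fx.resolve_left hu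
          replace fy := fy.resolve_left hu'
          have r1 := lo_tri (φ (dn q x s)) (φ q) (φ (dn q y s))
          rw [lo_comm (φ (dn q x s)) (φ q)] at r1
          omega
      have hhi : hi (φ (dn q x s)) (φ (dn q y s)) ≤
          max (pos (φ (dn q x s))) (pos (φ (dn q y s))) + d := by
        by_cases hu : up x
        · have hu' := hupxy.1 hu
          have r1 := hi_tri (φ (dn q x s)) (φ q) (φ (dn q y s))
          rw [hi_comm (φ (dn q x s)) (φ q)] at r1
          simp only [hup] at hu hu'
          omega
        · have hu' := mt hupxy.2 hu
          replace fx := fx.resolve_left hu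
          replace fy := fy.resolve_left hu'
          have r1 := hi_tri (φ (dn q x s)) (φ (dn q x (L - s))) (φ (dn q x L))
          have r2 := hi_tri (φ (dn q y s)) (φ (dn q y (L - s))) (φ (dn q y L))
          have r3 := hi_tri (φ (dn q x s)) (φ (dn q x L)) (φ (dn q y s))
          have r4 := hi_tri (φ (dn q x L)) (φ (dn q y L)) (φ (dn q y s))
          rw [hi_comm (φ (dn q y L)) (φ (dn q y s))] at r4
          unfold len at *
          omega
      unfold len
      omega
    have hne := le_len_dn_of_ne q (x := y) (y := x) (show j < s by omega) hj
    have hlow := h.lower (dn q x s) (dn q y s)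
    rw [len_comm] at hne
    have : K * len (φ (dn q x s)) (φ (dn q y s)) ≤ K * (η + 2 * d) :=
      mul_le_mul_of_nonneg_left hcontra (by omega)
    omega
  calc Pr L S ≤ Pr L (fun x => ∃ i ∈ I, P i x) := Pr_mono hcover
    _ ≤ ∑ i ∈ I, Pr L (P i) := Pr_exists _ _ _
    _ ≤ ∑ i ∈ I, (θ + ((Fintype.card F : ℝ) ^ k)⁻¹) := Finset.sum_le_sum hclass
    _ = 2 * (2 * b + 1) ^ 2 * (θ + ((Fintype.card F : ℝ) ^ k)⁻¹) := by
      rw [Finset.sum_const, nsmul_eq_mul]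
      congr 1
      simp only [I, Finset.card_product, Int.card_Icc, Finset.card_univ, Fintype.card_bool]
      have : ((b : ℤ) + 1 - -b).toNat = 2 * b + 1 := by omega
      rw [this]
      push_cast
      ring

end

section

variable {F F' : Type} [Group F'] [Fintype F'] [Group F] [Fintype F]

/-- Bounded functions. -/
def Bd {X : Type} (g : X → ℝ) : Prop := ∃ C, ∀ p, |g p| ≤ C

lemma Bd.add {X : Type} {g g' : X → ℝ} (h : Bd g) (h' : Bd g') : Bd fun p => g p + g' p := by
  obtain ⟨C, hC⟩ := h
  obtain ⟨C', hC'⟩ := h'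
  exact ⟨C + C', fun p => (abs_add_le _ _).trans (add_le_add (hC p) (hC' p))⟩

lemma Bd.mul {X : Type} {g g' : X → ℝ} (h : Bd g) (h' : Bd g') : Bd fun p => g p * g' p := by
  obtain ⟨C, hC⟩ := h
  obtain ⟨C', hC'⟩ := h'
  refine ⟨C * C', fun p => ?_⟩
  rw [abs_mul]
  exact mul_le_mul (hC p) (hC' p) (abs_nonneg _) ((abs_nonneg _).trans (hC p))

lemma Bd.const {X : Type} (c : ℝ) : Bd fun _ : X => c := ⟨|c|, fun _ => le_rfl⟩

lemma Bd.sub {X : Type} {g g' : X → ℝ} (h : Bd g) (h' : Bd g') : Bd fun p => g p - g' p := by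
  simpa [sub_eq_add_neg] using h.add ((Bd.const (-1)).mul h')

lemma Bd.comp {X Y : Type} {g : X → ℝ} (h : Bd g) (f : Y → X) : Bd fun p => g (f p) :=
  h.imp fun _ hC p => hC (f p)

lemma Bd.sum {X ι : Type} (s : Finset ι) {g : ι → X → ℝ} (h : ∀ i ∈ s, Bd (g i)) :
    Bd fun p => ∑ i ∈ s, g i p := by
  classical
  induction s using Finset.induction_on with
  | empty => simpa using Bd.const 0
  | insert a s ha ih =>
    simp only [Finset.sum_insert ha]
    exact (h _ (Finset.mem_insert_self _ _)).add
      (ih fun i hi => h i (Finset.mem_insert_of_mem hi))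

lemma abs_EL_le {L : ℕ} {G : (ℕ → F) → ℝ} {C : ℝ} (h : ∀ x, |G x| ≤ C) : |EL L G| ≤ C := by
  rw [abs_le]
  constructor
  · rw [← EL_const (F := F) L (-C)]
    exact EL_mono fun x => (abs_le.1 (h x)).1
  · rw [← EL_const (F := F) L C]
    exact EL_mono fun x => (abs_le.1 (h x)).2

lemma Bd.EL {X : Type} (L : ℕ) {G : X → (ℕ → F) → ℝ} {C : ℝ} (h : ∀ p x, |G p x| ≤ C) :
    Bd fun p => Lamp.EL L (G p) := ⟨C, fun p => abs_EL_le (h p)⟩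

lemma Bd.Pr {X : Type} (L : ℕ) (P : X → (ℕ → F) → Prop) : Bd fun p => Lamp.Pr L (P p) :=
  ⟨1, fun p => abs_le.2 ⟨by linarith [Pr_nonneg L (P p)], Pr_le_one _ _⟩⟩

/-- A positive functional, invariant under right translations, on bounded functions. -/
structure IsMean (m : (Lamplighter F → ℝ) →ₗ[ℝ] ℝ) : Prop where
  nonneg : ∀ g, Bd g → (∀ p, 0 ≤ g p) → 0 ≤ m g
  inv : ∀ g a, Bd g → m (fun p => g (p * a)) = m g

section
variable (m : (Lamplighter F → ℝ) →ₗ[ℝ] ℝ)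

lemma lin_add (g g' : Lamplighter F → ℝ) : m (fun p => g p + g' p) = m g + m g' := map_add m g g'
lemma lin_sub (g g' : Lamplighter F → ℝ) : m (fun p => g p - g' p) = m g - m g' := map_sub m g g'
lemma lin_mul (c : ℝ) (g : Lamplighter F → ℝ) : m (fun p => c * g p) = c * m g := map_smul m c g
lemma lin_const (c : ℝ) : m (fun _ => c) = c * m (fun _ => 1) := by
  rw [← lin_mul]; simp
lemma lin_sum {ι : Type} (s : Finset ι) (g : ι → Lamplighter F → ℝ) :
    m (fun p => ∑ i ∈ s, g i p) = ∑ i ∈ s, m (g i) := by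
  rw [← map_sum]
  congr 1
  funext p
  simp

lemma lin_EL (L : ℕ) (G : Lamplighter F → (ℕ → F') → ℝ) :
    m (fun p => EL L (G p)) = EL L fun x => m fun p => G p x := by
  simp only [EL, Fintype.expect_eq_sum_div_card, div_eq_inv_mul]
  rw [lin_mul, lin_sum]

end

namespace IsMean
variable {m : (Lamplighter F → ℝ) →ₗ[ℝ] ℝ} (hm : IsMean m)
include hm

lemma mono {g g' : Lamplighter F → ℝ} (hg : Bd g) (hg' : Bd g') (h : ∀ p, g p ≤ g' p) :
    m g ≤ m g' := by
  have := hm.nonneg _ (hg'.sub hg) fun p => by linarith [h p]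
  rw [lin_sub] at this
  linarith

lemma mv {g : Lamplighter F → ℝ} (hg : Bd g) (k : ℤ) : m (fun p => g (mv p k)) = m g := by
  rw [← hm.inv g (Lamp.mv 1 k) hg]
  congr 1
  funext p
  congr 1
  exact ext_pt (fun i => by simp) (by simp)

lemma dn {g : Lamplighter F → ℝ} (hg : Bd g) (a : ℕ) :
    m (fun p => EL a fun x => g (dn p x a)) = m g := by
  have key : ∀ p : Lamplighter F, EL a (fun x => g (Lamp.dn p x a)) =
      EL a fun x => g (p * Lamp.dn 1 x a) := by
    intro p
    refine (Fintype.expect_equiv (Equiv.mulLeft fun k : Fin a => lamp p (pos p - 1 - k))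
      _ _ fun v => ?_).symm
    refine congrArg g (ext_pt (fun i => ?_)
      (by rw [pos_mul, pos_dn, pos_dn, pos_one]; ring))
    rw [lamp_mul]
    by_cases h : pos p - a ≤ i ∧ i < pos p
    · rw [lamp_dn_of_mem _ (by rw [pos_one]; omega) (by rw [pos_one]; omega),
        lamp_dn_of_mem _ h.1 h.2, pos_one]
      have h1 : (0 - 1 - (i - pos p)).toNat = (pos p - 1 - i).toNat := by omega
      have h2 : (pos p - 1 - i).toNat < a := by omega
      rw [h1, extw, extw, dif_pos h2, dif_pos h2]
      simp only [Equiv.coe_mulLeft, Pi.mul_apply]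
      congr 2
      omega
    · rw [lamp_dn_of_not_mem _ (by rw [pos_one]; omega), lamp_dn_of_not_mem _ h, lamp_one, mul_one]
  simp only [key]
  rw [lin_EL]
  simp only [fun x => hm.inv g (Lamp.dn 1 x a) hg, EL_const]

lemma mass_transport {E : Type} (src tgt : E → Lamplighter F)
    (hs : ∀ p, {e | src e = p}.Finite) (ht : ∀ p, {e | tgt e = p}.Finite) (M R : ℕ)
    (hM : ∀ p, (hs p).toFinset.card ≤ M) (hR : ∀ e, len (src e) (tgt e) ≤ R)
    (w : E → ℝ) (hw : Bd w) :
    m (fun p => ∑ e ∈ (hs p).toFinset, w e) = m (fun p => ∑ e ∈ (ht p).toFinset, w e) := by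
  classical
  have hfin : {a : Lamplighter F | len 1 a ≤ R}.Finite := by
    by_contra hinf
    obtain ⟨s, hs1, hs2⟩ := (show {a : Lamplighter F | len 1 a ≤ R}.Infinite from
      hinf).exists_subset_card_eq ((R + 1) ^ 2 * Fintype.card F ^ R + 1)
    have := card_ball_le (1 : Lamplighter F) R s fun e he => hs1 he
    omega
  have hmem : ∀ e, (src e)⁻¹ * tgt e ∈ hfin.toFinset := fun e => by
    have := len_mul (src e)⁻¹ (src e) (tgt e)
    rw [inv_mul_cancel] at this
    simpa [this] using hR e
  set u : Lamplighter F → Lamplighter F → ℝ := fun a p =>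
    ∑ e ∈ (hs p).toFinset with (src e)⁻¹ * tgt e = a, w e with hu
  have h1 : ∀ p, ∑ e ∈ (hs p).toFinset, w e = ∑ a ∈ hfin.toFinset, u a p := fun p =>
    (Finset.sum_fiberwise_of_maps_to (fun e _ => hmem e) _).symm
  have h2 : ∀ p, ∑ e ∈ (ht p).toFinset, w e = ∑ a ∈ hfin.toFinset, u a (p * a⁻¹) := fun p => by
    rw [← Finset.sum_fiberwise_of_maps_to (fun e _ => hmem e)]
    refine Finset.sum_congr rfl fun a _ => Finset.sum_congr ?_ fun _ _ => rfl
    ext e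
    simp only [Finset.mem_filter, Finite.mem_toFinset, mem_ofPred_eq]
    constructor
    · rintro ⟨rfl, rfl⟩
      simp
    · rintro ⟨h, rfl⟩
      have h' := congrArg (· * ((src e)⁻¹ * tgt e)) h
      exact ⟨by simpa [mul_assoc] using h', rfl⟩
  have hub : ∀ a, Bd (u a) := fun a => by
    obtain ⟨C, hC⟩ := hw
    refine ⟨M * |C|, fun p => (Finset.abs_sum_le_sum_abs _ _).trans ?_⟩
    have hcard : (((hs p).toFinset.filter fun e => (src e)⁻¹ * tgt e = a).card : ℝ) ≤ M := by
      exact_mod_cast (Finset.card_filter_le _ _).trans (hM p)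
    calc _ ≤ ∑ e ∈ (hs p).toFinset with (src e)⁻¹ * tgt e = a, |C| :=
          Finset.sum_le_sum fun e _ => (hC e).trans (le_abs_self C)
      _ ≤ M * |C| := by
          rw [Finset.sum_const, nsmul_eq_mul]
          gcongr
  simp only [h1, h2]
  rw [lin_sum, lin_sum]
  exact Finset.sum_congr rfl fun a _ => (hm.inv (u a) a⁻¹ (hub a)).symm

end IsMean

lemma QIPair.fiber_finite {K : ℤ} {φ : Lamplighter F → Lamplighter F'}
    {ψ : Lamplighter F' → Lamplighter F} (h : QIPair K φ ψ) (e : Lamplighter F') :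
    {p | φ p = e}.Finite := by
  by_contra hinf
  obtain ⟨s, hs1, hs2⟩ := (show {p | φ p = e}.Infinite from
    hinf).exists_subset_card_eq (mult F K + 1)
  have := h.card_fiber_le s e fun p hp => hs1 hp
  omega

/-- The functional transported along a map with finite fibres. -/
def pull {ψ : Lamplighter F' → Lamplighter F} (hψ : ∀ p, {e | ψ e = p}.Finite)
    (m : (Lamplighter F → ℝ) →ₗ[ℝ] ℝ) : (Lamplighter F' → ℝ) →ₗ[ℝ] ℝ where
  toFun g := m fun p => ∑ e ∈ (hψ p).toFinset, g e
  map_add' g g' := by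
    rw [← lin_add]
    simp [Finset.sum_add_distrib]
  map_smul' c g := by
    rw [RingHom.id_apply, smul_eq_mul, ← lin_mul]
    simp [Finset.mul_sum]

lemma pull_apply {ψ : Lamplighter F' → Lamplighter F} (hψ : ∀ p, {e | ψ e = p}.Finite)
    (m : (Lamplighter F → ℝ) →ₗ[ℝ] ℝ) (g : Lamplighter F' → ℝ) :
    pull hψ m g = m fun p => ∑ e ∈ (hψ p).toFinset, g e := rfl

lemma Bd.fiberSum {ψ : Lamplighter F' → Lamplighter F} (hψ : ∀ p, {e | ψ e = p}.Finite)
    {M : ℕ} (hM : ∀ p, (hψ p).toFinset.card ≤ M) {g : Lamplighter F' → ℝ} (hg : Bd g) :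
    Bd fun p => ∑ e ∈ (hψ p).toFinset, g e := by
  obtain ⟨C, hC⟩ := hg
  have hC0 : 0 ≤ C := (abs_nonneg _).trans (hC 1)
  refine ⟨M * C, fun p => (Finset.abs_sum_le_sum_abs _ _).trans ?_⟩
  calc _ ≤ ∑ e ∈ (hψ p).toFinset, C := Finset.sum_le_sum fun e _ => hC e
    _ ≤ M * C := by
      rw [Finset.sum_const, nsmul_eq_mul]
      have : ((hψ p).toFinset.card : ℝ) ≤ M := by exact_mod_cast hM p
      gcongr

namespace QIPair
variable {K : ℤ} {φ : Lamplighter F → Lamplighter F'} {ψ : Lamplighter F' → Lamplighter F}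
  (h : QIPair K φ ψ) {m : (Lamplighter F → ℝ) →ₗ[ℝ] ℝ} (hm : IsMean m)
include h

lemma card_toFinset_fiber_le (p : Lamplighter F) :
    (h.symm.fiber_finite p).toFinset.card ≤ mult F' K :=
  h.symm.card_fiber_le _ p fun e he => by simpa using he

include hm

lemma isMean_pull : IsMean (pull h.symm.fiber_finite m) := by
  constructor
  · intro g hg h0
    exact hm.nonneg _ (Bd.fiberSum _ h.card_toFinset_fiber_le hg)
      fun p => Finset.sum_nonneg fun e _ => h0 e
  · intro g a hg
    have hinj : ∀ p, {e | ψ (e * a) = p}.Finite := fun p =>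
      (h.symm.fiber_finite p).preimage (fun x _ y _ hxy => mul_right_cancel hxy)
    have hK := h.one_le
    rw [pull_apply, pull_apply, hm.mass_transport ψ (fun e => ψ (e * a)) h.symm.fiber_finite hinj
      (mult F' K) (K * len 1 a + K).toNat h.card_toFinset_fiber_le (fun e => by
        have h1 := h.len_right e (e * a)
        have h2 := len_mul e 1 a
        rw [mul_one] at h2
        rw [h2] at h1
        omega) (fun e => g (e * a)) (hg.comp _)]
    congr 1
    funext p
    refine Finset.sum_bij (fun e _ => e * a) (fun e he => by simpa using he)
      (fun _ _ _ _ h => mul_right_cancel h) (fun e he => ⟨e * a⁻¹, by simpa using he, by simp⟩)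
      (fun _ _ => rfl)

lemma pull_comp_le {g : Lamplighter F → ℝ} (hg : Bd g) (h0 : ∀ p, 0 ≤ g p) :
    pull h.symm.fiber_finite m (fun e => g (ψ e)) ≤ mult F' K * m g := by
  rw [pull_apply, ← lin_mul]
  refine hm.mono (Bd.fiberSum _ h.card_toFinset_fiber_le (hg.comp ψ)) ((Bd.const _).mul hg)
    fun p => ?_
  calc ∑ e ∈ (h.symm.fiber_finite p).toFinset, g (ψ e)
      = ∑ e ∈ (h.symm.fiber_finite p).toFinset, g p := Finset.sum_congr rfl fun e he => by
        rw [show ψ e = p by simpa using he]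
    _ ≤ _ := by
      rw [Finset.sum_const, nsmul_eq_mul]
      have : ((h.symm.fiber_finite p).toFinset.card : ℝ) ≤ mult F' K := by
        exact_mod_cast h.card_toFinset_fiber_le p
      have := h0 p
      gcongr

lemma comp_le_pull {g : Lamplighter F' → ℝ} (hg : Bd g) (h0 : ∀ p, 0 ≤ g p) :
    m (fun p => g (φ p)) ≤ mult F K * pull h.symm.fiber_finite m g := by
  classical
  have hfin : ∀ p, {p' | ψ (φ p') = p}.Finite := fun p =>
    ((h.symm.fiber_finite p).preimage' fun e _ => h.fiber_finite e)
  have hid : ∀ p : Lamplighter F, {p' | p' = p}.Finite := fun p => finite_singleton p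
  have hK := h.one_le
  have h1 := hm.mass_transport (fun p => p) (fun p => ψ (φ p)) hid hfin 1 K.toNat (fun p => by
    simp) (fun p => by
      have := h.inv_left p
      rw [len_comm] at this
      omega) (fun p => g (φ p)) (hg.comp _)
  have h2 : ∀ p, ∑ e ∈ (hid p).toFinset, g (φ e) = g (φ p) := fun p => by simp
  simp only [h2] at h1
  have hle : ∀ p, ∑ e ∈ (hfin p).toFinset, g (φ e) ≤
      mult F K * ∑ e ∈ (h.symm.fiber_finite p).toFinset, g e := fun p => by
    rw [← Finset.sum_fiberwise_of_maps_to (s := (hfin p).toFinset)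
      (t := (h.symm.fiber_finite p).toFinset) (g := φ) (fun e he => by simpa using he),
      Finset.mul_sum]
    refine Finset.sum_le_sum fun e he => ?_
    calc ∑ p' ∈ (hfin p).toFinset with φ p' = e, g (φ p')
        = ∑ p' ∈ (hfin p).toFinset with φ p' = e, g e :=
          Finset.sum_congr rfl fun p' hp' => by rw [(Finset.mem_filter.1 hp').2]
      _ ≤ _ := by
        rw [Finset.sum_const, nsmul_eq_mul]
        have : (((hfin p).toFinset.filter fun p' => φ p' = e).card : ℝ) ≤ mult F K := by
          exact_mod_cast h.card_fiber_le _ e fun p' hp' => (Finset.mem_filter.1 hp').2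
        have := h0 e
        gcongr
  have hb := Bd.fiberSum h.symm.fiber_finite h.card_toFinset_fiber_le hg
  rw [h1, pull_apply, ← lin_mul]
  refine hm.mono ?_ ((Bd.const _).mul hb) hle
  obtain ⟨C, hC⟩ := (Bd.const (mult F K : ℝ)).mul hb
  refine ⟨C, fun p => ?_⟩
  rw [abs_of_nonneg (Finset.sum_nonneg fun e _ => h0 _)]
  exact (hle p).trans ((le_abs_self _).trans (hC p))

end QIPair

end

section

variable {F F' : Type} [Group F'] [Fintype F'] [Group F] [Fintype F]

/-- The distance between the images of two points on a vertical line. -/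
def sg (φ : Lamplighter F → Lamplighter F') (q : Lamplighter F) (x : ℕ → F) (a b : ℕ) : ℤ :=
  len (φ (dn q x a)) (φ (dn q x b))

/-- The excess of a broken line. -/
def dfct (φ : Lamplighter F → Lamplighter F') (q : Lamplighter F) (x : ℕ → F) (a b c d : ℕ) : ℤ :=
  sg φ q x a b + sg φ q x b c + sg φ q x c d - sg φ q x a d

/-- The expected length of the image of a line of length `L`. -/
def eh (φ : Lamplighter F → Lamplighter F') (L : ℕ) (q : Lamplighter F) : ℝ :=
  EL L fun x => (sg φ q x 0 L : ℝ)

lemma sg_congr (φ : Lamplighter F → Lamplighter F') (q : Lamplighter F) {x y : ℕ → F} {a b L : ℕ}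
    (ha : a ≤ L) (hb : b ≤ L) (h : ∀ i < L, x i = y i) : sg φ q x a b = sg φ q y a b := by
  rw [sg, sg, dn_congr q fun i hi => h i (by omega), dn_congr q fun i hi => h i (by omega)]

lemma sg_nonneg (φ : Lamplighter F → Lamplighter F') (q : Lamplighter F) (x : ℕ → F) (a b : ℕ) :
    0 ≤ sg φ q x a b := len_nonneg _ _

lemma dfct_nonneg (φ : Lamplighter F → Lamplighter F') (q : Lamplighter F) (x : ℕ → F)
    (a b c d : ℕ) : 0 ≤ dfct φ q x a b c d := by
  have h1 := len_tri (φ (dn q x a)) (φ (dn q x b)) (φ (dn q x d))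
  have h2 := len_tri (φ (dn q x b)) (φ (dn q x c)) (φ (dn q x d))
  unfold dfct sg
  omega

lemma sg_cat (φ : Lamplighter F → Lamplighter F') (q : Lamplighter F) (x y : ℕ → F) (a b : ℕ) :
    sg φ q (cat a x y) a (a + b) = sg φ (dn q x a) y 0 b := by
  rw [sg, sg, dn_cat _ _ _ le_rfl, ← dn_dn, dn_zero]

section
variable {K : ℤ} {φ : Lamplighter F → Lamplighter F'} {ψ : Lamplighter F' → Lamplighter F}
  (h : QIPair K φ ψ)
include h

lemma QIPair.sg_le (q : Lamplighter F) (x : ℕ → F) {a b : ℕ} (hab : a ≤ b) :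
    sg φ q x a b ≤ K * (b - a) + K := by
  have := h.len_left (dn q x a) (dn q x b)
  rwa [len_dn_dn _ _ hab] at this

lemma QIPair.abs_sg_le (q : Lamplighter F) (x : ℕ → F) {a b L : ℕ} (hab : a ≤ b) (hb : b ≤ L) :
    |(sg φ q x a b : ℝ)| ≤ K * L + K := by
  rw [abs_of_nonneg (by exact_mod_cast sg_nonneg φ q x a b)]
  have h1 := h.sg_le q x hab
  have h2 : K * ((b : ℤ) - a) ≤ K * L := mul_le_mul_of_nonneg_left (by omega) (by linarith [h.one_le])
  exact_mod_cast h1.trans (by linarith)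

lemma QIPair.bd_sg {a b L : ℕ} (hab : a ≤ b) : Bd fun q => EL L fun x => (sg φ q x a b : ℝ) :=
  Bd.EL L fun q x => h.abs_sg_le q x hab le_rfl

lemma QIPair.bd_eh (L : ℕ) : Bd (eh φ L) := h.bd_sg (Nat.zero_le L)

lemma QIPair.eh_nonneg (L : ℕ) (q : Lamplighter F) : 0 ≤ eh φ L q :=
  EL_nonneg fun x => by exact_mod_cast sg_nonneg φ q x 0 L

lemma QIPair.eh_le (L : ℕ) (q : Lamplighter F) : eh φ L q ≤ K * L + K :=
  (le_abs_self _).trans (abs_EL_le fun x => h.abs_sg_le q x (Nat.zero_le L) le_rfl)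

variable {m : (Lamplighter F → ℝ) →ₗ[ℝ] ℝ} (hm : IsMean m)
include hm

lemma QIPair.mean_sg {a b L : ℕ} (hab : a ≤ b) (hb : b ≤ L) :
    m (fun q => EL L fun x => (sg φ q x a b : ℝ)) = m (eh φ (b - a)) := by
  obtain ⟨c, rfl⟩ := Nat.exists_eq_add_of_le hab
  rw [Nat.add_sub_cancel_left, ← hm.dn (h.bd_eh c) a]
  congr 1
  funext q
  rw [EL_of_le hb fun x y hxy => by rw [sg_congr φ q (by omega) le_rfl hxy], EL_split]
  simp only [sg_cat, eh]

lemma QIPair.subadditive : Subadditive fun L => m (eh φ L) := by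
  intro a b
  have h1 := h.mean_sg hm (Nat.zero_le a) (show a ≤ a + b by omega)
  have h2 := h.mean_sg hm (show a ≤ a + b by omega) le_rfl
  rw [Nat.add_sub_cancel_left] at h2
  rw [Nat.sub_zero] at h1
  dsimp only
  rw [← h1, ← h2, ← lin_add]
  refine hm.mono (h.bd_eh _) ((h.bd_sg (Nat.zero_le a)).add (h.bd_sg (by omega))) fun q => ?_
  rw [← EL_add]
  refine EL_mono fun x => ?_
  exact_mod_cast len_tri _ _ _

lemma QIPair.exists_scale {δ : ℝ} (hδ : 0 < δ) : ∃ l0 : ℕ, ∀ a ≥ l0, ∀ b ≥ l0, ∀ c ≥ l0,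
    m (eh φ a) + m (eh φ b) + m (eh φ c) - m (eh φ (a + b + c)) ≤ δ * (a + b + c) := by
  have hs := h.subadditive hm
  have hbd : BddBelow (range fun n : ℕ => m (eh φ n) / n) := ⟨0, by
    rintro _ ⟨n, rfl⟩
    have := hm.nonneg _ (h.bd_eh n) (h.eh_nonneg n)
    positivity⟩
  obtain ⟨l0, hl0⟩ := Filter.eventually_atTop.1
    ((tendsto_order.1 (hs.tendsto_lim hbd)).2 (hs.lim + δ) (by linarith))
  have up : ∀ a ≥ l0 + 1, m (eh φ a) ≤ (hs.lim + δ) * a := fun a ha => by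
    have := (hl0 a (by omega)).le
    rwa [div_le_iff₀ (by exact_mod_cast (by omega : 0 < a))] at this
  refine ⟨l0 + 1, fun a ha b hb c hc => ?_⟩
  have low := hs.lim_le_div hbd (show a + b + c ≠ 0 by omega)
  rw [le_div_iff₀ (by exact_mod_cast (by omega : 0 < a + b + c))] at low
  push_cast at low
  linarith [up a ha, up b hb, up c hc]

lemma QIPair.mean_dfct_le {δ : ℝ} {l0 a0 a1 a2 a3 L : ℕ} {d : ℤ} (hd : 0 < d)
    (hl0 : ∀ a ≥ l0, ∀ b ≥ l0, ∀ c ≥ l0,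
      m (eh φ a) + m (eh φ b) + m (eh φ c) - m (eh φ (a + b + c)) ≤ δ * (a + b + c))
    (h1 : a0 + l0 ≤ a1) (h2 : a1 + l0 ≤ a2) (h3 : a2 + l0 ≤ a3) (h4 : a3 ≤ L) :
    m (fun q => Pr L fun x => ¬ dfct φ q x a0 a1 a2 a3 ≤ d) ≤ δ * (a3 - a0) / d := by
  have hd' : (0 : ℝ) < d := by exact_mod_cast hd
  have b1 := h.bd_sg (a := a0) (b := a1) (L := L) (by omega)
  have b2 := h.bd_sg (a := a1) (b := a2) (L := L) (by omega)
  have b3 := h.bd_sg (a := a2) (b := a3) (L := L) (by omega)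
  have b4 := h.bd_sg (a := a0) (b := a3) (L := L) (by omega)
  rw [le_div_iff₀ hd', mul_comm, ← lin_mul]
  have key := hl0 (a1 - a0) (by omega) (a2 - a1) (by omega) (a3 - a2) (by omega)
  rw [show a1 - a0 + (a2 - a1) + (a3 - a2) = a3 - a0 by omega,
    ← h.mean_sg hm (show a0 ≤ a1 by omega) (show a1 ≤ L by omega),
    ← h.mean_sg hm (show a1 ≤ a2 by omega) (show a2 ≤ L by omega),
    ← h.mean_sg hm (show a2 ≤ a3 by omega) h4,
    ← h.mean_sg hm (show a0 ≤ a3 by omega) h4, ← lin_add, ← lin_add, ← lin_sub] at key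
  rw [Nat.cast_sub (by omega), Nat.cast_sub (by omega), Nat.cast_sub (by omega)] at key
  refine (hm.mono ((Bd.const _).mul (Bd.Pr L _)) (((b1.add b2).add b3).sub b4) fun q => ?_).trans
    (key.trans_eq (by ring))
  rw [← EL_add, ← EL_add, ← EL_sub]
  refine Pr_le_EL (fun x => ?_) fun x hx => ?_
  · exact_mod_cast dfct_nonneg φ q x a0 a1 a2 a3
  · push Not at hx
    exact_mod_cast hx.le

end

end

section

variable {F F' : Type} [Group F'] [Fintype F'] [Group F] [Fintype F]

/-- One half of an almost straight two-sided line rises. -/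
lemma exists_rising (y : ℕ → Lamplighter F) (C : ℕ) (d : ℤ) (hC : 2 ≤ C) (hd : 0 ≤ d)
    (hdn : ∀ k, C < k → k < 2 * C → len (y 0) (y C) + len (y C) (y k) + len (y k) (y (k + 1)) ≤
      len (y 0) (y (k + 1)) + d)
    (hup : ∀ k, 0 < k → k < C → len (y (2 * C)) (y C) + len (y C) (y k) + len (y k) (y (k - 1)) ≤
      len (y (2 * C)) (y (k - 1)) + d)
    (hfar : ∀ i ≤ 2 * C, ∀ j ≤ 2 * C, i ≠ j → 3 * d < len (y i) (y j)) :
    ∃ f : ℕ → ℕ, f 0 = C ∧ ((∀ k ≤ C, f k = C + k) ∨ ∀ k ≤ C, f k = C - k) ∧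
      ∀ k, 0 < k → k < C → pos (y C) - d ≤ lo (y C) (y (f k)) ∧
        hi (y C) (y (f k)) ≤ pos (y (f k)) + d := by
  have f1 := fun k (h1 : C < k) (h2 : k < 2 * C) => four_points _ _ _ _ d (hdn k h1 h2)
    (by linarith [hfar 0 (by omega) C (by omega) (by omega)])
    (by linarith [hfar C (by omega) k (by omega) (by omega)])
    (by linarith [hfar k (by omega) (k + 1) (by omega) (by omega)])
  have f2 := fun k (h1 : 0 < k) (h2 : k < C) => four_points _ _ _ _ d (hup k h1 h2)
    (by linarith [hfar (2 * C) (by omega) C (by omega) (by omega)])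
    (by linarith [hfar C (by omega) k (by omega) (by omega)])
    (by linarith [hfar k (by omega) (k - 1) (by omega) (by omega)])
  by_cases hA : hi (y 0) (y C) ≤ pos (y C) + d
  · refine ⟨fun k => C + k, rfl, Or.inl fun _ _ => rfl, fun k h1 h2 => ?_⟩
    have h3 := hfar 0 (by omega) C (by omega) (by omega)
    rcases f1 (C + k) (by omega) (by omega) with h4 | h4
    · exact ⟨h4.1, h4.2.1⟩
    · unfold len at h3
      omega
  · refine ⟨fun k => C - k, rfl, Or.inr fun _ _ => rfl, fun k h1 h2 => ?_⟩
    have h3 := (f1 (C + 1) (by omega) (by omega)).resolve_left fun h4 => hA h4.2.2.1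
    have h5 := hfar (2 * C) (by omega) C (by omega) (by omega)
    rcases f2 (C - k) (by omega) (by omega) with h4 | h4
    · exact ⟨h4.1, h4.2.1⟩
    · have h6 := hfar 0 (by omega) C (by omega) (by omega)
      rcases f2 1 (by omega) (by omega) with h7 | h7
      · unfold len at h5
        omega
      · have h8 := hi_tri (y C) (y 1) (y 0)
        rw [Nat.sub_self] at h7
        rw [hi_comm (y C) (y 0)] at h8
        have h9 := left_le_hi (y C) (y 1)
        have h10 := right_le_hi (y C) (y 1)
        unfold len at h6
        omega

variable {K : ℤ} {φ : Lamplighter F → Lamplighter F'} {ψ : Lamplighter F' → Lamplighter F}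

/-- `p` is connected to a point at height `H * l` above it, by a path of controlled length. -/
def Link (φ : Lamplighter F → Lamplighter F') (c : ℤ) (l : ℕ) (p q : Lamplighter F) : Prop :=
  pos q = pos p + l ∧ pos p ≤ lo p q ∧ hi p q ≤ pos q ∧ len (φ p) (φ q) ≤ c

lemma QIPair.exists_link (h : QIPair K φ ψ) {l H c : ℕ} {u : ℤ} (hu : 0 ≤ u)
    (hl : K * (3 * u) + 3 * K < l) (hH : K + 5 < H) (hc : 1 ≤ c) (E : Lamplighter F') (V : ℕ → F')
    (hdn : ∀ k, c + 1 < k → k < 2 * (c + 1) →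
      dfct ψ E V (0 * l) ((c + 1) * l) (k * l) ((k + 1) * l) ≤ u)
    (hup : ∀ k, 0 < k → k < c + 1 →
      dfct ψ E V ((k - 1) * l) (k * l) ((c + 1) * l) (2 * (c + 1) * l) ≤ u)
    (hfar1 : (H * l : ℤ) ≤ sg ψ E V (1 * l) ((c + 1) * l))
    (hfar2 : (H * l : ℤ) ≤ sg ψ E V ((c + 1) * l) ((2 * c + 1) * l))
    (p : Lamplighter F) (hp : φ p = dn E V ((c + 1) * l)) (j0 : ℕ) (hj0 : 2 * l ≤ j0)
    (hj0' : j0 < 3 * l) :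
    ∃ q, Link φ (c * l + (K ^ 2 + 10 * K) * l) (H * l) (mv p (-j0)) q ∧
      ∃ k ≤ 2 * (c + 1), ∃ j : ℕ, j ≤ (K + 4) * l ∧ q = mv (ψ (dn E V (k * l))) j := by
  have hK := h.one_le
  have hKu : u ≤ K * u := le_mul_of_one_le_left hu hK
  have hKu' : K * (3 * u) = 3 * (K * u) := by ring
  obtain ⟨f, hf0, hf, hr⟩ := exists_rising (fun k => ψ (dn E V (k * l))) (c + 1) u (by omega) hu
    (fun k h1 h2 => by
      have := hdn k h1 h2
      unfold dfct sg at this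
      linarith)
    (fun k h1 h2 => by
      have := hup k h1 h2
      unfold dfct sg at this
      have c1 := len_comm (ψ (dn E V (2 * (c + 1) * l))) (ψ (dn E V ((c + 1) * l)))
      have c2 := len_comm (ψ (dn E V ((c + 1) * l))) (ψ (dn E V (k * l)))
      have c3 := len_comm (ψ (dn E V (k * l))) (ψ (dn E V ((k - 1) * l)))
      have c4 := len_comm (ψ (dn E V (2 * (c + 1) * l))) (ψ (dn E V ((k - 1) * l)))
      linarith)
    (fun i hi j hj hij => h.symm.lower_lt <| by
      have key : ∀ i j : ℕ, i < j → (l : ℤ) ≤ len (dn E V (i * l)) (dn E V (j * l)) := by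
        intro i j hij
        rw [len_dn_dn _ _ (Nat.mul_le_mul_right l hij.le)]
        have : (i + 1) * l ≤ j * l := Nat.mul_le_mul_right l hij
        have h2 : (i + 1) * l = i * l + l := by ring
        omega
      rcases lt_or_gt_of_ne hij with h1 | h1
      · linarith [key i j h1]
      · rw [len_comm]
        linarith [key j i h1])
  set y : ℕ → Lamplighter F := fun k => ψ (dn E V (k * l)) with hy
  replace hr : ∀ k, 0 < k → k < c + 1 → pos (y (c + 1)) - u ≤ lo (y (c + 1)) (y (f k)) ∧
    hi (y (c + 1)) (y (f k)) ≤ pos (y (f k)) + u := hr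
  have hstep : ∀ k < c + 1, len (y (f k)) (y (f (k + 1))) ≤ K * l + K := by
    intro k hk
    have key : ∀ i : ℕ, len (y i) (y (i + 1)) ≤ K * l + K := fun i => by
      have := h.symm.sg_le E V (Nat.mul_le_mul_right l (Nat.le_succ i))
      refine this.trans (le_of_eq ?_)
      push_cast
      ring
    rcases hf with hf | hf
    · rw [hf k hk.le, hf (k + 1) hk]
      exact key _
    · rw [hf k hk.le, hf (k + 1) hk, len_comm]
      have := key (c + 1 - (k + 1))
      rwa [show c + 1 - (k + 1) + 1 = c + 1 - k by omega] at this
  have hdist : ∀ k ≤ c + 1, len (dn E V ((c + 1) * l)) (dn E V (f k * l)) = k * l := by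
    intro k hk
    rcases hf with hf | hf
    · rw [hf k hk, len_dn_dn _ _ (Nat.mul_le_mul_right l (by omega))]
      push_cast
      ring
    · rw [hf k hk, len_comm, len_dn_dn _ _ (Nat.mul_le_mul_right l (by omega)),
        Nat.cast_mul, Nat.cast_mul, Nat.cast_sub hk]
      push_cast
      ring
  have hfarc : (H * l : ℤ) ≤ len (y (c + 1)) (y (f c)) := by
    rcases hf with hf | hf
    · rw [hf c (by omega), show c + 1 + c = 2 * c + 1 by ring]
      exact hfar2
    · rw [hf c (by omega), show c + 1 - c = 1 by omega, len_comm]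
      exact hfar1
  set t : ℤ := (H - K - 5) * l with ht
  have ht0 : l ≤ t := by
    have : 1 * (l : ℤ) ≤ (H - K - 5) * l := mul_le_mul_of_nonneg_right (by linarith) (by positivity)
    linarith
  have hex : ∃ k, k ≤ c ∧ pos (y (c + 1)) + t ≤ pos (y (f k)) := by
    refine ⟨c, le_rfl, ?_⟩
    have h1 := hr c (by omega) (by omega)
    have h2 : t = H * l - (K + 5) * l := by rw [ht]; ring
    have h3 : 0 ≤ K * (l : ℤ) := by positivity
    have h4 : (K + 5) * (l : ℤ) = K * l + 5 * l := by ring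
    unfold len at hfarc
    omega
  classical
  obtain ⟨k, ⟨hk1, hk2⟩, hk3⟩ : ∃ k, (k ≤ c ∧ pos (y (c + 1)) + t ≤ pos (y (f k))) ∧
      ∀ k' < k, ¬ (k' ≤ c ∧ pos (y (c + 1)) + t ≤ pos (y (f k'))) :=
    ⟨Nat.find hex, Nat.find_spec hex, fun k' hk' => Nat.find_min hex hk'⟩
  have hk0 : k ≠ 0 := by
    rintro rfl
    rw [hf0] at hk2
    omega
  obtain ⟨k, rfl⟩ := Nat.exists_eq_succ_of_ne_zero hk0
  rw [Nat.succ_eq_add_one] at *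
  have hprev := hk3 k (by omega)
  have hst := hstep k (by omega)
  have hrise := hr (k + 1) (by omega) (by omega)
  have hinv := h.inv_left p
  rw [hp] at hinv
  change len (y (c + 1)) p ≤ K at hinv
  set r := y (f (k + 1)) with hrdef
  have hpr := (abs_pos_le_len _ _).trans hst
  have hpy := (abs_pos_le_len _ _).trans hinv
  rw [abs_le] at hpr hpy
  have htl : t = H * l - K * l - 5 * l := by rw [ht]; ring
  have hKl : 0 ≤ K * (l : ℤ) := by positivity
  obtain ⟨j, hj⟩ := Int.eq_ofNat_of_zero_le
    (show 0 ≤ pos p - j0 + H * l - pos r by omega)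
  have hju : (j : ℤ) ≤ (K + 4) * l := by
    have : (K + 4) * (l : ℤ) = K * l + 4 * l := by ring
    omega
  refine ⟨mv r j, ⟨by rw [pos_mv, pos_mv]; push_cast; omega, ?_, ?_, ?_⟩, f (k + 1), ?_, j, hju, rfl⟩
  · have e1 := lo_tri (mv p (-j0)) p (mv r j)
    have e2 := lo_tri p (y (c + 1)) (mv r j)
    have e3 := lo_tri (y (c + 1)) r (mv r j)
    have e4 : min (pos p) (pos p - j0) ≤ lo (mv p (-j0)) p :=
      le_lo.2 ⟨by simp, by omega, fun i _ => rfl⟩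
    have e5 : min (pos r) (pos r + j) ≤ lo r (mv r j) :=
      le_lo.2 ⟨by omega, by simp, fun i _ => rfl⟩
    rw [lo_comm p (y (c + 1))] at e2
    have e6 := left_le_hi (y (c + 1)) p
    unfold len at hinv
    rw [pos_mv]
    omega
  · have e1 := hi_tri (mv p (-j0)) p (mv r j)
    have e2 := hi_tri p (y (c + 1)) (mv r j)
    have e3 := hi_tri (y (c + 1)) r (mv r j)
    have e4 : hi (mv p (-j0)) p ≤ max (pos p) (pos p - j0) :=
      hi_le.2 ⟨by simp, by omega, fun i _ => rfl⟩
    have e5 : hi r (mv r j) ≤ max (pos r) (pos r + j) :=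
      hi_le.2 ⟨by omega, by simp, fun i _ => rfl⟩
    rw [hi_comm p (y (c + 1))] at e2
    have e6 := lo_le_left (y (c + 1)) p
    unfold len at hinv
    rw [pos_mv]
    omega
  · have e1 := len_tri (φ (mv p (-j0))) (φ p) (φ (mv r j))
    have e2 := len_tri (φ p) (dn E V (f (k + 1) * l)) (φ (mv r j))
    have e3 := len_tri (dn E V (f (k + 1) * l)) (φ r) (φ (mv r j))
    have e4 := h.len_left (mv p (-j0)) p
    have e5 := h.len_left r (mv r j)
    have e6 := len_mv p (-j0)
    have e7 := len_mv r j
    have e8 := h.inv_right (dn E V (f (k + 1) * l))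
    rw [len_comm] at e8
    have e9 := hdist (k + 1) (by omega)
    rw [← hp] at e9
    rw [abs_neg, Nat.abs_cast] at e6
    rw [Nat.abs_cast] at e7
    rw [len_comm p] at e6
    have e10 : K * len (mv p (-j0)) p ≤ K * (3 * l) :=
      mul_le_mul_of_nonneg_left (by omega) (by omega)
    have e11 : K * len r (mv r j) ≤ K * ((K + 4) * l) :=
      mul_le_mul_of_nonneg_left (by omega) (by omega)
    have e12 : ((k + 1 : ℕ) : ℤ) * l ≤ c * l :=
      mul_le_mul_of_nonneg_right (by exact_mod_cast hk1) (by positivity)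
    have e13 : K * 1 ≤ K * l := mul_le_mul_of_nonneg_left (by omega) (by omega)
    have e14 : φ r = φ (ψ (dn E V (f (k + 1) * l))) := rfl
    rw [← e14] at e8
    nlinarith
  · rcases hf with hf | hf
    · rw [hf _ (by omega)]; omega
    · rw [hf _ (by omega)]; omega

end

section

variable {F F' : Type} [Group F] [Group F'] [Fintype F] [Fintype F']
variable {K : ℤ} {φ : Lamplighter F → Lamplighter F'} {ψ : Lamplighter F' → Lamplighter F}

lemma dn_eq_dn_of_le {q q' : Lamplighter F} {x : ℕ → F} {L : ℕ} (hpos : pos q' = pos q)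
    (h1 : pos q - L ≤ lo (dn q x L) q') (h2 : hi (dn q x L) q' ≤ pos q) (y : ℕ → F) :
    dn q' y L = dn q y L := by
  refine ext_pt (fun i => ?_) (by rw [pos_dn, pos_dn, hpos])
  by_cases hi' : pos q - L ≤ i ∧ i < pos q
  · rw [lamp_dn_of_mem _ (by omega) (by omega), lamp_dn_of_mem _ hi'.1 hi'.2, hpos]
  · rw [lamp_dn_of_not_mem _ (by rwa [hpos]), lamp_dn_of_not_mem _ hi']
    have e : lamp (dn q x L) i = lamp q i := lamp_dn_of_not_mem _ hi'
    rw [← e]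
    by_cases h3 : i < pos q - L
    · exact (lamp_eq_of_lt (by omega)).symm
    · exact (lamp_eq_of_le (by omega)).symm

/-- The proportion of lines below `q` whose image is not almost straight. -/
def crook (φ : Lamplighter F → Lamplighter F') (l L u : ℕ) (q : Lamplighter F) : ℝ :=
  Pr L fun x => ¬ dfct φ q x 0 l (L - l) L ≤ u

/-- The image of a straight line stays between the heights of its ends. -/
lemma QIPair.hull_of_dfct_le (h : QIPair K φ ψ) {q : Lamplighter F} {y : ℕ → F} {l L u : ℕ}
    (hL : 3 * l ≤ L) (hl : K * (3 * u) + 3 * K < l) (hy : dfct φ q y 0 l (L - l) L ≤ u) :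
    min (pos (φ q)) (pos (φ (dn q y L))) - (u + 2 * (K * l + K)) ≤ lo (φ q) (φ (dn q y L)) ∧
    hi (φ q) (φ (dn q y L)) ≤ max (pos (φ q)) (pos (φ (dn q y L))) + (u + 2 * (K * l + K)) := by
  have hK := h.one_le
  have h1 := h.sg_le q y (Nat.zero_le l)
  have h2 := h.sg_le q y (show L - l ≤ L by omega)
  rw [Nat.cast_sub (by omega), sub_sub_cancel] at h2
  rw [Nat.cast_zero, sub_zero] at h1
  have hu : 0 ≤ K * (3 * u) := by positivity
  have h4 := four_points (φ q) (φ (dn q y l)) (φ (dn q y (L - l))) (φ (dn q y L)) u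
    (by unfold dfct sg at hy; rw [dn_zero] at hy; linarith)
    (h.lower_lt (by rw [len_dn']; omega))
    (h.lower_lt (by rw [len_dn_dn _ _ (by omega)]; omega))
    (h.lower_lt (by rw [len_dn_dn _ _ (by omega)]; omega))
  unfold sg at h1 h2
  rw [dn_zero] at h1
  have a1 := lo_tri (φ q) (φ (dn q y l)) (φ (dn q y L))
  have a2 := lo_tri (φ (dn q y l)) (φ (dn q y (L - l))) (φ (dn q y L))
  have a3 := hi_tri (φ q) (φ (dn q y l)) (φ (dn q y L))
  have a4 := hi_tri (φ (dn q y l)) (φ (dn q y (L - l))) (φ (dn q y L))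
  have b1 := lo_le_left (φ q) (φ (dn q y l))
  have b2 := lo_le_right (φ q) (φ (dn q y l))
  have b3 := left_le_hi (φ q) (φ (dn q y l))
  have b4 := right_le_hi (φ q) (φ (dn q y l))
  have c1 := lo_le_left (φ (dn q y (L - l))) (φ (dn q y L))
  have c2 := lo_le_right (φ (dn q y (L - l))) (φ (dn q y L))
  have c3 := left_le_hi (φ (dn q y (L - l))) (φ (dn q y L))
  have c4 := right_le_hi (φ (dn q y (L - l))) (φ (dn q y L))
  unfold len at h1 h2
  generalize K * (l : ℤ) = z at *
  omega

lemma QIPair.eh_le_of_link (h : QIPair K φ ψ) {q : Lamplighter F} {l L u bb : ℕ} {Rc : ℤ} {b : ℝ}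
    (hu : 0 < u) (hL : 3 * l ≤ L) (hl : u + K * (3 * u) + 3 * K < l) (hRc : 0 ≤ Rc)
    (hbb : K * L + K ≤ bb * u) (hq : crook φ l L u q ≤ b)
    (hun : Pr L (fun x => ¬ ∃ q', Link φ Rc L (dn q x L) q' ∧ crook φ l L u q' ≤ b) ≤ b) :
    eh φ L q ≤ Rc + 4 * (K * l + K) + 7 * u +
      (K * L + K) * (2 * b + 2 * (2 * bb + 1) ^ 2 * (b + ((Fintype.card F : ℝ) ^ u)⁻¹)) := by
  have hK := h.one_le
  have hb0 : 0 ≤ b := (Pr_nonneg _ _).trans hq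
  set R : ℤ := Rc + 2 * u + 2 * (K * l + K) with hR
  set S : (ℕ → F) → Prop := fun x => dfct φ q x 0 l (L - l) L ≤ u ∧
    R + 2 * (K * l + K) + 4 * u + u ≤ len (φ q) (φ (dn q x L)) ∧
    ∃ q', Link φ Rc L (dn q x L) q' ∧ crook φ l L u q' ≤ b with hS
  have htree : Pr L S ≤ _ := h.tree q (s := l) (L := L) (k := u) (d := u) (R := R) (η := u)
    (b := bb) (θ := b) hb0 hL (by positivity) (by exact_mod_cast hu) hbb
    (by linarith) (by linarith) S
    (fun x hx => by
      have := hx.1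
      unfold dfct sg at this
      rw [dn_zero] at this
      linarith) (fun x hx => hx.2.1) (fun x hx => by
      obtain ⟨q', ⟨e1, e2, e3, e4⟩, e5⟩ := hx.2.2
      rw [pos_dn, sub_add_cancel] at e1
      rw [pos_dn] at e2
      rw [e1] at e3
      have hdn := dn_eq_dn_of_le e1 e2 e3
      refine (Pr_mono fun y hy => ?_).trans e5
      refine mt (fun hy' hxy => ?_) hy
      have h5 := h.hull_of_dfct_le hL (by linarith) hy'
      rw [hdn] at h5
      have a1 := lo_tri (φ (dn q x L)) (φ q') (φ (dn q y L))
      have a2 := hi_tri (φ (dn q x L)) (φ q') (φ (dn q y L))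
      have b1 := lo_le_left (φ (dn q x L)) (φ q')
      have b2 := lo_le_right (φ (dn q x L)) (φ q')
      have b3 := left_le_hi (φ (dn q x L)) (φ q')
      have b4 := right_le_hi (φ (dn q x L)) (φ q')
      rw [abs_le] at hxy
      unfold len at e4
      have hz : 0 ≤ K * (l : ℤ) := by positivity
      generalize K * (l : ℤ) = z at *
      omega)
  have hbad : Pr L (fun x => ¬ (len (φ q) (φ (dn q x L)) ≤ R + 2 * (K * l + K) + 5 * u)) ≤
      b + (b + 2 * (2 * bb + 1) ^ 2 * (b + ((Fintype.card F : ℝ) ^ u)⁻¹)) := by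
    refine (Pr_mono fun x hx => ?_).trans ((Pr_or L (fun x => ¬ dfct φ q x 0 l (L - l) L ≤ u)
      (fun x => (¬ ∃ q', Link φ Rc L (dn q x L) q' ∧ crook φ l L u q' ≤ b) ∨ S x)).trans
      (add_le_add hq ((Pr_or L _ S).trans (add_le_add hun htree))))
    by_contra hc
    push Not at hc
    exact hc.2.2 ⟨hc.1, by linarith, hc.2.1⟩
  have hfin := EL_le_of_Pr (L := L) (G := fun x => (sg φ q x 0 L : ℝ))
    (P := fun x => ¬ (len (φ q) (φ (dn q x L)) ≤ R + 2 * (K * l + K) + 5 * u))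
    (d := R + 2 * (K * l + K) + 5 * u) (M := K * L + K)
    (fun x => (le_abs_self _).trans (h.abs_sg_le q x (Nat.zero_le L) le_rfl))
    (fun x hx => by
      rw [not_not] at hx
      rw [sg, dn_zero]
      exact_mod_cast hx)
    (by
      have : 0 ≤ R + 2 * (K * l + K) + 5 * u := by rw [hR]; positivity
      exact_mod_cast this)
  have hKL : (0 : ℝ) ≤ K * L + K := by
    have : 0 ≤ K * L + K := by positivity
    exact_mod_cast this
  refine hfin.trans ?_
  have := mul_le_mul_of_nonneg_left hbad hKL
  rw [hR]
  push_cast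
  linarith

end

section

variable {F F' : Type} [Group F] [Group F'] [Fintype F] [Fintype F']
variable {K : ℤ} {φ : Lamplighter F → Lamplighter F'} {ψ : Lamplighter F' → Lamplighter F}

open Classical in
/-- The indicator of a proposition. -/
def ind (P : Prop) : ℝ := if P then 1 else 0

lemma ind_pos' {P : Prop} (h : P) : ind P = 1 := if_pos h
lemma ind_neg' {P : Prop} (h : ¬ P) : ind P = 0 := if_neg h
lemma ind_nonneg (P : Prop) : 0 ≤ ind P := by unfold ind; split_ifs <;> norm_num
lemma ind_le_one (P : Prop) : ind P ≤ 1 := by unfold ind; split_ifs <;> norm_num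
lemma ind_mono {P Q : Prop} (h : P → Q) : ind P ≤ ind Q := by
  by_cases hp : P
  · rw [ind_pos' hp, ind_pos' (h hp)]
  · rw [ind_neg' hp]
    exact ind_nonneg Q
lemma ind_le_div {P : Prop} {b x : ℝ} (hb : 0 < b) (hx : 0 ≤ x) (h : P → b ≤ x) :
    ind P ≤ x / b := by
  by_cases hp : P
  · rw [ind_pos' hp, le_div_iff₀ hb, one_mul]
    exact h hp
  · rw [ind_neg' hp]
    positivity
lemma ind_exists_le {ι : Type*} (s : Finset ι) (P : ι → Prop) :
    ind (∃ i ∈ s, P i) ≤ ∑ i ∈ s, ind (P i) := by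
  by_cases h : ∃ i ∈ s, P i
  · obtain ⟨i, hi, hp⟩ := h
    rw [ind_pos' ⟨i, hi, hp⟩, ← ind_pos' hp]
    exact Finset.single_le_sum (f := fun i => ind (P i)) (fun j _ => ind_nonneg _) hi
  · rw [ind_neg' h]
    exact Finset.sum_nonneg fun j _ => ind_nonneg _
lemma bd_ind {X : Type} (P : X → Prop) : Bd fun p => ind (P p) :=
  ⟨1, fun p => by rw [abs_of_nonneg (ind_nonneg _)]; exact ind_le_one _⟩
lemma Pr_eq_EL_ind (L : ℕ) (P : (ℕ → F) → Prop) : Pr L P = EL L fun x => ind (P x) := rfl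

/-- A functional conditioned to points whose position lies in a residue class. -/
def res (m : (Lamplighter F → ℝ) →ₗ[ℝ] ℝ) (l : ℕ) (t : ℤ) : (Lamplighter F → ℝ) →ₗ[ℝ] ℝ where
  toFun g := l * m fun p => ind (pos p % l = t) * g p
  map_add' g g' := by
    rw [← mul_add, ← lin_add]
    simp [mul_add]
  map_smul' c g := by
    rw [RingHom.id_apply, smul_eq_mul, mul_left_comm, ← lin_mul m c]
    refine congrArg (fun f => (l : ℝ) * m f) (funext fun p => ?_)
    simp only [Pi.smul_apply, smul_eq_mul]
    ring

lemma res_apply (m : (Lamplighter F → ℝ) →ₗ[ℝ] ℝ) (l : ℕ) (t : ℤ) (g : Lamplighter F → ℝ) :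
    res m l t g = l * m fun p => ind (pos p % l = t) * g p := rfl

lemma sum_ind_emod {l : ℕ} (hl : 0 < l) (x : ℤ) :
    ∑ t ∈ Finset.range l, ind (x % l = t) = 1 := by
  have h0 := Int.emod_nonneg x (show (l : ℤ) ≠ 0 by omega)
  have h1 := Int.emod_lt_of_pos x (show (0 : ℤ) < l by omega)
  rw [Finset.sum_eq_single (x % l).toNat]
  · exact ind_pos' (by omega)
  · intro t _ ht
    exact ind_neg' (by omega)
  · intro ht
    rw [Finset.mem_range] at ht
    omega

section
variable {m : (Lamplighter F → ℝ) →ₗ[ℝ] ℝ} (hm : IsMean m)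

lemma sum_res {l : ℕ} (hl : 0 < l) (g : Lamplighter F → ℝ) :
    ∑ t ∈ Finset.range l, res m l t g = l * m g := by
  simp only [res_apply]
  rw [← Finset.mul_sum, ← lin_sum]
  simp only [← Finset.sum_mul, sum_ind_emod hl, one_mul]

lemma exists_res_nonneg {l : ℕ} (hl : 0 < l) {g : Lamplighter F → ℝ} (hg : 0 ≤ m g) :
    ∃ t : ℕ, t < l ∧ 0 ≤ res m l t g := by
  by_contra! hc
  have h1 : ∑ t ∈ Finset.range l, res m l t g < 0 :=
    Finset.sum_neg (fun t ht => hc t (Finset.mem_range.1 ht)) ⟨0, Finset.mem_range.2 hl⟩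
  rw [sum_res hl] at h1
  have : 0 ≤ l * m g := by positivity
  linarith

include hm

lemma res_mono {l : ℕ} {t : ℤ} {g g' : Lamplighter F → ℝ} (hg : Bd g) (hg' : Bd g')
    (h : ∀ p, g p ≤ g' p) : res m l t g ≤ res m l t g' :=
  mul_le_mul_of_nonneg_left (hm.mono ((bd_ind _).mul hg) ((bd_ind _).mul hg') fun p =>
    mul_le_mul_of_nonneg_left (h p) (ind_nonneg _)) (by positivity)

lemma res_one {l : ℕ} {t : ℕ} (ht : t < l) : res m l t (fun _ => 1) = m fun _ => 1 := by
  have hl : 0 < l := by omega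
  have key : ∀ t' ∈ Finset.range l, res m l t' (fun _ => 1) = res m l t (fun _ => 1) := by
    intro t' ht'
    rw [Finset.mem_range] at ht'
    have e1 : (t : ℤ) % l = t := Int.emod_eq_of_lt (by omega) (by omega)
    have e2 : (t' : ℤ) % l = t' := Int.emod_eq_of_lt (by omega) (by omega)
    rw [res_apply, res_apply]
    congr 1
    simp only [mul_one]
    rw [← hm.mv (bd_ind _) ((t' : ℤ) - t)]
    congr 1
    funext p
    congr 1
    rw [pos_mv]
    refine propext ⟨fun h => ?_, fun h => ?_⟩
    · have : (pos p + (t' - t)) % l = t' % l := by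
        rw [h, e2]
      have h3 : (pos p + (t' - t) - (t' - t)) % l = (t' - (t' - t)) % l :=
        Int.ModEq.sub_right _ this
      rw [show pos p + ((t' : ℤ) - t) - (t' - t) = pos p by ring,
        show (t' : ℤ) - (t' - t) = t by ring, e1] at h3
      exact h3
    · have : pos p % l = t % l := by rw [h, e1]
      have h3 : (pos p + (t' - t)) % l = (t + (t' - t)) % l := Int.ModEq.add_right _ this
      rw [show (t : ℤ) + (t' - t) = t' by ring, e2] at h3
      exact h3
  have h1 := sum_res (m := m) hl (fun _ => 1)
  rw [Finset.sum_congr rfl key, Finset.sum_const, Finset.card_range, nsmul_eq_mul] at h1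
  exact mul_left_cancel₀ (by exact_mod_cast hl.ne') h1

lemma res_dn {l L : ℕ} {t : ℤ} (hL : l ∣ L) {g : Lamplighter F → ℝ} (hg : Bd g) :
    res m l t (fun p => EL L fun x => g (dn p x L)) = res m l t g := by
  rw [res_apply, res_apply, ← hm.dn ((bd_ind _).mul hg) L]
  congr 2
  funext p
  rw [← EL_mul]
  congr 1
  funext x
  obtain ⟨k, rfl⟩ := hL
  rw [pos_dn]
  push_cast
  rw [Int.sub_mul_emod_self_left]

end

end

section

variable {F F' : Type} [Group F] [Group F'] [Fintype F] [Fintype F']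
variable {φ : Lamplighter F → Lamplighter F'} {ψ : Lamplighter F' → Lamplighter F}

/-- A descending line that fails to produce a short link. -/
def BadLine (ψ : Lamplighter F' → Lamplighter F) (G : Lamplighter F → Prop) (l u c H : ℕ)
    (E : Lamplighter F') (V : ℕ → F') : Prop :=
  (∃ k ∈ Finset.Ioo (c + 1) (2 * (c + 1)),
    ¬ dfct ψ E V (0 * l) ((c + 1) * l) (k * l) ((k + 1) * l) ≤ u) ∨
  (∃ k ∈ Finset.Ioo 0 (c + 1),
    ¬ dfct ψ E V ((k - 1) * l) (k * l) ((c + 1) * l) (2 * (c + 1) * l) ≤ u) ∨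
  sg ψ E V (1 * l) ((c + 1) * l) < (H * l : ℤ) ∨
  sg ψ E V ((c + 1) * l) ((2 * c + 1) * l) < (H * l : ℤ) ∨
  ∃ k ∈ Finset.range (2 * (c + 1) + 1), G (ψ (dn E V (k * l)))

/-- All lines through a point are bad. -/
def BadPt (ψ : Lamplighter F' → Lamplighter F) (G : Lamplighter F → Prop) (l u c H : ℕ)
    (e : Lamplighter F') : Prop :=
  ∀ E V, dn E V ((c + 1) * l) = e → BadLine ψ G l u c H E V

/-- A point that is not linked to a nice point above. -/
def Unl (φ : Lamplighter F → Lamplighter F') (Rc : ℤ) (l L u : ℕ) (b : ℝ)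
    (p : Lamplighter F) : Prop :=
  ¬ ∃ r, Link φ Rc L p r ∧ crook φ l L u r ≤ b

/-- A point close below a crooked one in a given residue class. -/
def NearCrook (φ : Lamplighter F → Lamplighter F') (κ l L u : ℕ) (t : ℤ) (b : ℝ)
    (p : Lamplighter F) : Prop :=
  ∃ j ∈ Finset.range ((κ + 4) * l + 1),
    pos (mv p (j : ℤ)) % l = t ∧ b < crook φ l L u (mv p (j : ℤ))

lemma bd_crook (l L u : ℕ) : Bd (crook φ l L u) := Bd.Pr L _

lemma crook_nonneg (l L u : ℕ) (q : Lamplighter F) : 0 ≤ crook φ l L u q := Pr_nonneg _ _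

variable {κ : ℕ} (h : QIPair (κ : ℤ) φ ψ) {m : (Lamplighter F → ℝ) →ₗ[ℝ] ℝ} (hm : IsMean m)

lemma mean_nearCrook_le (hm : IsMean m) {l L u : ℕ} (hl : 0 < l) (t : ℤ) {b : ℝ} (hb : 0 < b) :
    m (fun p => ind (NearCrook φ κ l L u t b p)) ≤
      (κ + 5) * res m l t (crook φ l L u) / b := by
  have hbd : Bd fun p => ind (pos p % l = t) * crook φ l L u p :=
    (bd_ind _).mul (bd_crook l L u)
  have h1 : m (fun p => ind (NearCrook φ κ l L u t b p)) ≤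
      m (fun p => ∑ j ∈ Finset.range ((κ + 4) * l + 1), b⁻¹ *
        (ind (pos (mv p (j : ℤ)) % l = t) * crook φ l L u (mv p (j : ℤ)))) := by
    refine hm.mono (bd_ind _) (Bd.sum _ fun j _ => (Bd.const _).mul
      (hbd.comp fun p => mv p (j : ℤ))) fun p => ?_
    refine (ind_exists_le _ _).trans (Finset.sum_le_sum fun j _ => ?_)
    by_cases hp : pos (mv p (j : ℤ)) % l = t
    · rw [ind_pos' hp, one_mul, inv_mul_eq_div]
      exact ind_le_div hb (crook_nonneg _ _ _ _) fun hc => hc.2.le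
    · rw [ind_neg' hp, ind_neg' fun hc => hp hc.1]
      simp
  refine h1.trans ?_
  rw [lin_sum]
  simp only [lin_mul]
  rw [Finset.sum_congr rfl fun j _ => by rw [hm.mv hbd (j : ℤ)], Finset.sum_const,
    Finset.card_range, nsmul_eq_mul, res_apply]
  have h0 : 0 ≤ m fun p => ind (pos p % l = t) * crook φ l L u p :=
    hm.nonneg _ hbd fun p => mul_nonneg (ind_nonneg _) (crook_nonneg _ _ _ _)
  have hl' : (1 : ℝ) ≤ l := by exact_mod_cast hl
  rw [mul_div_assoc, mul_div_assoc, div_eq_inv_mul]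
  have : (((κ + 4) * l + 1 : ℕ) : ℝ) ≤ (κ + 5) * l := by push_cast; nlinarith
  calc _ ≤ (κ + 5) * (l : ℝ) * (b⁻¹ * m fun p => ind (pos p % l = t) * crook φ l L u p) :=
        mul_le_mul_of_nonneg_right this (by positivity)
    _ = _ := by ring

lemma mean_badPt_le (hm : IsMean m) {G : Lamplighter F' → Prop} {l u c H : ℕ} :
    m (fun q => ind (BadPt φ G l u c H q)) ≤
      m (fun q => Pr (2 * (c + 1) * l) (BadLine φ G l u c H q)) := by
  rw [← hm.dn (bd_ind fun q => BadPt φ G l u c H q) ((c + 1) * l)]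
  refine hm.mono (Bd.EL _ (C := 1) fun p x => ?_) (Bd.Pr _ _) fun q => ?_
  · rw [abs_of_nonneg (ind_nonneg _)]
    exact ind_le_one _
  · rw [← EL_of_le (L := 2 * (c + 1) * l) (Nat.mul_le_mul_right l (by omega))
      (fun x y hxy => by rw [dn_congr q hxy]), Pr_eq_EL_ind]
    exact EL_mono fun x => ind_mono fun hb => hb q x rfl

include h hm

lemma mean_crook_le {l L u : ℕ} {δ : ℝ} {l0 : ℕ} (hu : 0 < u)
    (hl0 : ∀ a ≥ l0, ∀ b ≥ l0, ∀ c ≥ l0,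
      m (eh φ a) + m (eh φ b) + m (eh φ c) - m (eh φ (a + b + c)) ≤ δ * (a + b + c))
    (hl : l0 ≤ l) (hL : 3 * l ≤ L) : m (crook φ l L u) ≤ δ * L / u := by
  have := h.mean_dfct_le hm (a0 := 0) (a1 := l) (a2 := L - l) (a3 := L) (L := L) (d := u)
    (by exact_mod_cast hu) hl0 (by omega) (by omega) (by omega) le_rfl
  rw [Nat.cast_zero, sub_zero, Int.cast_natCast] at this
  exact this

lemma mean_badLine_le {l u c H l0 : ℕ} {δ η : ℝ} (hu : 0 < u)
    (hδ : 0 ≤ δ)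
    (hl0 : ∀ a ≥ l0, ∀ b ≥ l0, ∀ c ≥ l0,
      m (eh φ a) + m (eh φ b) + m (eh φ c) - m (eh φ (a + b + c)) ≤ δ * (a + b + c))
    (hl : l0 ≤ l) (hη : ∀ q, Pr (c * l) (fun x => sg φ q x 0 (c * l) < (H * l : ℤ)) ≤ η)
    {G : Lamplighter F' → Prop} :
    m (fun q => Pr (2 * (c + 1) * l) (BadLine φ G l u c H q)) ≤
      3 * (c + 1) * (δ * (2 * (c + 1) * l) / u) + 2 * η * m (fun _ => 1) +
      (2 * c + 3) * m (fun q => ind (G (φ q))) := by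
  set N := 2 * (c + 1) * l with hN
  have hη0 : 0 ≤ η := (Pr_nonneg _ _).trans (hη 1)
  have hk : ∀ k, k ≤ 2 * (c + 1) → k * l ≤ N := fun k hk => Nat.mul_le_mul_right l hk
  have hu' : (0 : ℝ) < u := by exact_mod_cast hu
  set w : ℝ := δ * (2 * (c + 1) * l) / u with hw
  have hw0 : 0 ≤ w := by positivity
  have hd : ∀ a0 a1 a2 a3 : ℕ, a0 + 1 ≤ a1 → a1 + 1 ≤ a2 → a2 + 1 ≤ a3 → a3 ≤ 2 * (c + 1) →
      m (fun q => Pr N fun x => ¬ dfct φ q x (a0 * l) (a1 * l) (a2 * l) (a3 * l) ≤ u) ≤ w := by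
    intro a0 a1 a2 a3 h1 h2 h3 h4
    have f : ∀ a b : ℕ, a + 1 ≤ b → a * l + l0 ≤ b * l := fun a b hab => by
      have := Nat.mul_le_mul_right l hab
      rw [add_mul, one_mul] at this
      omega
    refine (h.mean_dfct_le hm (d := u) (by exact_mod_cast hu) hl0 (f _ _ h1) (f _ _ h2) (f _ _ h3)
      (hk a3 h4)).trans ?_
    rw [hw]
    have h5 : ((a3 * l : ℕ) : ℝ) ≤ 2 * (c + 1) * l := by exact_mod_cast hk a3 h4
    have h6 : (0 : ℝ) ≤ ((a0 * l : ℕ) : ℝ) := by positivity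
    rw [Int.cast_natCast]
    gcongr
    linarith
  have b1 : m (fun q => Pr N fun x => ∃ k ∈ Finset.Ioo (c + 1) (2 * (c + 1)),
      ¬ dfct φ q x (0 * l) ((c + 1) * l) (k * l) ((k + 1) * l) ≤ u) ≤ (c + 1) * w := by
    refine (hm.mono (Bd.Pr _ _) (Bd.sum _ fun k _ => Bd.Pr _ _) fun q =>
      Pr_exists (Finset.Ioo (c + 1) (2 * (c + 1))) N _).trans ?_
    rw [lin_sum]
    refine (Finset.sum_le_card_nsmul _ _ w fun k hk => ?_).trans ?_
    · rw [Finset.mem_Ioo] at hk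
      exact hd _ _ _ _ (by omega) (by omega) (by omega) (by omega)
    · rw [nsmul_eq_mul, Nat.card_Ioo]
      refine mul_le_mul_of_nonneg_right ?_ hw0
      exact_mod_cast (show 2 * (c + 1) - (c + 1) - 1 ≤ c + 1 by omega)
  have b2 : m (fun q => Pr N fun x => ∃ k ∈ Finset.Ioo 0 (c + 1),
      ¬ dfct φ q x ((k - 1) * l) (k * l) ((c + 1) * l) (2 * (c + 1) * l) ≤ u) ≤ (c + 1) * w := by
    refine (hm.mono (Bd.Pr _ _) (Bd.sum _ fun k _ => Bd.Pr _ _) fun q =>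
      Pr_exists (Finset.Ioo 0 (c + 1)) N _).trans ?_
    rw [lin_sum]
    refine (Finset.sum_le_card_nsmul _ _ w fun k hk => ?_).trans ?_
    · rw [Finset.mem_Ioo] at hk
      exact hd _ _ _ _ (by omega) (by omega) (by omega) (by omega)
    · rw [nsmul_eq_mul, Nat.card_Ioo]
      refine mul_le_mul_of_nonneg_right ?_ hw0
      exact_mod_cast (show c + 1 - 0 - 1 ≤ c + 1 by omega)
  have hfar : ∀ a : ℕ, a + c ≤ 2 * (c + 1) → ∀ q,
      Pr N (fun x => sg φ q x (a * l) ((a + c) * l) < (H * l : ℤ)) ≤ η := by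
    intro a ha q
    rw [Pr_of_le (a := a * l + c * l) (by rw [← add_mul]; exact hk _ ha) (fun x y hxy => by
      rw [sg_congr φ q (L := a * l + c * l) (by omega) (by rw [add_mul]) hxy]), Pr_split]
    refine (EL_mono fun x => ?_).trans (EL_const (F := F) (a * l) η).le
    refine le_trans (le_of_eq (Pr_congr fun y => ?_)) (hη (dn q x (a * l)))
    rw [add_mul, sg_cat]
  have b3 : m (fun q => Pr N fun x => sg φ q x (1 * l) ((c + 1) * l) < (H * l : ℤ)) ≤
      η * m (fun _ => 1) := by
    rw [← lin_const]
    refine hm.mono (Bd.Pr _ _) (Bd.const _) fun q => ?_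
    have := hfar 1 (by omega) q
    rwa [add_comm 1 c] at this
  have b4 : m (fun q => Pr N fun x => sg φ q x ((c + 1) * l) ((2 * c + 1) * l) < (H * l : ℤ)) ≤
      η * m (fun _ => 1) := by
    rw [← lin_const]
    refine hm.mono (Bd.Pr _ _) (Bd.const _) fun q => ?_
    have := hfar (c + 1) (by omega) q
    rwa [show c + 1 + c = 2 * c + 1 by ring] at this
  have b5 : m (fun q => Pr N fun x => ∃ k ∈ Finset.range (2 * (c + 1) + 1),
      G (φ (dn q x (k * l)))) ≤ (2 * c + 3) * m (fun q => ind (G (φ q))) := by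
    refine (hm.mono (Bd.Pr _ _) (Bd.sum _ fun k _ => Bd.Pr _ _) fun q =>
      Pr_exists (Finset.range (2 * (c + 1) + 1)) N _).trans ?_
    rw [lin_sum]
    refine (Finset.sum_le_card_nsmul _ _ (m (fun q => ind (G (φ q)))) fun k hk' => ?_).trans ?_
    · rw [Finset.mem_range] at hk'
      rw [← hm.dn (bd_ind fun q => G (φ q)) (k * l)]
      refine le_of_eq (congrArg m (funext fun q => ?_))
      rw [Pr_eq_EL_ind]
      refine EL_of_le (hk k (by omega)) fun x y hxy => ?_
      rw [dn_congr q hxy]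
    · rw [nsmul_eq_mul, Finset.card_range]
      push_cast
      linarith
  have htot : m (fun q => Pr N (BadLine φ G l u c H q)) ≤
      m (fun q => (Pr N fun x => ∃ k ∈ Finset.Ioo (c + 1) (2 * (c + 1)),
        ¬ dfct φ q x (0 * l) ((c + 1) * l) (k * l) ((k + 1) * l) ≤ u) +
      ((Pr N fun x => ∃ k ∈ Finset.Ioo 0 (c + 1),
        ¬ dfct φ q x ((k - 1) * l) (k * l) ((c + 1) * l) (2 * (c + 1) * l) ≤ u) +
      ((Pr N fun x => sg φ q x (1 * l) ((c + 1) * l) < (H * l : ℤ)) +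
      ((Pr N fun x => sg φ q x ((c + 1) * l) ((2 * c + 1) * l) < (H * l : ℤ)) +
      (Pr N fun x => ∃ k ∈ Finset.range (2 * (c + 1) + 1), G (φ (dn q x (k * l)))))))) := by
    refine hm.mono (Bd.Pr _ _) ((Bd.Pr _ _).add ((Bd.Pr _ _).add ((Bd.Pr _ _).add
      ((Bd.Pr _ _).add (Bd.Pr _ _))))) fun q => ?_
    refine (Pr_or _ _ _).trans (add_le_add_right ?_ _)
    refine (Pr_or _ _ _).trans (add_le_add_right ?_ _)
    refine (Pr_or _ _ _).trans (add_le_add_right ?_ _)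
    exact Pr_or _ _ _
  rw [lin_add, lin_add, lin_add, lin_add] at htot
  nlinarith

end

section

variable {F F' : Type} [Group F] [Group F'] [Fintype F] [Fintype F']
variable {φ : Lamplighter F → Lamplighter F'} {ψ : Lamplighter F' → Lamplighter F}
variable {κ : ℕ} (h : QIPair (κ : ℤ) φ ψ) {m : (Lamplighter F → ℝ) →ₗ[ℝ] ℝ} (hm : IsMean m)

include h

lemma QIPair.badPt_of_unl {l L u c H : ℕ} {Rc : ℤ} {b : ℝ} {t : ℤ}
    (hl : (κ : ℤ) * (3 * u) + 3 * κ < l) (hH : κ + 5 < H) (hc : 1 ≤ c) (hL : L = H * l)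
    (hRc : (c * l + ((κ : ℤ) ^ 2 + 10 * κ) * l) ≤ Rc) {p : Lamplighter F}
    (hp : Unl φ Rc l L u b p) (ht : pos p % l = t) (j0 : ℕ) (hj0 : 2 * l ≤ j0)
    (hj0' : j0 < 3 * l) :
    BadPt ψ (NearCrook φ κ l L u t b) l u c H (φ (mv p j0)) := by
  intro E V hE
  by_contra hbad
  unfold BadLine at hbad
  push Not at hbad
  obtain ⟨g1, g2, g3, g4, g5⟩ := hbad
  obtain ⟨q, hq, k, hk, j, hj, hqj⟩ := h.exists_link (l := l) (H := H) (c := c) (u := u)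
    (by positivity) hl (by exact_mod_cast hH) (by exact_mod_cast hc) E V
    (fun k h1 h2 => g1 k (Finset.mem_Ioo.2 ⟨h1, h2⟩))
    (fun k h1 h2 => g2 k (Finset.mem_Ioo.2 ⟨h1, h2⟩)) g3 g4 _ hE.symm j0 hj0 hj0'
  rw [mv_mv, add_neg_cancel, mv_zero] at hq
  refine hp ⟨q, ?_, ?_⟩
  · obtain ⟨q1, q2, q3, q4⟩ := hq
    rw [hL]
    exact ⟨q1, q2, q3, q4.trans hRc⟩
  · by_contra hcr
    refine g5 k (Finset.mem_range.2 (by omega)) ⟨j, Finset.mem_range.2 ?_, ?_⟩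
    · have : j ≤ (κ + 4) * l := by exact_mod_cast hj
      omega
    · rw [← hqj]
      refine ⟨?_, not_le.1 hcr⟩
      rw [hq.1, ← ht]
      push_cast
      rw [Int.add_mul_emod_self_right]

include hm

lemma res_unl_le {l L u c H : ℕ} {Rc : ℤ} {b : ℝ} (t : ℤ)
    (hl : (κ : ℤ) * (3 * u) + 3 * κ < l) (hH : κ + 5 < H) (hc : 1 ≤ c) (hL : L = H * l)
    (hRc : (c * l + ((κ : ℤ) ^ 2 + 10 * κ) * l) ≤ Rc) :
    res m l t (fun p => ind (Unl φ Rc l L u b p)) ≤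
      mult F κ * pull h.symm.fiber_finite m
        (fun e => ind (BadPt ψ (NearCrook φ κ l L u t b) l u c H e)) := by
  set B : Lamplighter F' → ℝ := fun e => ind (BadPt ψ (NearCrook φ κ l L u t b) l u c H e)
  have hB : Bd B := bd_ind _
  refine le_trans ?_ (h.comp_le_pull hm hB fun e => ind_nonneg _)
  set w : Lamplighter F → ℝ := fun p => ind (pos p % l = t) * ind (Unl φ Rc l L u b p) with hw
  have bw : Bd w := (bd_ind _).mul (bd_ind _)
  have h1 : m (fun p => ∑ j ∈ Finset.Ico (2 * l) (3 * l), w (mv p (-(j : ℤ)))) ≤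
      m (fun p => B (φ p)) := by
    refine hm.mono (Bd.sum _ fun j _ => bw.comp fun p => mv p (-(j : ℤ))) (hB.comp φ)
      fun p => ?_
    by_cases hex : ∃ j ∈ Finset.Ico (2 * l) (3 * l), pos (mv p (-(j : ℤ))) % l = t ∧
        Unl φ Rc l L u b (mv p (-(j : ℤ)))
    · obtain ⟨j, hj, hj1, hj2⟩ := hex
      have hj' := Finset.mem_Ico.1 hj
      have hbad := h.badPt_of_unl hl hH hc hL hRc hj2 hj1 j hj'.1 hj'.2
      rw [mv_mv, neg_add_cancel, mv_zero] at hbad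
      rw [Finset.sum_eq_single j, show B (φ p) = 1 from ind_pos' hbad]
      · exact mul_le_one₀ (ind_le_one _) (ind_nonneg _) (ind_le_one _)
      · intro i hi hij
        have hi' := Finset.mem_Ico.1 hi
        refine mul_eq_zero_of_left (ind_neg' fun hc => hij ?_) _
        rw [pos_mv] at hc hj1
        have h2 : (l : ℤ) ∣ (i : ℤ) - j := by
          have h3 := Int.ModEq.dvd (hc.trans hj1.symm : _ ≡ _ [ZMOD l])
          rwa [show pos p + -(j : ℤ) - (pos p + -(i : ℤ)) = i - j by ring] at h3
        have := Int.eq_zero_of_abs_lt_dvd h2 (abs_lt.2 ⟨by omega, by omega⟩)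
        omega
      · exact fun hj' => absurd hj hj'
    · push Not at hex
      rw [Finset.sum_eq_zero]
      · exact ind_nonneg _
      · intro j hj
        by_cases hp : pos (mv p (-(j : ℤ))) % l = t
        · exact mul_eq_zero_of_right _ (ind_neg' (hex j hj hp))
        · exact mul_eq_zero_of_left (ind_neg' hp) _
  rw [lin_sum, Finset.sum_congr rfl fun (j : ℕ) _ => hm.mv bw (-(j : ℤ)), Finset.sum_const,
    Nat.card_Ico, nsmul_eq_mul, show 3 * l - 2 * l = l by omega] at h1
  exact h1

lemma res_eh_le {l L u bb : ℕ} {Rc : ℤ} {b : ℝ} {t : ℕ} (ht : t < l) (hu : 0 < u) (hb : 0 < b)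
    (hm1 : m (fun _ => 1) = 1)
    (hL : 3 * l ≤ L) (hlL : l ∣ L) (hl : u + (κ : ℤ) * (3 * u) + 3 * κ < l) (hRc : 0 ≤ Rc)
    (hbb : κ * L + κ ≤ bb * u) :
    res m l t (eh φ L) ≤ Rc + 4 * (κ * l + κ) + 7 * u +
      (κ * L + κ) * (2 * b + 2 * (2 * bb + 1) ^ 2 * (b + ((Fintype.card F : ℝ) ^ u)⁻¹)) +
      (κ * L + κ) / b * (res m l t (crook φ l L u) +
        res m l t (fun p => ind (Unl φ Rc l L u b p))) := by
  set X : ℝ := Rc + 4 * (κ * l + κ) + 7 * u +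
      (κ * L + κ) * (2 * b + 2 * (2 * bb + 1) ^ 2 * (b + ((Fintype.card F : ℝ) ^ u)⁻¹)) with hX
  have hRc' : (0 : ℝ) ≤ Rc := by exact_mod_cast hRc
  have hX0 : 0 ≤ X := by positivity
  have key : ∀ q, eh φ L q ≤ X * 1 + ((κ * L + κ) / b * (crook φ l L u q +
      EL L fun x => ind (Unl φ Rc l L u b (dn q x L)))) := by
    intro q
    have hun0 : 0 ≤ EL L fun x => ind (Unl φ Rc l L u b (dn q x L)) :=
      EL_nonneg fun x => ind_nonneg _
    have hcr0 := crook_nonneg (φ := φ) l L u q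
    have hle := h.eh_le L q
    rw [Int.cast_natCast] at hle
    have hpos : 0 ≤ ((κ : ℝ) * L + κ) / b := by positivity
    by_cases h1 : crook φ l L u q ≤ b
    · by_cases h2 : (EL L fun x => ind (Unl φ Rc l L u b (dn q x L))) ≤ b
      · have := h.eh_le_of_link hu hL hl hRc (by exact_mod_cast hbb) h1 h2
        rw [Int.cast_natCast] at this
        have h3 := mul_nonneg hpos (add_nonneg hcr0 hun0)
        linarith
      · have h3 : ((κ : ℝ) * L + κ) / b * b ≤ (κ * L + κ) / b * (crook φ l L u q +
            EL L fun x => ind (Unl φ Rc l L u b (dn q x L))) :=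
          mul_le_mul_of_nonneg_left (by linarith) hpos
        rw [div_mul_cancel₀ _ hb.ne'] at h3
        linarith
    · have h3 : ((κ : ℝ) * L + κ) / b * b ≤ (κ * L + κ) / b * (crook φ l L u q +
            EL L fun x => ind (Unl φ Rc l L u b (dn q x L))) :=
        mul_le_mul_of_nonneg_left (by linarith) hpos
      rw [div_mul_cancel₀ _ hb.ne'] at h3
      linarith
  have bU : Bd fun q => EL L fun x => ind (Unl φ Rc l L u b (dn q x L)) :=
    Bd.EL L (C := 1) fun p x => by
      rw [abs_of_nonneg (ind_nonneg _)]
      exact ind_le_one _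
  refine (res_mono hm (h.bd_eh L) (((Bd.const X).mul (Bd.const 1)).add
    ((Bd.const _).mul ((bd_crook l L u).add bU))) key).trans (le_of_eq ?_)
  rw [lin_add, lin_mul, lin_mul, lin_add, res_one hm ht, hm1, mul_one,
    res_dn hm hlL (bd_ind fun p => Unl φ Rc l L u b p)]

end

section

variable {F F' : Type} [Group F] [Group F'] [Fintype F] [Fintype F']
variable {φ : Lamplighter F → Lamplighter F'} {ψ : Lamplighter F' → Lamplighter F}

lemma exists_small_params {C1 C2 C3 x ε0 : ℝ} (hε : 0 < ε0) (h1 : 0 < C1) (h2 : 0 ≤ C2)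
    (h3 : 0 < C3) (hx : 0 ≤ x) : ∃ β η δ : ℝ, 0 < β ∧ 0 < η ∧ 0 < δ ∧ C1 * β ≤ ε0 / 16 ∧
      C2 * δ ≤ ε0 / 16 ∧ C3 * η ≤ ε0 / 16 ∧ x / β * δ ≤ ε0 / 2 := by
  have hβ : 0 < ε0 / (16 * C1) := by positivity
  obtain ⟨y, hy⟩ : ∃ y, y = x / (ε0 / (16 * C1)) := ⟨_, rfl⟩
  have hy0 : 0 ≤ y := by rw [hy]; positivity
  have hW0 : 0 < 16 * C2 + 2 * y + 1 := by positivity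
  refine ⟨ε0 / (16 * C1), ε0 / (16 * C3), ε0 / (16 * C2 + 2 * y + 1), hβ, by positivity,
    by positivity, le_of_eq (by field_simp), ?_, le_of_eq (by field_simp), ?_⟩
  · rw [mul_div_assoc', div_le_iff₀ hW0]
    nlinarith
  · rw [← hy, mul_div_assoc', div_le_iff₀ hW0]
    nlinarith

lemma main_term_le {κ L l u H c ρ ε0 b B v : ℝ} (hκ : 1 ≤ κ) (hL : 1 ≤ L) (hu : 1 ≤ u)
    (hul : u ≤ l) (hLl : L = H * l) (hv : v ≤ b)
    (hc : c ≤ (ρ + ε0 / 16) * H + 1) (hHε : 16 * (κ ^ 2 + 18 * κ + 8) ≤ ε0 * H)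
    (hPb : 2 * κ * (2 + 4 * B ^ 2) * b = ε0 / 8) (hb : 0 < b) (hv0 : 0 ≤ v) :
    (c * l + (κ ^ 2 + 10 * κ) * l) + 4 * (κ * l + κ) + 7 * u +
      (κ * L + κ) * (2 * b + 2 * B ^ 2 * (b + v)) ≤ (ρ + ε0 / 4) * L := by
  have hl : 1 ≤ l := hu.trans hul
  have h1 : (κ * L + κ) * (2 * b + 2 * B ^ 2 * (b + v)) ≤ ε0 / 8 * L := by
    have h2 : (2 * b + 2 * B ^ 2 * (b + v)) ≤ (2 + 4 * B ^ 2) * b := by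
      nlinarith [sq_nonneg B]
    have h3 : κ * L + κ ≤ 2 * κ * L := by nlinarith
    calc _ ≤ 2 * κ * L * ((2 + 4 * B ^ 2) * b) :=
          mul_le_mul h3 h2 (by positivity) (by positivity)
      _ = ε0 / 8 * L := by rw [← hPb]; ring
  have h4 : c * l ≤ ((ρ + ε0 / 16) * H + 1) * l := mul_le_mul_of_nonneg_right hc (by linarith)
  have h5 : 16 * (κ ^ 2 + 18 * κ + 8) * l ≤ ε0 * H * l :=
    mul_le_mul_of_nonneg_right hHε (by linarith)
  have h6 : κ ≤ κ * l := by nlinarith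
  rw [hLl] at *
  nlinarith

lemma error_term_le {κ L l u c b D M M' β η δ m1 N N' B un cr ε0 : ℝ} (hκ : 1 ≤ κ) (hL : 1 ≤ L)
    (hb : 0 < b) (hu : 0 < u) (hl : l = D * u) (hc : 0 ≤ c) (hη : 0 ≤ η)
    (hM : 0 < M) (hM' : 0 < M') (hcr : cr ≤ β)
    (hN' : N' ≤ (κ + 5) * cr / b) (hN : N ≤ M' * N') (hm1 : m1 ≤ M')
    (hB : B ≤ 3 * (c + 1) * (δ * (2 * (c + 1) * l) / u) + 2 * η * m1 + (2 * c + 3) * N)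
    (hun : un ≤ M * B) (h0 : 0 ≤ cr + un)
    (h1 : 2 * κ / b * (1 + M * ((2 * c + 3) * (M' * ((κ + 5) / b)))) * β ≤ ε0 / 16)
    (h2 : 2 * κ / b * (M * (6 * (c + 1) ^ 2 * D)) * δ ≤ ε0 / 16)
    (h3 : 2 * κ / b * (M * (2 * M')) * η ≤ ε0 / 16) :
    (κ * L + κ) / b * (cr + un) ≤ 3 * ε0 / 16 * L := by
  have e1 : N' ≤ (κ + 5) / b * β := by
    refine hN'.trans ?_
    rw [mul_div_right_comm]
    exact mul_le_mul_of_nonneg_left hcr (by positivity)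
  have e2 : N ≤ M' * ((κ + 5) / b * β) := hN.trans (mul_le_mul_of_nonneg_left e1 hM'.le)
  have e3 : B ≤ 6 * (c + 1) ^ 2 * D * δ + 2 * η * M' +
      (2 * c + 3) * (M' * ((κ + 5) / b * β)) := by
    refine hB.trans (add_le_add (add_le_add (le_of_eq ?_) ?_) ?_)
    · rw [hl]
      field_simp
      ring
    · exact mul_le_mul_of_nonneg_left hm1 (by positivity)
    · exact mul_le_mul_of_nonneg_left e2 (by positivity)
  have e4 := hun.trans (mul_le_mul_of_nonneg_left e3 hM.le)
  have e5 : (κ * L + κ) / b ≤ 2 * κ / b * L := by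
    rw [div_mul_eq_mul_div]
    exact div_le_div_of_nonneg_right (by nlinarith) hb.le
  calc _ ≤ 2 * κ / b * L * (cr + un) := mul_le_mul_of_nonneg_right e5 h0
    _ ≤ 2 * κ / b * L * (β + M * (6 * (c + 1) ^ 2 * D * δ + 2 * η * M' +
      (2 * c + 3) * (M' * ((κ + 5) / b * β)))) :=
        mul_le_mul_of_nonneg_left (add_le_add hcr e4) (by positivity)
    _ = (2 * κ / b * (1 + M * ((2 * c + 3) * (M' * ((κ + 5) / b)))) * β +
      2 * κ / b * (M * (6 * (c + 1) ^ 2 * D)) * δ + 2 * κ / b * (M * (2 * M')) * η) * L := by ring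
    _ ≤ _ := mul_le_mul_of_nonneg_right (by linarith) (by linarith)

set_option maxHeartbeats 1000000 in
theorem QIPair.mean_upper {κ : ℕ} (h : QIPair (κ : ℤ) φ ψ)
    {m : (Lamplighter F → ℝ) →ₗ[ℝ] ℝ} (hm : IsMean m) (hm1 : m (fun _ => 1) = 1)
    (hF : 2 ≤ Fintype.card F) (hF' : 2 ≤ Fintype.card F') {ε0 : ℝ} (hε : 0 < ε0) :
    ∃ L : ℕ, 0 < L ∧ m (eh φ L) ≤ (rate F F' + ε0) * L := by
  by_contra! hcon
  have hκ1 : 1 ≤ κ := by exact_mod_cast h.one_le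
  have hκ : (1 : ℝ) ≤ κ := by exact_mod_cast hκ1
  obtain ⟨ρ, hρ⟩ : ∃ ρ, ρ = rate F F' := ⟨_, rfl⟩
  rw [← hρ] at hcon
  have hρ0 : 0 < ρ := hρ ▸ rate_pos hF hF'
  have hρρ : ρ * rate F' F = 1 := hρ ▸ rate_mul_rate hF hF'
  obtain ⟨H, hH1⟩ := exists_nat_ge (16 * ((κ : ℝ) ^ 2 + 18 * κ + 8) / ε0 + κ + 6)
  have hH0 : 0 ≤ 16 * ((κ : ℝ) ^ 2 + 18 * κ + 8) / ε0 := by positivity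
  have hHr : (κ : ℝ) + 6 ≤ H := by linarith
  have hHκ : κ + 5 < H := by
    have : κ + 6 ≤ H := by exact_mod_cast hHr
    omega
  have hHpos : (0 : ℝ) < H := by linarith
  have hHε : 16 * ((κ : ℝ) ^ 2 + 18 * κ + 8) ≤ ε0 * H := by
    have : 16 * ((κ : ℝ) ^ 2 + 18 * κ + 8) / ε0 ≤ H := by linarith
    rw [div_le_iff₀ hε] at this
    linarith
  obtain ⟨c, hcge, hcle, hc1⟩ : ∃ c : ℕ, (ρ + ε0 / 16) * H ≤ c ∧
      (c : ℝ) ≤ (ρ + ε0 / 16) * H + 1 ∧ 1 ≤ c :=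
    ⟨⌈(ρ + ε0 / 16) * H⌉₊, Nat.le_ceil _, (Nat.ceil_lt_add_one (by positivity)).le,
      Nat.ceil_pos.2 (by positivity)⟩
  obtain ⟨D, hD⟩ : ∃ D, D = 8 * κ := ⟨_, rfl⟩
  obtain ⟨bb, hbb⟩ : ∃ bb, bb = 2 * κ * H * D := ⟨_, rfl⟩
  obtain ⟨b, hb0, hPb⟩ : ∃ b : ℝ, 0 < b ∧ 2 * κ * (2 + 4 * (2 * bb + 1) ^ 2) * b = ε0 / 8 := by
    have hP : (0 : ℝ) < 2 * κ * (2 + 4 * (2 * bb + 1) ^ 2) := by positivity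
    exact ⟨ε0 / 8 / (2 * κ * (2 + 4 * (2 * bb + 1) ^ 2)), by positivity, mul_div_cancel₀ _ hP.ne'⟩
  obtain ⟨M, hM⟩ : ∃ M : ℝ, M = ((mult F κ : ℕ) : ℝ) := ⟨_, rfl⟩
  obtain ⟨M', hM'⟩ : ∃ M' : ℝ, M' = ((mult F' κ : ℕ) : ℝ) := ⟨_, rfl⟩
  have hM0 : 0 < M := by rw [hM]; exact_mod_cast mult_pos F κ
  have hM'0 : 0 < M' := by rw [hM']; exact_mod_cast mult_pos F' κ
  obtain ⟨β, η, δ, hβ0, hη0, hδ0, hβ1, hδ1, hη1, hδ2⟩ := exists_small_params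
    (C1 := 2 * κ / b * (1 + M * ((2 * c + 3) * (M' * ((κ + 5) / b)))))
    (C2 := 2 * κ / b * (M * (6 * (c + 1) ^ 2 * D))) (C3 := 2 * κ / b * (M * (2 * M')))
    (x := H * D * (2 * κ)) hε (by positivity) (by positivity) (by positivity) (by positivity)
  obtain ⟨A, hA⟩ : ∃ A : ℝ, A = 2 * κ / β := ⟨_, rfl⟩
  have hA0 : 0 < A := by rw [hA]; positivity
  have hAβ : A * β = 2 * κ := by rw [hA]; field_simp
  -- geometric data at this scale
  obtain ⟨l1, hl1⟩ := h.exists_scale hm hδ0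
  set m' := pull h.symm.fiber_finite m with hm'
  have hmm' : IsMean m' := h.isMean_pull hm
  obtain ⟨l2, hl2⟩ := h.symm.exists_scale hmm' hδ0
  have hm'1 : m' (fun _ => 1) ≤ M' := by
    have := h.pull_comp_le hm (g := fun _ => 1) (Bd.const 1) fun _ => zero_le_one
    rwa [hm1, mul_one, ← hM'] at this
  obtain ⟨ε, hεd⟩ : ∃ ε : ℝ, ε = rate F' F - 1 / (ρ + ε0 / 16) := ⟨_, rfl⟩
  have hεp : 0 < ε := by
    have : rate F' F = 1 / ρ := by field_simp; linarith
    rw [hεd, this, sub_pos]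
    exact one_div_lt_one_div_of_lt hρ0 (by linarith)
  obtain ⟨L0, hL0⟩ := h.symm.lower_bound hF' hF hεp hη0
  obtain ⟨u0, hu0⟩ := exists_pow_lt_of_lt_one hb0
    (show ((Fintype.card F : ℝ))⁻¹ < 1 from inv_lt_one_of_one_lt₀ (by exact_mod_cast hF))
  obtain ⟨u, hu⟩ : ∃ u, u = l1 + l2 + L0 + u0 + 1 := ⟨_, rfl⟩
  have hu1 : 1 ≤ u := by omega
  obtain ⟨l, hl⟩ : ∃ l, l = D * u := ⟨_, rfl⟩
  have hul : u ≤ l := by rw [hl]; exact Nat.le_mul_of_pos_left u (by omega)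
  have hl0 : 0 < l := by omega
  obtain ⟨L, hL⟩ : ∃ L, L = H * l := ⟨_, rfl⟩
  have hL3 : 3 * l ≤ L := hL ▸ Nat.mul_le_mul_right l (by omega)
  have hLpos : 0 < L := by omega
  have hLr : (0 : ℝ) < L := by exact_mod_cast hLpos
  have hL1 : (1 : ℝ) ≤ L := by exact_mod_cast hLpos
  have hur : (1 : ℝ) ≤ u := by exact_mod_cast hu1
  have hlr : (l : ℝ) = D * u := by rw [hl]; push_cast; ring
  have hLl : (L : ℝ) = H * l := by rw [hL]; push_cast; ring
  have hlu : (u + (κ : ℤ) * (3 * u) + 3 * κ) < l := by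
    have h1 : (κ : ℤ) ≤ κ * u := by exact_mod_cast Nat.le_mul_of_pos_right κ hu1
    have h2 : (u : ℤ) ≤ κ * u := by exact_mod_cast Nat.le_mul_of_pos_left u hκ1
    have h3 : (l : ℤ) = 8 * (κ * u) := by rw [hl, hD]; push_cast; ring
    rw [show (κ : ℤ) * (3 * u) = 3 * (κ * u) by ring, h3]
    omega
  have hlu' : (κ : ℤ) * (3 * u) + 3 * κ < l := by omega
  -- choice of a residue class
  have hcr : m (crook φ l L u) ≤ δ * (H * D) := by
    refine (mean_crook_le h hm (by omega) hl1 (by omega) hL3).trans (le_of_eq ?_)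
    rw [hLl, hlr]
    field_simp
  have hf : 0 ≤ m (fun q => (L : ℝ)⁻¹ * eh φ L q - ((ρ + ε0 / 2) * 1 + A * crook φ l L u q)) := by
    rw [lin_sub, lin_add, lin_mul, lin_mul, lin_mul, hm1]
    have h1 := hcon L hLpos
    have h2 : ρ + ε0 ≤ (L : ℝ)⁻¹ * m (eh φ L) := by
      rw [inv_mul_eq_div, le_div_iff₀ hLr]
      exact h1.le
    have h3 : A * m (crook φ l L u) ≤ ε0 / 2 := by
      calc _ ≤ A * (δ * (H * D)) := mul_le_mul_of_nonneg_left hcr hA0.le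
        _ ≤ _ := by
          rw [hA]
          refine le_trans (le_of_eq ?_) hδ2
          ring
    have h4 : m (fun p => eh φ L p) = m (eh φ L) := rfl
    have h5 : m (fun p => crook φ l L u p) = m (crook φ l L u) := rfl
    linarith
  obtain ⟨t, ht, hres⟩ := exists_res_nonneg hl0 hf
  rw [lin_sub, lin_add, lin_mul, lin_mul, lin_mul, res_one hm ht, hm1, mul_one] at hres
  set cr := res m l t (crook φ l L u) with hcrd
  change 0 ≤ (L : ℝ)⁻¹ * res m l t (eh φ L) - (ρ + ε0 / 2 + A * cr) at hres
  have hcr0 : 0 ≤ cr := by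
    have := res_mono hm (l := l) (t := t) ((Bd.const 0)) (bd_crook (φ := φ) l L u)
      fun p => crook_nonneg _ _ _ _
    have h0 : res m l t (fun _ => 0) = 0 := map_zero (res m l t)
    rwa [h0] at this
  have hreL : res m l t (eh φ L) ≤ 2 * κ * L := by
    have h1 := res_mono hm (l := l) (t := t) (h.bd_eh L) (Bd.const (2 * κ * L)) fun q => by
      have := h.eh_le L q
      rw [Int.cast_natCast] at this
      have h2 : (κ : ℝ) ≤ κ * L := le_mul_of_one_le_right (by positivity) hL1
      linarith
    rwa [lin_const (res m l t), res_one hm ht, hm1, mul_one] at h1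
  have hre : (ρ + ε0 / 2 + A * cr) * L ≤ res m l t (eh φ L) := by
    have : ρ + ε0 / 2 + A * cr ≤ (L : ℝ)⁻¹ * res m l t (eh φ L) := by linarith
    rwa [inv_mul_eq_div, le_div_iff₀ hLr] at this
  have hcrβ : cr ≤ β := by
    have h1 : A * cr * L ≤ A * β * L := by
      rw [hAβ]
      have h2 : 0 < (ρ + ε0 / 2) * L := by positivity
      linarith
    exact le_of_mul_le_mul_left (le_of_mul_le_mul_right h1 hLr) hA0
  -- upper bound
  obtain ⟨Rc, hRc⟩ : ∃ Rc : ℤ, Rc = c * l + ((κ : ℤ) ^ 2 + 10 * κ) * l := ⟨_, rfl⟩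
  have hRc0 : 0 ≤ Rc := by rw [hRc]; positivity
  have hfarη : ∀ q, Pr (c * l) (fun x => sg ψ q x 0 (c * l) < (H * l : ℤ)) ≤ η := by
    intro q
    refine (Pr_mono fun x hx => ?_).trans (hL0 (c * l)
      (le_trans (by omega : L0 ≤ l) (Nat.le_mul_of_pos_left l hc1)) q)
    have h1 : (len (ψ q) (ψ (dn q x (c * l))) : ℝ) < H * l := by
      have : len (ψ q) (ψ (dn q x (c * l))) < H * l := by
        simpa [sg, dn_zero] using hx
      exact_mod_cast this
    refine h1.le.trans ?_
    rw [hεd, sub_sub_cancel]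
    push_cast
    rw [← mul_assoc]
    refine mul_le_mul_of_nonneg_right ?_ (by positivity)
    rw [one_div_mul_eq_div, le_div_iff₀ (by positivity)]
    linarith
  have hun := res_unl_le h hm (u := u) (b := b) (t : ℤ) hlu' hHκ hc1 hL hRc.ge
  have hbp := mean_badPt_le hmm' (φ := ψ) (G := NearCrook φ κ l L u t b) (l := l) (u := u)
    (c := c) (H := H)
  have hbl := mean_badLine_le h.symm hmm' (G := NearCrook φ κ l L u t b) (u := u) (c := c)
    hu1 hδ0.le hl2 (show l2 ≤ l by omega) hfarη
  have hnc := mean_nearCrook_le (κ := κ) (φ := φ) (L := L) (u := u) hm hl0 (t : ℤ) hb0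
  have hpc := h.pull_comp_le hm (bd_ind fun p => NearCrook φ κ l L u t b p) fun _ => ind_nonneg _
  have heh := res_eh_le h hm ht hu1 hb0 hm1 hL3 (Dvd.intro_left H hL.symm) hlu hRc0 (bb := bb) (by
    have : κ ≤ κ * L := Nat.le_mul_of_pos_right κ hLpos
    have h2 : κ * L = κ * H * D * u := by rw [hL, hl]; ring
    have h3 : bb * u = 2 * (κ * H * D * u) := by rw [hbb]; ring
    omega)
  have hvb : ((Fintype.card F : ℝ) ^ u)⁻¹ ≤ b := by
    rw [← inv_pow]
    refine (pow_le_pow_of_le_one (by positivity) ?_ (show u0 ≤ u by omega)).trans hu0.le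
    exact inv_le_one_of_one_le₀ (by exact_mod_cast (show 1 ≤ Fintype.card F by omega))
  have hun0 : 0 ≤ res m l t (fun p => ind (Unl φ Rc l L u b p)) := by
    have := res_mono hm (l := l) (t := t) ((Bd.const 0))
      (bd_ind fun p => Unl φ Rc l L u b p) fun p => ind_nonneg _
    have h0 : res m l t (fun _ => 0) = 0 := map_zero (res m l t)
    rwa [h0] at this
  have hmain := main_term_le (v := ((Fintype.card F : ℝ) ^ u)⁻¹) hκ hL1 hur
    (by exact_mod_cast hul) hLl hvb hcle hHε hPb hb0 (by positivity)
  have herr := error_term_le hκ hL1 hb0 (by linarith) hlr (by positivity) hη0.le hM0 hM'0 hcrβ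
    hnc (hM' ▸ hpc) hm'1 hbl (hun.trans (by rw [hM]; exact mul_le_mul_of_nonneg_left hbp (by positivity)))
    (add_nonneg hcr0 hun0) hβ1 hδ1 hη1
  have hRr : (Rc : ℝ) = c * l + ((κ : ℝ) ^ 2 + 10 * κ) * l := by
    rw [hRc]
    push_cast
    ring
  rw [hRr, ← hcrd] at heh
  have h1 : 0 ≤ A * cr * L := by positivity
  have h2 : 0 < ε0 * L := mul_pos hε hLr
  clear_value cr
  clear hnc hbp hbl hpc hun hcon hl1 hl2 hL0 hfarη
  linarith

end

section

variable {F F' : Type} [Group F] [Group F'] [Fintype F] [Fintype F']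
variable {K : ℤ} {φ : Lamplighter F → Lamplighter F'} {ψ : Lamplighter F' → Lamplighter F}

/-- The limit of a sequence along a fixed nonprincipal ultrafilter. -/
def ulim (f : ℕ → ℝ) : ℝ := (Filter.hyperfilter ℕ : Filter ℕ).limUnder f

lemma tendsto_ulim {f : ℕ → ℝ} {C : ℝ} (h : ∀ n, |f n| ≤ C) :
    Filter.Tendsto f (Filter.hyperfilter ℕ) (nhds (ulim f)) := by
  have hc : IsCompact (Set.Icc (-C) C) := isCompact_Icc
  obtain ⟨x, _, hx⟩ := hc.ultrafilter_le_nhds ((Filter.hyperfilter ℕ).map f) (by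
    rw [Ultrafilter.coe_map, Filter.le_principal_iff, Filter.mem_map]
    exact Filter.Eventually.of_forall fun n => abs_le.1 (h n))
  exact tendsto_nhds_limUnder ⟨x, hx⟩

lemma ulim_eq {f : ℕ → ℝ} {x : ℝ}
    (h : Filter.Tendsto f (Filter.hyperfilter ℕ) (nhds x)) : ulim f = x := h.limUnder_eq

lemma tendsto_hyper {f : ℕ → ℝ} {x : ℝ} (h : Filter.Tendsto f Filter.atTop (nhds x)) :
    Filter.Tendsto f (Filter.hyperfilter ℕ) (nhds x) :=
  h.mono_left (by rw [← Nat.cofinite_eq_atTop]; exact Filter.hyperfilter_le_cofinite)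

/-- The bounded functions. -/
def bdSub (X : Type) : Submodule ℝ (X → ℝ) where
  carrier := {g | Bd g}
  add_mem' := fun h h' => h.add h'
  zero_mem' := Bd.const 0
  smul_mem' := fun c _ h => (Bd.const c).mul h

lemma exists_limit_mean (A : ℕ → (Lamplighter F → ℝ) → ℝ)
    (hadd : ∀ k g g', A k (fun p => g p + g' p) = A k g + A k g')
    (hmul : ∀ k c g, A k (fun p => c * g p) = c * A k g)
    (hmono : ∀ k g, (∀ p, 0 ≤ g p) → 0 ≤ A k g) (hone : ∀ k, A k (fun _ => 1) = 1)
    (hinv : ∀ g a, Bd g → Filter.Tendsto (fun k => A k (fun p => g (p * a)) - A k g)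
      Filter.atTop (nhds 0)) :
    ∃ m : (Lamplighter F → ℝ) →ₗ[ℝ] ℝ, IsMean m ∧ m (fun _ => 1) = 1 ∧
      ∀ g, Bd g → Filter.Tendsto (fun k => A k g) (Filter.hyperfilter ℕ) (nhds (m g)) := by
  have habs : ∀ k g C, (∀ p, |g p| ≤ C) → |A k g| ≤ C := by
    intro k g C hg
    have h1 := hmono k (fun p => C * 1 + (-1) * g p) fun p => by linarith [(abs_le.1 (hg p)).2]
    have h2 := hmono k (fun p => C * 1 + g p) fun p => by linarith [(abs_le.1 (hg p)).1]
    rw [hadd, hmul, hmul, hone] at h1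
    rw [hadd, hmul, hone] at h2
    have h3 : A k (fun p => g p) = A k g := rfl
    exact abs_le.2 ⟨by linarith, by linarith⟩
  have hten : ∀ g, Bd g →
      Filter.Tendsto (fun k => A k g) (Filter.hyperfilter ℕ) (nhds (ulim fun k => A k g)) := by
    rintro g ⟨C, hC⟩
    exact tendsto_ulim fun k => habs k g C hC
  let m0 : bdSub (Lamplighter F) →ₗ[ℝ] ℝ :=
    { toFun := fun g => ulim fun k => A k g.1
      map_add' := fun g g' => by
        refine ulim_eq ?_
        have := (hten _ g.2).add (hten _ g'.2)
        refine this.congr fun k => ?_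
        exact (hadd k g.1 g'.1).symm
      map_smul' := fun c g => by
        refine ulim_eq ?_
        have := (hten _ g.2).const_mul c
        refine this.congr fun k => ?_
        exact (hmul k c g.1).symm }
  obtain ⟨m, hm⟩ := m0.exists_extend
  have hmg : ∀ g, Bd g → m g = ulim fun k => A k g := fun g hg => by
    have := LinearMap.congr_fun hm (⟨g, hg⟩ : bdSub (Lamplighter F))
    exact this
  have hlim : ∀ g, Bd g →
      Filter.Tendsto (fun k => A k g) (Filter.hyperfilter ℕ) (nhds (m g)) := fun g hg => by
    rw [hmg g hg]
    exact hten g hg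
  refine ⟨m, ⟨fun g hg h0 => ?_, fun g a hg => ?_⟩, ?_, hlim⟩
  · exact ge_of_tendsto' (hlim g hg) fun k => hmono k g h0
  · have h1 := (hlim _ (hg.comp fun p => p * a)).sub (hlim g hg)
    have h2 := tendsto_nhds_unique h1 (tendsto_hyper (hinv g a hg))
    linarith
  · refine tendsto_nhds_unique (hlim _ (Bd.const 1)) ?_
    simp only [hone]
    exact tendsto_const_nhds

/-- The point of a box with configuration `x` at a given level. -/
def bx (Q : Lamplighter F) (T : ℕ) (x : ℕ → F) (a : ℕ) : Lamplighter F :=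
  mv (dn Q x T) (T - a)

/-- The average over a box of size `T`. -/
def boxAvg (Q : Lamplighter F) (T : ℕ) (g : Lamplighter F → ℝ) : ℝ :=
  (T : ℝ)⁻¹ * ∑ a ∈ Finset.range T, EL T fun x => g (bx Q T x a)

lemma pos_bx (Q : Lamplighter F) (T : ℕ) (x : ℕ → F) (a : ℕ) : pos (bx Q T x a) = pos Q - a := by
  rw [bx, pos_mv, pos_dn]
  ring

lemma lamp_bx (Q : Lamplighter F) (T : ℕ) (x : ℕ → F) (a : ℕ) (i : ℤ) :
    lamp (bx Q T x a) i = lamp (dn Q x T) i := by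
  rw [bx, lamp_mv]

lemma EL_mul_right (T : ℕ) (c : ℕ → F) {G : (ℕ → F) → ℝ}
    (hG : ∀ x y, (∀ i < T, x i = y i) → G x = G y) : EL T (fun x => G fun i => x i * c i) = EL T G := by
  unfold EL
  refine Fintype.expect_equiv (Equiv.mulRight fun i : Fin T => c i) _ _ fun v => ?_
  refine hG _ _ fun i hi => ?_
  simp [extw, hi]

lemma bx_congr (Q : Lamplighter F) {T : ℕ} {x y : ℕ → F} (a : ℕ) (h : ∀ i < T, x i = y i) :
    bx Q T x a = bx Q T y a := by
  rw [bx, bx, dn_congr Q h]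

lemma EL_bx_mul (Q : Lamplighter F) (T : ℕ) (g : Lamplighter F → ℝ) (b : Lamplighter F) {R : ℕ}
    (hR : ∀ i : ℤ, lamp b i ≠ 1 → -R ≤ i ∧ i < R) (hR' : |pos b| ≤ R) {a : ℕ} (h1 : R ≤ a)
    (h2 : a + R ≤ T) :
    EL T (fun x => g (bx Q T x a * b)) =
      EL T (fun x => g (bx Q T x ((a : ℤ) - pos b).toNat)) := by
  rw [abs_le] at hR'
  rw [← EL_mul_right T (fun j => lamp b (a - 1 - j))
    (G := fun x => g (bx Q T x ((a : ℤ) - pos b).toNat))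
    fun x y hxy => by rw [bx_congr Q _ hxy]]
  congr 1
  funext x
  refine congrArg g (ext_pt (fun i => ?_) ?_)
  · rw [lamp_mul, lamp_bx, lamp_bx, pos_bx]
    by_cases hi : pos Q - T ≤ i ∧ i < pos Q
    · rw [lamp_dn_of_mem x hi.1 hi.2, lamp_dn_of_mem _ hi.1 hi.2]
      congr 2
      omega
    · rw [lamp_dn_of_not_mem x hi, lamp_dn_of_not_mem _ hi]
      by_contra hne
      have := hR (i - (pos Q - a)) fun h => hne (by rw [h, mul_one])
      omega
  · rw [pos_mul, pos_bx, pos_bx]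
    omega

lemma abs_sum_range_sub_le {T R : ℕ} {f : ℕ → ℝ} {C : ℝ} (hf : ∀ a, |f a| ≤ C) {s : Finset ℕ}
    (hs : s ⊆ Finset.range T) (hc : s.card + 2 * R = T) :
    |∑ a ∈ Finset.range T, f a - ∑ a ∈ s, f a| ≤ 2 * R * C := by
  rw [← Finset.sum_sdiff hs, add_sub_cancel_right]
  refine (Finset.abs_sum_le_sum_abs _ _).trans ?_
  refine (Finset.sum_le_card_nsmul _ _ C fun a _ => hf a).trans ?_
  have h : (Finset.range T \ s).card = 2 * R := by
    rw [Finset.card_sdiff_of_subset hs, Finset.card_range]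
    omega
  rw [h, nsmul_eq_mul]
  push_cast
  exact le_rfl

lemma exists_support_bound (b : Lamplighter F) :
    ∃ R : ℕ, (∀ i : ℤ, lamp b i ≠ 1 → -R ≤ i ∧ i < R) ∧ |pos b| ≤ R := by
  obtain ⟨h1, h2, h3⟩ := (le_lo (p := b) (q := 1)).1 le_rfl
  obtain ⟨h4, h5, h6⟩ := (hi_le (p := b) (q := 1)).1 le_rfl
  have g1 := neg_abs_le (lo b 1)
  have g2 := le_abs_self (hi b 1)
  have g3 := abs_nonneg (lo b 1)
  have g4 := abs_nonneg (hi b 1)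
  refine ⟨(|lo b 1| + |hi b 1|).toNat, fun i hne => ?_, ?_⟩
  · have h7 : ¬ i < lo b 1 := fun h => hne ((h3 i h).trans (lamp_one i))
    have h8 : ¬ hi b 1 ≤ i := fun h => hne ((h6 i h).trans (lamp_one i))
    omega
  · rw [abs_le]
    omega

lemma abs_boxAvg_mul_sub_le (Q : Lamplighter F) {T R : ℕ} {g : Lamplighter F → ℝ} {C : ℝ}
    (hg : ∀ p, |g p| ≤ C) (b : Lamplighter F)
    (hR : ∀ i : ℤ, lamp b i ≠ 1 → -R ≤ i ∧ i < R) (hR' : |pos b| ≤ R) (hT : 2 * R ≤ T)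
    (hT0 : 0 < T) :
    |boxAvg Q T (fun p => g (p * b)) - boxAvg Q T g| ≤ 4 * R * C / T := by
  have hb := abs_le.1 hR'
  have h1 := abs_sum_range_sub_le (T := T) (R := R) (C := C)
    (f := fun a => EL T fun x => g (bx Q T x a * b)) (fun a => abs_EL_le fun x => hg _)
    (s := Finset.Ico R (T - R)) (fun a ha => by simp at ha ⊢; omega) (by simp; omega)
  have h2 := abs_sum_range_sub_le (T := T) (R := R) (C := C)
    (f := fun a => EL T fun x => g (bx Q T x a)) (fun a => abs_EL_le fun x => hg _)
    (s := Finset.Ico (R - pos b).toNat (T - R - pos b).toNat)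
    (fun a ha => by simp at ha ⊢; omega) (by simp; omega)
  have h3 : ∑ a ∈ Finset.Ico R (T - R), EL T (fun x => g (bx Q T x a * b)) =
      ∑ a ∈ Finset.Ico (R - pos b).toNat (T - R - pos b).toNat,
        EL T fun x => g (bx Q T x a) := by
    refine Finset.sum_nbij' (fun a => (a - pos b).toNat) (fun a => (a + pos b).toNat)
      (fun a ha => ?_) (fun a ha => ?_) (fun a ha => ?_) (fun a ha => ?_) (fun a ha => ?_)
    · simp at ha ⊢; omega
    · simp at ha ⊢; omega
    · simp at ha; omega
    · simp at ha; omega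
    · simp at ha
      exact EL_bx_mul Q T g b hR hR' (by omega) (by omega)
  have hT' : (0 : ℝ) < T := by exact_mod_cast hT0
  rw [boxAvg, boxAvg, ← mul_sub, abs_mul, abs_of_pos (inv_pos.2 hT'), le_div_iff₀ hT',
    mul_comm, ← mul_assoc, mul_inv_cancel₀ hT'.ne', one_mul]
  rw [h3] at h1
  rw [abs_le] at h1 h2 ⊢
  constructor <;> linarith [h1.1, h1.2, h2.1, h2.2]

lemma tendsto_boxAvg (Q : ℕ → Lamplighter F) (T : ℕ → ℕ) (hT : ∀ k, k < T k)
    (g : Lamplighter F → ℝ) (b : Lamplighter F) (hg : Bd g) :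
    Filter.Tendsto (fun k => boxAvg (Q k) (T k) (fun p => g (p * b)) - boxAvg (Q k) (T k) g)
      Filter.atTop (nhds 0) := by
  obtain ⟨C, hC⟩ := hg
  obtain ⟨R, hR, hR'⟩ := exists_support_bound b
  have hC0 : 0 ≤ C := (abs_nonneg _).trans (hC 1)
  have hlim : Filter.Tendsto (fun k : ℕ => 4 * R * C / (k : ℝ)) Filter.atTop (nhds 0) :=
    tendsto_const_div_atTop_nhds_zero_nat _
  refine squeeze_zero_norm' ?_ hlim
  filter_upwards [Filter.eventually_ge_atTop (2 * R + 1)] with k hk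
  rw [Real.norm_eq_abs]
  refine (abs_boxAvg_mul_sub_le (Q k) hC b hR hR' (by have := hT k; omega)
    (by have := hT k; omega)).trans ?_
  have h1 : (0 : ℝ) < k := by exact_mod_cast (by omega : 0 < k)
  have h2 : (k : ℝ) ≤ T k := by exact_mod_cast (hT k).le
  gcongr

lemma exists_box_mean (Q : ℕ → Lamplighter F) (T : ℕ → ℕ) (hT : ∀ k, k < T k) :
    ∃ m : (Lamplighter F → ℝ) →ₗ[ℝ] ℝ, IsMean m ∧ m (fun _ => 1) = 1 ∧
      ∀ g, Bd g → Filter.Tendsto (fun k => boxAvg (Q k) (T k) g) (Filter.hyperfilter ℕ)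
        (nhds (m g)) := by
  refine exists_limit_mean (fun k g => boxAvg (Q k) (T k) g) (fun k g g' => ?_)
    (fun k c g => ?_) (fun k g hg => ?_) (fun k => ?_)
    fun g b hg => tendsto_boxAvg Q T hT g b hg
  · simp only [boxAvg, EL_add, Finset.sum_add_distrib, mul_add]
  · simp only [boxAvg, EL_mul, ← Finset.mul_sum]
    ring
  · exact mul_nonneg (by positivity) (Finset.sum_nonneg fun a _ => EL_nonneg fun x => hg _)
  · have : (T k : ℝ) ≠ 0 := by exact_mod_cast (by have := hT k; omega : T k ≠ 0)
    simp only [boxAvg, EL_const, Finset.sum_const, Finset.card_range, nsmul_eq_mul, mul_one]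
    exact inv_mul_cancel₀ this

end

section

variable {F F' : Type} [Group F] [Group F'] [Fintype F] [Fintype F']
variable {K : ℤ} {φ : Lamplighter F → Lamplighter F'} {ψ : Lamplighter F' → Lamplighter F}

/-- The points on top of a box. -/
def tp (Q : Lamplighter F) (T : ℕ) (u : ℕ → F) : Lamplighter F := mv (dn Q u T) T

@[simp] lemma pos_tp (Q : Lamplighter F) (T : ℕ) (u : ℕ → F) : pos (tp Q T u) = pos Q := by
  simp [tp]

lemma lamp_tp (Q : Lamplighter F) (T : ℕ) (u : ℕ → F) (i : ℤ) :
    lamp (tp Q T u) i = lamp (dn Q u T) i := by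
  rw [tp, lamp_mv]

lemma dn_tp_cat (Q : Lamplighter F) (a c : ℕ) (u u' v : ℕ → F) :
    dn (tp Q (a + c) (cat a u u')) v a = bx Q (a + c) (cat a v u') a := by
  refine ext_pt (fun i => ?_) (by rw [pos_dn, pos_tp, pos_bx])
  rw [lamp_bx]
  by_cases h1 : pos Q - a ≤ i ∧ i < pos Q
  · rw [lamp_dn_of_mem v (by rw [pos_tp]; exact h1.1) (by rw [pos_tp]; exact h1.2), pos_tp,
      lamp_dn_of_mem _ (by push_cast; omega) h1.2, cat, if_pos (by omega)]
  · rw [lamp_dn_of_not_mem v (by rwa [pos_tp]), lamp_tp]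
    by_cases h2 : pos Q - (a + c : ℕ) ≤ i ∧ i < pos Q
    · rw [lamp_dn_of_mem _ h2.1 h2.2, lamp_dn_of_mem _ h2.1 h2.2, cat, cat, if_neg (by omega),
        if_neg (by omega)]
    · rw [lamp_dn_of_not_mem _ h2, lamp_dn_of_not_mem _ h2]

lemma dn_tp (Q : Lamplighter F) (T : ℕ) (u v : ℕ → F) : dn (tp Q T u) v T = dn Q v T := by
  refine ext_pt (fun i => ?_) (by simp)
  rw [lamp_dn, lamp_dn, pos_tp, lamp_tp, lamp_dn]
  split_ifs <;> rfl

lemma EL_dn_tp (Q : Lamplighter F) {T a : ℕ} (ha : a ≤ T) (g : Lamplighter F → ℝ) :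
    EL T (fun u => EL a fun v => g (dn (tp Q T u) v a)) = EL T fun x => g (bx Q T x a) := by
  obtain ⟨c, rfl⟩ := Nat.exists_eq_add_of_le ha
  rw [EL_split, EL_split a c]
  simp only [dn_tp_cat, EL_const]
  rw [EL_comm]

lemma EL_sg_eq (q : Lamplighter F) {T a L : ℕ} (h : a + L ≤ T) :
    EL T (fun v => (sg φ q v a (a + L) : ℝ)) = EL a fun v => eh φ L (dn q v a) := by
  rw [EL_of_le h fun x y hxy => by rw [sg_congr φ q (by omega) le_rfl hxy], EL_split]
  simp only [sg_cat, eh]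

/-- The expected length of the image of an initial part of a random vertical line of a box. -/
def bl (φ : Lamplighter F → Lamplighter F') (Q : Lamplighter F) (T a : ℕ) : ℝ :=
  EL T fun u => EL T fun v => (sg φ (tp Q T u) v 0 a : ℝ)

lemma bl_add_le (Q : Lamplighter F) {T a L : ℕ} (h : a + L ≤ T) :
    bl φ Q T (a + L) ≤ bl φ Q T a + EL T fun x => eh φ L (bx Q T x a) := by
  rw [← EL_dn_tp Q (by omega : a ≤ T), bl, bl, ← EL_add]
  refine EL_mono fun u => ?_
  rw [← EL_sg_eq _ h, ← EL_add]
  refine EL_mono fun v => ?_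
  exact_mod_cast len_tri _ _ _

section
variable (h : QIPair K φ ψ)
include h

lemma QIPair.bl_le (Q : Lamplighter F) {T a : ℕ} : bl φ Q T a ≤ K * a + K := by
  rw [bl, ← EL_const (F := F) T ((K : ℝ) * a + K)]
  refine EL_mono fun u => ?_
  refine le_trans (EL_mono fun v => ?_) (EL_const (F := F) T ((K : ℝ) * a + K)).le
  have := h.sg_le (tp Q T u) v (Nat.zero_le a)
  have h2 : sg φ (tp Q T u) v 0 a ≤ K * a + K := by simpa using this
  exact_mod_cast h2

lemma QIPair.bl_le_add (Q : Lamplighter F) {T a : ℕ} (ha : a ≤ T) :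
    bl φ Q T T ≤ bl φ Q T a + (K * (T - a : ℕ) + K) := by
  have h1 := bl_add_le (φ := φ) Q (by omega : a + (T - a) ≤ T)
  rw [Nat.add_sub_cancel' ha] at h1
  refine h1.trans (add_le_add le_rfl ?_)
  rw [← EL_const (F := F) T ((K : ℝ) * (T - a : ℕ) + K)]
  exact EL_mono fun x => h.eh_le _ _

lemma QIPair.bl_le_boxAvg (Q : Lamplighter F) {T L : ℕ} (hL : L ≤ T) (hT : 0 < T) :
    L * (bl φ Q T T - 2 * (K * L + K)) ≤ T * boxAvg Q T (eh φ L) := by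
  have hK : (0 : ℝ) ≤ K := by exact_mod_cast (by linarith [h.one_le] : (0 : ℤ) ≤ K)
  have hT' : (T : ℝ) ≠ 0 := by exact_mod_cast hT.ne'
  rw [boxAvg, ← mul_assoc, mul_inv_cancel₀ hT', one_mul]
  have h1 : ∑ a ∈ Finset.range (T - L), bl φ Q T (a + L) ≤
      ∑ a ∈ Finset.range (T - L), (bl φ Q T a + EL T fun x => eh φ L (bx Q T x a)) :=
    Finset.sum_le_sum fun a ha => bl_add_le Q (by simp at ha; omega)
  rw [Finset.sum_add_distrib] at h1
  have h2 : ∑ a ∈ Finset.range (T - L), EL T (fun x => eh φ L (bx Q T x a)) ≤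
      ∑ a ∈ Finset.range T, EL T fun x => eh φ L (bx Q T x a) :=
    Finset.sum_le_sum_of_subset_of_nonneg (fun a ha => by simp at ha ⊢; omega)
      fun a _ _ => EL_nonneg fun x => h.eh_nonneg _ _
  have h3 := Finset.sum_range_add (fun a => bl φ Q T a) L (T - L)
  have h4 := Finset.sum_range_add (fun a => bl φ Q T a) (T - L) L
  rw [Nat.add_sub_cancel' hL] at h3
  rw [Nat.sub_add_cancel hL] at h4
  simp only [Nat.add_comm L] at h3
  have h5 : ∑ a ∈ Finset.range L, bl φ Q T a ≤ L * (K * L + K) := by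
    refine (Finset.sum_le_card_nsmul _ _ ((K : ℝ) * L + K) fun a ha => ?_).trans
      (by rw [Finset.card_range, nsmul_eq_mul])
    simp at ha
    refine (h.bl_le Q).trans ?_
    have : (a : ℝ) ≤ L := by exact_mod_cast ha.le
    gcongr
  have h6 : L * (bl φ Q T T - (K * L + K)) ≤ ∑ a ∈ Finset.range L, bl φ Q T (T - L + a) := by
    refine le_trans (by rw [Finset.card_range, nsmul_eq_mul])
      (Finset.card_nsmul_le_sum (Finset.range L) _ (bl φ Q T T - (K * L + K)) fun a ha => ?_)
    simp at ha
    have h7 := h.bl_le_add Q (by omega : T - L + a ≤ T)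
    have : ((T - (T - L + a) : ℕ) : ℝ) ≤ L := by exact_mod_cast (by omega)
    have h8 := mul_le_mul_of_nonneg_left this hK
    linarith
  linarith

end

/-- Images of random vertical lines of large boxes are short on average. -/
theorem QIPair.box_upper {κ : ℕ} (h : QIPair (κ : ℤ) φ ψ) (hF : 2 ≤ Fintype.card F)
    (hF' : 2 ≤ Fintype.card F') {ε : ℝ} (hε : 0 < ε) :
    ∃ T0 : ℕ, ∀ T ≥ T0, ∀ Q, bl φ Q T T ≤ (rate F F' + ε) * T := by
  by_contra hcon
  push Not at hcon
  have hc : ∀ k : ℕ, ∃ TQ : ℕ × Lamplighter F, k < TQ.1 ∧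
      (rate F F' + ε) * TQ.1 < bl φ TQ.2 TQ.1 TQ.1 := fun k => by
    obtain ⟨T, hT, Q, hQ⟩ := hcon (k + 1)
    exact ⟨(T, Q), hT, hQ⟩
  choose TQ hT hQ using hc
  obtain ⟨m, hm, hm1, hlim⟩ := exists_box_mean (fun k => (TQ k).2) (fun k => (TQ k).1) hT
  obtain ⟨L, hL, hmL⟩ := h.mean_upper hm hm1 hF hF' (by positivity : 0 < ε / 2)
  have hL' : (0 : ℝ) < L := by exact_mod_cast hL
  have h1 := hlim _ (h.bd_eh L)
  have h2 : Filter.Tendsto (fun k : ℕ => (rate F F' + ε) * L -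
      (L * (2 * ((κ : ℤ) * L + (κ : ℤ)) : ℝ)) / (k : ℝ)) (Filter.hyperfilter ℕ)
      (nhds ((rate F F' + ε) * L - 0)) :=
    tendsto_hyper (tendsto_const_nhds.sub (tendsto_const_div_atTop_nhds_zero_nat _))
  have hev : ∀ᶠ k : ℕ in (Filter.hyperfilter ℕ : Filter ℕ), (rate F F' + ε) * L -
      (L * (2 * ((κ : ℤ) * L + (κ : ℤ)) : ℝ)) / (k : ℝ) ≤
      boxAvg (TQ k).2 (TQ k).1 (eh φ L) := by
    have hat : ∀ᶠ k : ℕ in Filter.atTop, L + 1 ≤ k := Filter.eventually_ge_atTop (L + 1)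
    rw [← Nat.cofinite_eq_atTop] at hat
    filter_upwards [Filter.hyperfilter_le_cofinite hat] with k hk
    have g1 := h.bl_le_boxAvg (TQ k).2 (by have := hT k; omega : L ≤ (TQ k).1)
      (by have := hT k; omega)
    have g2 : (0 : ℝ) < k := by exact_mod_cast (by omega : 0 < k)
    have g3 : (k : ℝ) < (TQ k).1 := by exact_mod_cast hT k
    have g4 := hQ k
    have g5 : (L * (2 * ((κ : ℤ) * L + (κ : ℤ)) : ℝ)) / (((TQ k).1 : ℕ) : ℝ) ≤
        (L * (2 * ((κ : ℤ) * L + (κ : ℤ)) : ℝ)) / (k : ℝ) := by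
      have : (0 : ℝ) ≤ L * (2 * ((κ : ℤ) * L + (κ : ℤ)) : ℝ) := by
        rw [Int.cast_natCast]; positivity
      gcongr
    refine le_trans (sub_le_sub_left g5 _) ?_
    have g6 : (0 : ℝ) < (TQ k).1 := by linarith
    obtain ⟨t, ht⟩ : ∃ t : ℝ, t = (TQ k).1 := ⟨_, rfl⟩
    rw [← ht] at g1 g4 g6 ⊢
    have g7 := mul_le_mul_of_nonneg_left g4.le hL'.le
    have g8 : t * ((rate F F' + ε) * L - (L * (2 * ((κ : ℤ) * L + (κ : ℤ)) : ℝ)) / t) =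
        L * ((rate F F' + ε) * t) - L * (2 * ((κ : ℤ) * L + (κ : ℤ))) := by
      field_simp
    refine le_of_mul_le_mul_left ?_ g6
    rw [g8]
    linarith
  have h3 := le_of_tendsto_of_tendsto h2 h1 hev
  have h4 : 0 < ε / 2 * L := by positivity
  nlinarith

end

section

variable {F F' : Type} [Group F] [Group F'] [Fintype F] [Fintype F']
variable {K : ℤ} {φ : Lamplighter F → Lamplighter F'} {ψ : Lamplighter F' → Lamplighter F}

/-- The reflection reversing the height. -/
def rf (p : Lamplighter F) : Lamplighter F :=
  mkPt (fun i => lamp p (-1 - i))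
    (((lamp_finite p).image fun i => -1 - i).subset fun i hi => ⟨-1 - i, hi, by ring⟩) (-pos p)

@[simp] lemma lamp_rf (p : Lamplighter F) (i : ℤ) : lamp (rf p) i = lamp p (-1 - i) := rfl
@[simp] lemma pos_rf (p : Lamplighter F) : pos (rf p) = -pos p := rfl
@[simp] lemma rf_rf (p : Lamplighter F) : rf (rf p) = p :=
  ext_pt (fun i => by simp) (by simp)

@[simp] lemma lo_rf (p q : Lamplighter F) : lo (rf p) (rf q) = -hi p q := by
  refine le_antisymm ?_ ?_
  · have h1 := (le_lo (p := rf p) (q := rf q)).1 le_rfl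
    have : hi p q ≤ -lo (rf p) (rf q) := by
      refine hi_le.2 ⟨by have := h1.1; simp at this; omega, by have := h1.2.1; simp at this; omega,
        fun i hi => ?_⟩
      have := h1.2.2 (-1 - i) (by omega)
      simpa using this
    omega
  · have h1 := (hi_le (p := p) (q := q)).1 le_rfl
    refine le_lo.2 ⟨by simp; omega, by simp; omega, fun i hi => ?_⟩
    simpa using h1.2.2 (-1 - i) (by omega)

@[simp] lemma hi_rf (p q : Lamplighter F) : hi (rf p) (rf q) = -lo p q := by
  have := lo_rf (rf p) (rf q)
  rw [rf_rf, rf_rf] at this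
  omega

@[simp] lemma len_rf (p q : Lamplighter F) : len (rf p) (rf q) = len p q := by
  unfold len
  rw [lo_rf, hi_rf]
  ring

lemma len_rf_left (p q : Lamplighter F) : len (rf p) q = len p (rf q) := by
  rw [← len_rf p, rf_rf]

lemma QIPair.rf_comp (h : QIPair K φ ψ) : QIPair K (fun p => rf (φ p)) (fun p => ψ (rf p)) where
  one_le := h.one_le
  len_left p q := by simpa using h.len_left p q
  len_right p q := by simpa using h.len_right (rf p) (rf q)
  inv_left p := by simpa using h.inv_left p
  inv_right p := by simpa [len_rf_left] using h.inv_right (rf p)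

lemma QIPair.comp_rf (h : QIPair K φ ψ) : QIPair K (fun p => φ (rf p)) (fun p => rf (ψ p)) where
  one_le := h.one_le
  len_left p q := by simpa using h.len_left (rf p) (rf q)
  len_right p q := by simpa using h.len_right p q
  inv_left p := by simpa [len_rf_left] using h.inv_left (rf p)
  inv_right p := by simpa using h.inv_right p

@[simp] lemma sg_rf (φ : Lamplighter F → Lamplighter F') (q : Lamplighter F) (x : ℕ → F)
    (a b : ℕ) : sg (fun p => rf (φ p)) q x a b = sg φ q x a b := len_rf _ _

/-- Few points have images that are determined by their height up to a short window. -/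
lemma QIPair.Pr_sandwich_le (h : QIPair K φ ψ) (q : Lamplighter F) (a r e : ℕ) (W : ℤ)
    (f g : ℤ → F') :
    Pr a (fun x => |pos (φ (dn q x a)) - W| ≤ r ∧
      (∀ i < pos (φ (dn q x a)) - e, lamp (φ (dn q x a)) i = f i) ∧
      (∀ i, pos (φ (dn q x a)) + e ≤ i → lamp (φ (dn q x a)) i = g i)) *
      (Fintype.card F : ℝ) ^ a ≤
      (mult F K * ((2 * r + 1) * Fintype.card F' ^ (2 * e)) : ℕ) := by
  classical
  refine Pr_dn_le q a (fun p => |pos (φ p) - W| ≤ r ∧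
      (∀ i < pos (φ p) - e, lamp (φ p) i = f i) ∧
      (∀ i, pos (φ p) + e ≤ i → lamp (φ p) i = g i)) _ fun s hs => (h.card_le s).trans ?_
  refine Nat.mul_le_mul_left _ ?_
  have := card_le_of_window (I := Fin (2 * r + 1)) (fun i => W - r + i) (fun i => W - r + i - e)
    (fun i j => if j < W - r + i then f j else g j) (2 * e) (s.image φ) (fun p hp => by
      obtain ⟨p, hp', rfl⟩ := Finset.mem_image.1 hp
      obtain ⟨h1, h2, h3⟩ := (hs p hp').1
      rw [abs_le] at h1
      refine ⟨⟨(pos (φ p) - (W - r)).toNat, by omega⟩, by simp only; omega, fun j hj => ?_⟩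
      simp only at hj ⊢
      split_ifs with hj'
      · exact h2 j (by push_cast at hj; omega)
      · exact h3 j (by push_cast at hj; omega))
  rwa [Fintype.card_fin] at this

lemma QIPair.Pr_half_le {κ : ℕ} (h : QIPair (κ : ℤ) φ ψ) (hF : 2 ≤ Fintype.card F)
    (hF' : 2 ≤ Fintype.card F') {ε η : ℝ} (hε : 0 < ε) (hη : 0 < η) :
    ∃ T0 : ℕ, ∀ T ≥ T0, ∀ Q, Pr T (fun v => 1 / 2 ≤
      Pr T fun u => (rate F F' + ε) * T < sg φ (tp Q T u) v 0 T) ≤ η := by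
  have hρ := rate_pos hF hF'
  obtain ⟨T1, hT1⟩ := h.box_upper hF hF' (by positivity : 0 < ε * η / 8)
  obtain ⟨T2, hT2⟩ := h.lower_bound hF hF' (by positivity : 0 < ε * η / 8)
    (by positivity : 0 < ε * η / (4 * rate F F'))
  refine ⟨max (max T1 T2) 1, fun T hT Q => ?_⟩
  have h1 := hT1 T (by omega) Q
  have hT0 : (0 : ℝ) < T := by exact_mod_cast (by omega : 0 < T)
  set ρ := rate F F' with hρd
  set X : (ℕ → F) → (ℕ → F) → ℝ := fun u v => (sg φ (tp Q T u) v 0 T : ℝ) with hX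
  set Pm : ℝ := EL T fun u => Pr T fun v => (ρ + ε) * T < X u v with hPm
  have h2 : ∀ u, (ρ - ε * η / 8) * T - ρ * T * (ε * η / (4 * ρ)) +
      ε * T * (Pr T fun v => (ρ + ε) * T < X u v) ≤ EL T fun v => X u v := fun u => by
    have h3 := hT2 T (by omega) (tp Q T u)
    have h4 : (ρ - ε * η / 8) * T - ρ * T * (Pr T fun v => X u v ≤ (ρ - ε * η / 8) * T) +
        ε * T * (Pr T fun v => (ρ + ε) * T < X u v) ≤ EL T fun v => X u v := by
      classical
      refine le_trans (le_of_eq ?_) (EL_mono (G := fun v => (ρ - ε * η / 8) * T -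
        ρ * T * (if X u v ≤ (ρ - ε * η / 8) * T then 1 else 0) +
        ε * T * (if (ρ + ε) * T < X u v then 1 else 0)) fun v => ?_)
      · simp only [EL_add, EL_sub, EL_mul, EL_const, Pr]
      have g0 : (0 : ℝ) ≤ X u v := Int.cast_nonneg (sg_nonneg φ _ _ _ _)
      have g1 : 0 < ε * η / 8 * T := by positivity
      have g2 : 0 < ε * T := by positivity
      have g3 : 0 < ρ * T := by positivity
      split_ifs with c1 c2 c2
      · nlinarith
      · linarith
      · linarith
      · push Not at c1
        linarith
    have h5 : (Pr T fun v => X u v ≤ (ρ - ε * η / 8) * T) ≤ ε * η / (4 * ρ) := by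
      simpa only [hX, sg, dn_zero] using h3
    have h6 := mul_le_mul_of_nonneg_left h5 (by positivity : 0 ≤ ρ * T)
    linarith
  have h3 : (ρ - ε * η / 8) * T - ρ * T * (ε * η / (4 * ρ)) + ε * T * Pm ≤ bl φ Q T T := by
    rw [hPm, bl, ← EL_mul, ← EL_const (F := F) T
      ((ρ - ε * η / 8) * T - ρ * T * (ε * η / (4 * ρ))), ← EL_add]
    exact EL_mono h2
  have h4 : ρ * T * (ε * η / (4 * ρ)) = ε * T * (η / 4) := by field_simp
  have h5 : Pm ≤ η / 2 := by
    refine le_of_mul_le_mul_left ?_ (by positivity : 0 < ε * T)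
    rw [h4] at h3
    nlinarith
  have h6 : 1 / 2 * (Pr T fun v => 1 / 2 ≤ Pr T fun u => (ρ + ε) * T < X u v) ≤
      EL T fun v => Pr T fun u => (ρ + ε) * T < X u v :=
    Pr_le_EL (fun v => Pr_nonneg _ _) fun v hv => hv
  have h7 : (EL T fun v => Pr T fun u => (ρ + ε) * T < X u v) = Pm := by
    simp only [hPm, Pr]
    exact EL_comm _ _ _
  linarith

end

section

variable {F F' : Type} [Group F] [Group F'] [Fintype F] [Fintype F']
variable {K : ℤ} {φ : Lamplighter F → Lamplighter F'} {ψ : Lamplighter F' → Lamplighter F}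

lemma dn_shift (q : Lamplighter F) (x : ℕ → F) (a i : ℕ) :
    dn (dn q x a) (fun j => x (a + j)) i = dn q x (a + i) := by
  rw [dn_dn_sub q x (Nat.le_add_right a i), Nat.add_sub_cancel_left]

lemma sg_shift (φ : Lamplighter F → Lamplighter F') (q : Lamplighter F) (x : ℕ → F) (a i j : ℕ) :
    sg φ (dn q x a) (fun k => x (a + k)) i j = sg φ q x (a + i) (a + j) := by
  rw [sg, sg, dn_shift, dn_shift]

/-- The excess of the image of a vertical line along a subdivision. -/
def tot (φ : Lamplighter F → Lamplighter F') (q : Lamplighter F) (y : ℕ → F) (a s T : ℕ) : ℤ :=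
  sg φ q y 0 s + sg φ q y s (a - s) + sg φ q y (a - s) a + sg φ q y a (a + s) +
    sg φ q y (a + s) (T - s) + sg φ q y (T - s) T - sg φ q y 0 T

lemma QIPair.hulls_of_tot_le (h : QIPair K φ ψ) {q : Lamplighter F} {y : ℕ → F} {T a s u E : ℕ}
    (hs : K * (3 * u) + 3 * K < s) (ha : 3 * s ≤ a) (haT : a + 3 * s ≤ T)
    (hE : u + 2 * (K * s + K) ≤ E) (hy : tot φ q y a s T ≤ u) :
    (min (pos (φ q)) (pos (φ (dn q y a))) - E ≤ lo (φ q) (φ (dn q y a)) ∧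
      hi (φ q) (φ (dn q y a)) ≤ max (pos (φ q)) (pos (φ (dn q y a))) + E) ∧
    (min (pos (φ (dn q y a))) (pos (φ (dn q y T))) - E ≤ lo (φ (dn q y a)) (φ (dn q y T)) ∧
      hi (φ (dn q y a)) (φ (dn q y T)) ≤ max (pos (φ (dn q y a))) (pos (φ (dn q y T))) + E) ∧
    (min (pos (φ q)) (pos (φ (dn q y T))) - E ≤ lo (φ q) (φ (dn q y T)) ∧
      hi (φ q) (φ (dn q y T)) ≤ max (pos (φ q)) (pos (φ (dn q y T))) + E) ∧
    sg φ q y 0 a + sg φ q y a T ≤ sg φ q y 0 T + u := by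
  have t0 := dfct_nonneg φ q y 0 s (a - s) a
  have t1 := dfct_nonneg φ q y a (a + s) (T - s) T
  have t2 : sg φ q y 0 T ≤ sg φ q y 0 a + sg φ q y a T := len_tri _ _ _
  have t3 : sg φ q y s (T - s) ≤ sg φ q y s a + sg φ q y a (T - s) := len_tri _ _ _
  have t4 : sg φ q y s a ≤ sg φ q y s (a - s) + sg φ q y (a - s) a := len_tri _ _ _
  have t5 : sg φ q y a (T - s) ≤ sg φ q y a (a + s) + sg φ q y (a + s) (T - s) := len_tri _ _ _
  unfold tot at hy
  unfold dfct at t0 t1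
  have h1 := h.hull_of_dfct_le (q := q) (y := y) (u := u) ha hs (by unfold dfct; omega)
  have h2 := h.hull_of_dfct_le (q := dn q y a) (y := fun j => y (a + j)) (L := T - a) (u := u)
    (by omega) hs (by
      unfold dfct
      simp only [sg_shift]
      rw [add_zero, show a + (T - a - s) = T - s by omega, show a + (T - a) = T by omega]
      omega)
  rw [dn_shift, show a + (T - a) = T by omega] at h2
  have h3 := h.hull_of_dfct_le (q := q) (y := y) (L := T) (u := u) (by omega) hs
    (by unfold dfct; omega)
  refine ⟨⟨?_, ?_⟩, ⟨?_, ?_⟩, ⟨?_, ?_⟩, ?_⟩ <;> omega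

lemma QIPair.Pr_down_le (h : QIPair K φ ψ) (q : Lamplighter F) {T a s u E r : ℕ} {X Y : ℤ}
    (hs : K * (3 * u) + 3 * K < s) (ha : 3 * s ≤ a) (haT : a + 3 * s ≤ T)
    (hE : u + 2 * (K * s + K) ≤ E) (hr : K * a + K ≤ r) (hY : 0 ≤ Y) (hX : Y + r ≤ X) :
    Pr T (fun v => tot φ q v a s T ≤ u ∧ pos (φ (dn q v T)) ≤ pos (φ q) - X ∧
      Pr T (fun u' => Y < sg φ (tp q T u') v 0 T) < 1 / 2) * (Fintype.card F : ℝ) ^ a ≤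
      (mult F K * ((2 * r + 1) * Fintype.card F' ^ (2 * (2 * E + u))) : ℕ) := by
  obtain ⟨g, hg⟩ : ∃ g : ℤ → F', ∀ v, (pos (φ (dn q v T)) ≤ pos (φ q) - X ∧
      Pr T (fun u' => Y < sg φ (tp q T u') v 0 T) < 1 / 2) →
      ∀ i, pos (φ q) - r ≤ i → lamp (φ (dn q v T)) i = g i := by
    by_cases hex : ∃ v, pos (φ (dn q v T)) ≤ pos (φ q) - X ∧
      Pr T (fun u' => Y < sg φ (tp q T u') v 0 T) < 1 / 2
    · obtain ⟨v0, h1, h2⟩ := hex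
      refine ⟨lamp (φ (dn q v0 T)), fun v hv i hi' => ?_⟩
      have h3 := Pr_or T (fun u' => Y < sg φ (tp q T u') v 0 T)
        (fun u' => Y < sg φ (tp q T u') v0 0 T)
      have h4 := Pr_not T (fun u' => Y < sg φ (tp q T u') v 0 T ∨ Y < sg φ (tp q T u') v0 0 T)
      obtain ⟨u', hu'⟩ := exists_of_Pr_pos (by linarith [hv.2] :
        0 < Pr T fun u' => ¬ (Y < sg φ (tp q T u') v 0 T ∨ Y < sg φ (tp q T u') v0 0 T))
      push Not at hu'
      rw [sg, sg, dn_zero, dn_zero, dn_tp, dn_tp] at hu'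
      have h5 := hi_tri (φ (dn q v T)) (φ (tp q T u')) (φ (dn q v0 T))
      rw [hi_comm (φ (dn q v T)) (φ (tp q T u'))] at h5
      have h6 := lo_le_right (φ (tp q T u')) (φ (dn q v T))
      have h7 := lo_le_right (φ (tp q T u')) (φ (dn q v0 T))
      refine lamp_eq_of_le (p := φ (dn q v T)) (q := φ (dn q v0 T)) (i := i) ?_
      unfold len at hu'
      omega
    · exact ⟨fun _ => 1, fun v hv => absurd ⟨v, hv⟩ hex⟩
  refine le_trans (mul_le_mul_of_nonneg_right ?_ (by positivity))
    (h.Pr_sandwich_le q a r (2 * E + u) (pos (φ q)) (lamp (φ q)) g)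
  rw [← Pr_of_le (by omega : a ≤ T) fun x y hxy => by rw [dn_congr q hxy]]
  refine Pr_mono fun v hv => ?_
  obtain ⟨⟨h1, h2⟩, ⟨h3, h4⟩, ⟨h5, h6⟩, h7⟩ := h.hulls_of_tot_le hs ha haT hE hv.1
  have h8 := h.sg_le q v (Nat.zero_le a)
  rw [Nat.cast_zero, sub_zero] at h8
  have hv2 := hv.2.1
  have h9 : sg φ q v 0 a = hi (φ q) (φ (dn q v a)) - lo (φ q) (φ (dn q v a)) := by
    rw [sg, dn_zero, len]
  have h10 : sg φ q v 0 T = hi (φ q) (φ (dn q v T)) - lo (φ q) (φ (dn q v T)) := by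
    rw [sg, dn_zero, len]
  have h11 : sg φ q v a T = hi (φ (dn q v a)) (φ (dn q v T)) - lo (φ (dn q v a)) (φ (dn q v T)) :=
    rfl
  have a1 := left_le_hi (φ q) (φ (dn q v a))
  have a2 := right_le_hi (φ q) (φ (dn q v a))
  have a3 := lo_le_left (φ q) (φ (dn q v a))
  have a4 := lo_le_right (φ q) (φ (dn q v a))
  have a5 := left_le_hi (φ (dn q v a)) (φ (dn q v T))
  have a6 := lo_le_right (φ (dn q v a)) (φ (dn q v T))
  refine ⟨by rw [abs_le]; omega, fun i hi' => ?_, fun i hi' => ?_⟩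
  · exact (lamp_eq_of_lt (by push_cast at hi'; omega)).symm
  · exact (lamp_eq_of_le (by push_cast at hi'; omega)).trans (hg v hv.2 i (by omega))

end

section

variable {F F' : Type} [Group F] [Group F'] [Fintype F] [Fintype F']
variable {K : ℤ} {φ : Lamplighter F → Lamplighter F'} {ψ : Lamplighter F' → Lamplighter F}

@[simp] lemma tot_rf (φ : Lamplighter F → Lamplighter F') (q : Lamplighter F) (y : ℕ → F)
    (a s T : ℕ) : tot (fun p => rf (φ p)) q y a s T = tot φ q y a s T := by
  simp only [tot, sg_rf]

lemma QIPair.spread_le (h : QIPair K φ ψ) (q : Lamplighter F) {T a s u E r : ℕ} {Y : ℤ} {p : ℝ}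
    (hs : K * (3 * u) + 3 * K < s) (ha : 3 * s ≤ a) (haT : a + 3 * s ≤ T)
    (hE : u + 2 * (K * s + K) ≤ E) (hr : K * a + K ≤ r) (hY : 0 ≤ Y)
    (h1 : Pr T (fun v => (u : ℤ) < tot φ q v a s T) ≤ p / 8)
    (h2 : p ≤ Pr T fun v => Y + r + 2 * E < sg φ q v 0 T)
    (h3 : Pr T (fun v => 1 / 2 ≤ Pr T fun u' => Y < sg φ (tp q T u') v 0 T) ≤ p / 8) :
    3 * p / 4 * (Fintype.card F : ℝ) ^ a ≤
      2 * (mult F K * ((2 * r + 1) * Fintype.card F' ^ (2 * (2 * E + u))) : ℕ) := by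
  have d1 := h.Pr_down_le q hs ha haT hE hr hY (le_refl (Y + r))
  have d2 := h.rf_comp.Pr_down_le q hs ha haT hE hr hY (le_refl (Y + r))
  simp only [tot_rf, sg_rf, pos_rf] at d2
  have c1 := Pr_or T (fun v => (u : ℤ) < tot φ q v a s T)
    (fun v => 1 / 2 ≤ Pr T fun u' => Y < sg φ (tp q T u') v 0 T)
  have c2 := Pr_or T (fun v => tot φ q v a s T ≤ u ∧
      pos (φ (dn q v T)) ≤ pos (φ q) - (Y + r) ∧
      Pr T (fun u' => Y < sg φ (tp q T u') v 0 T) < 1 / 2)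
    (fun v => tot φ q v a s T ≤ u ∧ -pos (φ (dn q v T)) ≤ -pos (φ q) - (Y + r) ∧
      Pr T (fun u' => Y < sg φ (tp q T u') v 0 T) < 1 / 2)
  have c3 := Pr_or T (fun v => (u : ℤ) < tot φ q v a s T ∨
      1 / 2 ≤ Pr T fun u' => Y < sg φ (tp q T u') v 0 T)
    (fun v => (tot φ q v a s T ≤ u ∧ pos (φ (dn q v T)) ≤ pos (φ q) - (Y + r) ∧
      Pr T (fun u' => Y < sg φ (tp q T u') v 0 T) < 1 / 2) ∨
      (tot φ q v a s T ≤ u ∧ -pos (φ (dn q v T)) ≤ -pos (φ q) - (Y + r) ∧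
      Pr T (fun u' => Y < sg φ (tp q T u') v 0 T) < 1 / 2))
  have c4 : Pr T (fun v => Y + r + 2 * E < sg φ q v 0 T) ≤ _ :=
    (Pr_mono fun v hv => ?_).trans c3
  · have c5 : 3 * p / 4 ≤ _ + _ := le_trans (by linarith) c2
    have c6 := mul_le_mul_of_nonneg_right c5
      (by positivity : (0 : ℝ) ≤ (Fintype.card F : ℝ) ^ a)
    rw [add_mul] at c6
    linarith
  · by_cases e1 : (u : ℤ) < tot φ q v a s T
    · exact Or.inl (Or.inl e1)
    by_cases e2 : 1 / 2 ≤ Pr T fun u' => Y < sg φ (tp q T u') v 0 T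
    · exact Or.inl (Or.inr e2)
    push Not at e1 e2
    obtain ⟨-, -, ⟨h5, h6⟩, -⟩ := h.hulls_of_tot_le hs ha haT hE e1
    rw [sg, dn_zero, len] at hv
    rcases le_total (pos (φ (dn q v T))) (pos (φ q)) with e3 | e3
    · exact Or.inr (Or.inl ⟨e1, by omega, e2⟩)
    · exact Or.inr (Or.inr ⟨e1, by omega, e2⟩)

/-- The largest expected length of the image of a line of length `T`. -/
def beta (φ : Lamplighter F → Lamplighter F') (T : ℕ) : ℝ := ⨆ q, eh φ T q

section
variable (h : QIPair K φ ψ)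
include h

lemma QIPair.bddAbove_eh (T : ℕ) : BddAbove (Set.range fun q => eh φ T q) :=
  ⟨K * T + K, by rintro _ ⟨q, rfl⟩; exact h.eh_le T q⟩

lemma QIPair.eh_le_beta (T : ℕ) (q : Lamplighter F) : eh φ T q ≤ beta φ T :=
  le_ciSup (h.bddAbove_eh T) q

lemma QIPair.beta_nonneg (T : ℕ) : 0 ≤ beta φ T := (h.eh_nonneg T 1).trans (h.eh_le_beta T 1)

lemma QIPair.EL_sg_le_beta (q : Lamplighter F) {a b T : ℕ} (hab : a ≤ b) (hb : b ≤ T) :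
    EL T (fun v => (sg φ q v a b : ℝ)) ≤ beta φ (b - a) := by
  have := EL_sg_eq (φ := φ) q (T := T) (a := a) (L := b - a) (by omega)
  rw [Nat.add_sub_cancel' hab] at this
  rw [this, ← EL_const (F := F) a (beta φ (b - a))]
  exact EL_mono fun v => h.eh_le_beta _ _

lemma QIPair.subadditive_beta : Subadditive (beta φ) := fun a b => by
  refine ciSup_le fun q => ?_
  have h1 := h.EL_sg_le_beta q (Nat.zero_le a) (by omega : a ≤ a + b)
  have h2 := h.EL_sg_le_beta q (Nat.le_add_right a b) le_rfl
  rw [Nat.sub_zero] at h1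
  rw [Nat.add_sub_cancel_left] at h2
  refine le_trans ?_ (add_le_add h1 h2)
  rw [← EL_add]
  refine EL_mono fun x => ?_
  exact_mod_cast len_tri _ _ _

lemma QIPair.EL_tot_le (q : Lamplighter F) {T a s : ℕ} (ha : 2 * s ≤ a) (haT : a + 2 * s ≤ T) :
    EL T (fun v => (tot φ q v a s T : ℝ)) ≤
      beta φ s + beta φ (a - s - s) + beta φ s + beta φ s + beta φ (T - s - (a + s)) +
        beta φ s - eh φ T q := by
  have h1 := h.EL_sg_le_beta q (Nat.zero_le s) (by omega : s ≤ T)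
  have h2 := h.EL_sg_le_beta q (by omega : s ≤ a - s) (by omega : a - s ≤ T)
  have h3 := h.EL_sg_le_beta q (by omega : a - s ≤ a) (by omega : a ≤ T)
  have h4 := h.EL_sg_le_beta q (by omega : a ≤ a + s) (by omega : a + s ≤ T)
  have h5 := h.EL_sg_le_beta q (by omega : a + s ≤ T - s) (by omega : T - s ≤ T)
  have h6 := h.EL_sg_le_beta q (by omega : T - s ≤ T) le_rfl
  rw [Nat.sub_zero] at h1
  rw [show a - (a - s) = s by omega] at h3
  rw [show a + s - a = s by omega] at h4
  rw [show T - (T - s) = s by omega] at h6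
  simp only [tot, Int.cast_add, Int.cast_sub, EL_add, EL_sub]
  rw [← eh]
  linarith

end

end

section

variable {F F' : Type} [Group F] [Group F'] [Fintype F] [Fintype F']
variable {K : ℤ} {φ : Lamplighter F → Lamplighter F'} {ψ : Lamplighter F' → Lamplighter F}

lemma linear_of_exponential_le {n m C1 E a r u M C4 : ℕ} (hm : 2 ≤ m) (h : m ^ 12 ≤ n ^ C1)
    (ha : a = C1 * E) (hu : u ≤ E) (hr : 2 * r + 1 ≤ C4 * E) (hE : 0 < E) {p : ℝ} (hp : 0 < p)
    (hh : 3 * p / 4 * (n : ℝ) ^ a ≤ 2 * (M * ((2 * r + 1) * m ^ (2 * (2 * E + u))) : ℕ)) :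
    3 * p / 4 * E ≤ 2 * M * C4 := by
  have hE' : (0 : ℝ) < E := by exact_mod_cast hE
  have h1 : m ^ (6 * E) * m ^ (6 * E) ≤ n ^ a := by
    rw [ha, pow_mul n, ← pow_add, show 6 * E + 6 * E = 12 * E by ring, pow_mul m]
    exact Nat.pow_le_pow_left h E
  have h2 : m ^ (2 * (2 * E + u)) ≤ m ^ (6 * E) := Nat.pow_le_pow_right (by omega) (by omega)
  have h3 : E * E ≤ m ^ (6 * E) := by
    calc E * E ≤ 2 ^ E * 2 ^ E := Nat.mul_le_mul Nat.lt_two_pow_self.le Nat.lt_two_pow_self.le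
      _ ≤ m ^ E * m ^ E := Nat.mul_le_mul (Nat.pow_le_pow_left hm E) (Nat.pow_le_pow_left hm E)
      _ = m ^ (2 * E) := by rw [← pow_add]; congr 1; ring
      _ ≤ m ^ (6 * E) := Nat.pow_le_pow_right (by omega) (by omega)
  have h4 : M * ((2 * r + 1) * m ^ (2 * (2 * E + u))) ≤ M * ((C4 * E) * m ^ (6 * E)) := by gcongr
  have h5 : 3 * p / 4 * ((m ^ (6 * E) * m ^ (6 * E) : ℕ) : ℝ) ≤
      2 * ((M * ((C4 * E) * m ^ (6 * E)) : ℕ) : ℝ) := by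
    refine le_trans (mul_le_mul_of_nonneg_left ?_ (by positivity)) (hh.trans
      (mul_le_mul_of_nonneg_left (by exact_mod_cast h4) (by norm_num)))
    exact_mod_cast h1
  have h6 : (0 : ℝ) < ((m ^ (6 * E) : ℕ) : ℝ) := by
    have : 0 < m := by omega
    exact_mod_cast Nat.pow_pos this
  have h7 : ((E * E : ℕ) : ℝ) ≤ ((m ^ (6 * E) : ℕ) : ℝ) := by exact_mod_cast h3
  obtain ⟨X, hX⟩ : ∃ X : ℝ, X = ((m ^ (6 * E) : ℕ) : ℝ) := ⟨_, rfl⟩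
  rw [Nat.cast_mul, Nat.cast_mul, Nat.cast_mul, Nat.cast_mul, ← hX] at h5
  rw [← hX] at h6 h7
  push_cast at h7
  have h8 : 3 * p / 4 * X ≤ 2 * M * C4 * E := by
    refine le_of_mul_le_mul_right ?_ h6
    linarith
  have h9 : 3 * p / 4 * (E * E) ≤ 2 * M * C4 * E :=
    (mul_le_mul_of_nonneg_left h7 (by positivity)).trans h8
  refine le_of_mul_le_mul_right ?_ hE'
  linarith

lemma tot_nonneg (φ : Lamplighter F → Lamplighter F') (q : Lamplighter F) (y : ℕ → F)
    (a s T : ℕ) : 0 ≤ tot φ q y a s T := by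
  have t0 := dfct_nonneg φ q y 0 s (a - s) a
  have t1 := dfct_nonneg φ q y a (a + s) (T - s) T
  have t2 : sg φ q y 0 T ≤ sg φ q y 0 a + sg φ q y a T := len_tri _ _ _
  unfold dfct at t0 t1
  unfold tot
  omega

/-- The parameters used for a nearly extremal vertical line. -/
lemma exists_scales {n m κ : ℕ} (hn : 2 ≤ n) (hκ : 1 ≤ κ) {δ : ℝ} (hδ : 0 < δ) :
    ∃ C1 C2 C3 C4 : ℕ, m ^ 12 ≤ n ^ C1 ∧ ∀ u : ℕ, 1 ≤ u → ∃ s E a r T : ℕ,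
      κ * (3 * u) + 3 * κ < s ∧ 3 * s ≤ a ∧ a + 3 * s ≤ T ∧ u + 2 * (κ * s + κ) ≤ E ∧
      κ * a + κ ≤ r ∧ a = C1 * E ∧ u ≤ E ∧ 2 * r + 1 ≤ C4 * E ∧ u ≤ s ∧
      (r : ℝ) + 2 * E + 1 ≤ δ * T ∧ T ≤ C2 * C3 * u ∧ E ≤ T := by
  obtain ⟨c, hc⟩ := exists_nat_gt ((κ * (m ^ 12 + 3) + κ + 3 : ℕ) / δ)
  rw [div_lt_iff₀ hδ] at hc
  refine ⟨m ^ 12 + 3, m ^ 12 + 6 + c, 1 + 2 * (κ * (6 * κ + 1) + κ), 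
    2 * (κ * (m ^ 12 + 3) + κ) + 1, ?_, fun u hu => ?_⟩
  · calc m ^ 12 ≤ 2 ^ (m ^ 12) := Nat.lt_two_pow_self.le
      _ ≤ 2 ^ (m ^ 12 + 3) := Nat.pow_le_pow_right (by norm_num) (by omega)
      _ ≤ n ^ (m ^ 12 + 3) := Nat.pow_le_pow_left hn _
  obtain ⟨C, hC⟩ : ∃ C, C = m ^ 12 := ⟨_, rfl⟩
  rw [← hC] at hc ⊢
  obtain ⟨s, hs⟩ : ∃ s, s = κ * (3 * u) + 3 * κ + 1 := ⟨_, rfl⟩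
  obtain ⟨E, hE⟩ : ∃ E, E = u + 2 * (κ * s + κ) := ⟨_, rfl⟩
  have hsE : s ≤ E := by nlinarith
  have hE1 : 1 ≤ E := by omega
  have hus : u ≤ s := by nlinarith
  have hs2 : s ≤ (6 * κ + 1) * u := by nlinarith
  have hE2 : E ≤ (1 + 2 * (κ * (6 * κ + 1) + κ)) * u := by
    have h1 := Nat.mul_le_mul_left κ hs2
    have h2 := Nat.mul_le_mul_left κ hu
    nlinarith
  refine ⟨s, E, (C + 3) * E, κ * ((C + 3) * E) + κ, (C + 6 + c) * E, by omega, ?_, ?_, hE.ge,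
    le_rfl, rfl, by omega, ?_, hus, ?_, ?_, ?_⟩
  · nlinarith
  · nlinarith
  · nlinarith
  · have h1 : (1 : ℝ) ≤ E := by exact_mod_cast hE1
    have h2 : (κ : ℝ) ≤ κ * E := by nlinarith [(Nat.cast_nonneg κ : (0 : ℝ) ≤ κ)]
    have h3 := mul_le_mul_of_nonneg_right hc.le (by positivity : (0 : ℝ) ≤ E)
    have h4 : 0 ≤ δ * ((C : ℝ) + 6) * E := by positivity
    push_cast at h3 ⊢
    linarith
  · calc (C + 6 + c) * E ≤ (C + 6 + c) * ((1 + 2 * (κ * (6 * κ + 1) + κ)) * u) :=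
        Nat.mul_le_mul_left _ hE2
      _ = _ := by ring
  · nlinarith

end

section

variable {F F' : Type} [Group F] [Group F'] [Fintype F] [Fintype F']
variable {K : ℤ} {φ : Lamplighter F → Lamplighter F'} {ψ : Lamplighter F' → Lamplighter F}

lemma QIPair.Pr_tot_le (h : QIPair K φ ψ) {B ε : ℝ} {N0 : ℕ}
    (hB : ∀ t ≥ N0, beta φ t ≤ (B + ε) * t) {q : Lamplighter F} {T a s u : ℕ}
    (hs : N0 ≤ s) (ha : 3 * s ≤ a) (haT : a + 3 * s ≤ T) (hq : B * T - 1 ≤ eh φ T q) :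
    u * Pr T (fun v => (u : ℤ) < tot φ q v a s T) ≤ ε * T + 1 := by
  have h1 := h.EL_tot_le q (by omega : 2 * s ≤ a) (by omega : a + 2 * s ≤ T)
  have h2 := hB s hs
  have h3 := hB (a - s - s) (by omega)
  have h4 := hB (T - s - (a + s)) (by omega)
  have h5 : (u : ℝ) * Pr T (fun v => (u : ℤ) < tot φ q v a s T) ≤
      EL T fun v => (tot φ q v a s T : ℝ) :=
    Pr_le_EL (fun v => by exact_mod_cast tot_nonneg φ q v a s T) fun v hv => by
      exact_mod_cast hv.le
  have e1 : ((a - s - s : ℕ) : ℝ) = a - s - s := by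
    rw [Nat.cast_sub (by omega), Nat.cast_sub (by omega)]
  have e2 : ((T - s - (a + s) : ℕ) : ℝ) = T - s - (a + s) := by
    rw [Nat.cast_sub (by omega), Nat.cast_sub (by omega), Nat.cast_add]
  rw [e1] at h3
  rw [e2] at h4
  have e3 : (B + ε) * s + (B + ε) * (a - s - s) + (B + ε) * s + (B + ε) * s +
    (B + ε) * (T - s - (a + s)) + (B + ε) * s = (B + ε) * T := by ring
  linarith

lemma QIPair.le_Pr_sg {κ : ℕ} (h : QIPair (κ : ℤ) φ ψ) {q : Lamplighter F} {T : ℕ}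
    {x δ : ℝ} (hT : 0 < T) (hx : 0 ≤ x) (hδ : 0 < δ) (hδT : 1 ≤ δ * T)
    (hq : (x + 4 * δ) * T - 1 ≤ eh φ T q) :
    δ / (2 * κ) ≤ Pr T fun v => (x + 2 * δ) * T < sg φ q v 0 T := by
  have hκ : (1 : ℝ) ≤ κ := by exact_mod_cast h.one_le
  have hT1 : (1 : ℝ) ≤ T := by exact_mod_cast hT
  have h1 : eh φ T q ≤ (x + 2 * δ) * T + (2 * κ * T) *
      Pr T fun v => (x + 2 * δ) * T < sg φ q v 0 T :=
    EL_le_of_Pr (fun v => by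
      have h2 := (le_abs_self _).trans (h.abs_sg_le q v (Nat.zero_le T) le_rfl)
      push_cast at h2
      nlinarith) (fun v hv => not_lt.1 hv) (by positivity)
  rw [div_le_iff₀ (by positivity)]
  refine le_of_mul_le_mul_right ?_ (by linarith : (0 : ℝ) < T)
  nlinarith

theorem QIPair.beta_lim_le {κ : ℕ} (h : QIPair (κ : ℤ) φ ψ) (hF : 2 ≤ Fintype.card F)
    (hF' : 2 ≤ Fintype.card F') : h.subadditive_beta.lim ≤ rate F F' := by
  by_contra hcon
  push Not at hcon
  have hκ : 1 ≤ κ := by exact_mod_cast h.one_le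
  have hκ' : (1 : ℝ) ≤ κ := by exact_mod_cast hκ
  have hρ := rate_pos hF hF'
  have hbd : BddBelow (Set.range fun n => beta φ n / n) :=
    ⟨0, by rintro _ ⟨n, rfl⟩; exact div_nonneg (h.beta_nonneg n) (Nat.cast_nonneg n)⟩
  have hlim := h.subadditive_beta.tendsto_lim hbd
  have hle : ∀ T : ℕ, 0 < T → h.subadditive_beta.lim * T ≤ beta φ T := fun T hT => by
    have := h.subadditive_beta.lim_le_div hbd hT.ne'
    rwa [le_div_iff₀ (by exact_mod_cast hT)] at this
  obtain ⟨B, hB⟩ : ∃ B, B = h.subadditive_beta.lim := ⟨_, rfl⟩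
  rw [← hB] at hcon hlim hle
  obtain ⟨δ, hδ⟩ : ∃ δ, δ = (B - rate F F') / 4 := ⟨_, rfl⟩
  have hδ0 : 0 < δ := by rw [hδ]; linarith
  obtain ⟨C1, C2, C3, C4, hC1, hC⟩ := exists_scales (n := Fintype.card F)
    (m := Fintype.card F') hF hκ hδ0
  obtain ⟨p, hp⟩ : ∃ p, p = δ / (2 * κ) := ⟨_, rfl⟩
  have hp0 : 0 < p := by rw [hp]; positivity
  obtain ⟨ε, hε⟩ : ∃ ε : ℝ, ε = p / (16 * (C2 * C3 + 1)) := ⟨_, rfl⟩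
  have hε0 : 0 < ε := by rw [hε]; positivity
  have hε1 : ε * (C2 * C3) ≤ p / 16 := by
    rw [hε, div_mul_eq_mul_div, div_le_div_iff₀ (by positivity) (by norm_num)]
    nlinarith
  obtain ⟨N0, hN0⟩ := Filter.eventually_atTop.1
    ((tendsto_order.1 hlim).2 (B + ε) (by linarith))
  obtain ⟨T0, hT0⟩ := h.Pr_half_le hF hF' hδ0 (by positivity : 0 < p / 8)
  obtain ⟨N1, hN1⟩ := exists_nat_gt (16 / p)
  obtain ⟨N2, hN2⟩ := exists_nat_gt (2 * (mult F (κ : ℤ) : ℕ) * C4 / (3 * p / 4))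
  obtain ⟨u, hu⟩ : ∃ u, u = N0 + T0 + N1 + N2 + 1 := ⟨_, rfl⟩
  obtain ⟨s, E, a, r, T, hs, ha, haT, hE, hr, haE, huE, hrE, hus, hδT, hTu, hET⟩ :=
    hC u (by omega)
  have hT : 0 < T := by omega
  have hT' : (0 : ℝ) < T := by exact_mod_cast hT
  have hu' : (0 : ℝ) < u := by exact_mod_cast (by omega : 0 < u)
  obtain ⟨q, hq⟩ := exists_lt_of_lt_ciSup (show beta φ T - 1 < ⨆ q, eh φ T q by
    rw [beta]; linarith)
  have hq' : B * T - 1 ≤ eh φ T q := by linarith [hle T hT]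
  have hB4 : B = rate F F' + 4 * δ := by rw [hδ]; ring
  have hpos : (0 : ℝ) ≤ r + 2 * E := by positivity
  have g2 := h.le_Pr_sg hT hρ.le hδ0 (by linarith) (by rw [← hB4]; exact hq')
  have g1 := h.Pr_tot_le (B := B) (ε := ε) (N0 := N0 + 1) (fun t ht => by
    have := hN0 t (by omega)
    rw [div_lt_iff₀ (by exact_mod_cast (by omega : 0 < t))] at this
    exact this.le) (u := u) (by omega : N0 + 1 ≤ s) ha haT hq'
  have g3 := hT0 T (by omega) q
  have g4 : Pr T (fun v => (u : ℤ) < tot φ q v a s T) ≤ p / 8 := by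
    have e1 : ε * T ≤ p / 16 * u := by
      have : (T : ℝ) ≤ C2 * C3 * u := by exact_mod_cast hTu
      calc ε * T ≤ ε * (C2 * C3 * u) := mul_le_mul_of_nonneg_left this hε0.le
        _ = ε * (C2 * C3) * u := by ring
        _ ≤ _ := mul_le_mul_of_nonneg_right hε1 hu'.le
    have e2 : 1 ≤ p / 16 * u := by
      have : (N1 : ℝ) ≤ u := by exact_mod_cast (by omega : N1 ≤ u)
      have e3 := hN1.trans_le this
      rw [div_lt_iff₀ hp0] at e3
      linarith
    refine le_of_mul_le_mul_left ?_ hu'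
    linarith
  have key := h.spread_le q (Y := ⌊(rate F F' + δ) * T⌋) (p := p) (u := u) (s := s) (by exact_mod_cast hs) ha haT
    (by exact_mod_cast hE) (by exact_mod_cast hr) (Int.floor_nonneg.2 (by positivity)) g4
    (by
      rw [hp]
      refine g2.trans (Pr_mono fun v hv => ?_)
      have e1 := Int.floor_le ((rate F F' + δ) * T)
      have e2 : ((⌊(rate F F' + δ) * T⌋ + r + 2 * E : ℤ) : ℝ) < sg φ q v 0 T := by
        push_cast
        linarith
      exact_mod_cast e2)
    (by
      refine le_trans (Pr_mono fun v hv => hv.trans (Pr_mono fun u' hu' => ?_)) g3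
      exact Int.floor_lt.1 hu')
  have fin := linear_of_exponential_le hF' hC1 haE huE hrE (by omega) hp0 key
  have e1 : (N2 : ℝ) ≤ E := by exact_mod_cast (by omega : N2 ≤ E)
  have e2 := hN2.trans_le e1
  rw [div_lt_iff₀ (by positivity)] at e2
  linarith

end

section

variable {F F' : Type} [Group F] [Group F'] [Fintype F] [Fintype F']
variable {K : ℤ} {φ : Lamplighter F → Lamplighter F'} {ψ : Lamplighter F' → Lamplighter F}

/-- The segment between `φ p` and `φ q` is vertical up to error `e`, of height about `R`. -/
def Good (φ : Lamplighter F → Lamplighter F') (R e : ℤ) (p q : Lamplighter F) : Prop :=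
  min (pos (φ p)) (pos (φ q)) - e ≤ lo (φ p) (φ q) ∧
  hi (φ p) (φ q) ≤ max (pos (φ p)) (pos (φ q)) + e ∧
  R - 3 * e ≤ |pos (φ p) - pos (φ q)| ∧ |pos (φ p) - pos (φ q)| ≤ R + e

lemma Good.symm {R e : ℤ} {p q : Lamplighter F} (h : Good φ R e p q) : Good φ R e q p := by
  obtain ⟨h1, h2, h3, h4⟩ := h
  rw [abs_sub_comm] at h3 h4
  exact ⟨by rwa [min_comm, lo_comm], by rwa [max_comm, hi_comm], h3, h4⟩

lemma mul_Pr_lt_le {L : ℕ} {S : (ℕ → F) → ℝ} (hS : ∀ x, 0 ≤ S x) {d t A η : ℝ} (hd : 0 ≤ d)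
    (ht : 0 ≤ t) (hA : EL L S ≤ A) (hη : Pr L (fun x => S x ≤ d) ≤ η) :
    t * Pr L (fun x => d + t < S x) ≤ A - d * (1 - η) := by
  classical
  have h1 := Pr_not L (fun x => S x ≤ d)
  have h2 : d * Pr L (fun x => ¬ S x ≤ d) + t * Pr L (fun x => d + t < S x) ≤ EL L S := by
    rw [Pr, Pr, ← EL_mul, ← EL_mul, ← EL_add]
    refine EL_mono fun x => ?_
    have := hS x
    split_ifs <;> linarith
  have h3 : d * (1 - η) ≤ d * Pr L (fun x => ¬ S x ≤ d) :=
    mul_le_mul_of_nonneg_left (by linarith) hd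
  linarith

lemma QIPair.EL_dfct_le (h : QIPair K φ ψ) {B : ℝ} {N0 : ℕ} (hB : ∀ t ≥ N0, beta φ t ≤ B * t)
    (q : Lamplighter F) {T l : ℕ} (hl : N0 ≤ l) (hT : 3 * l ≤ T) :
    EL T (fun v => (dfct φ q v 0 l (T - l) T : ℝ)) ≤
      B * T - EL T fun v => (sg φ q v 0 T : ℝ) := by
  have h1 := h.EL_sg_le_beta q (Nat.zero_le l) (by omega : l ≤ T)
  have h2 := h.EL_sg_le_beta q (by omega : l ≤ T - l) (by omega : T - l ≤ T)
  have h3 := h.EL_sg_le_beta q (by omega : T - l ≤ T) le_rfl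
  have g1 := hB (l - 0) (by omega)
  have g2 := hB (T - l - l) (by omega)
  have g3 := hB (T - (T - l)) (by omega)
  have e1 : ((T - l - l : ℕ) : ℝ) = T - l - l := by
    rw [Nat.cast_sub (by omega), Nat.cast_sub (by omega)]
  have e3 : T - (T - l) = l := by omega
  rw [e3] at g3 h3
  rw [e1] at g2
  simp only [Nat.sub_zero] at g1 h1
  have e4 : EL T (fun v => (dfct φ q v 0 l (T - l) T : ℝ)) =
      EL T (fun v => (sg φ q v 0 l : ℝ)) + EL T (fun v => (sg φ q v l (T - l) : ℝ)) +
      EL T (fun v => (sg φ q v (T - l) T : ℝ)) - EL T fun v => (sg φ q v 0 T : ℝ) := by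
    rw [← EL_add, ← EL_add, ← EL_sub]
    simp only [dfct]
    push_cast
    rfl
  rw [e4]
  nlinarith

lemma QIPair.good_of_dfct_le (h : QIPair K φ ψ) {q : Lamplighter F} {v : ℕ → F} {T l u e : ℕ}
    {R : ℤ} (hT : 3 * l ≤ T) (hl : K * (3 * u) + 3 * K < l) (he : u + 2 * (K * l + K) ≤ e)
    (h1 : dfct φ q v 0 l (T - l) T ≤ u) (h2 : R - e ≤ sg φ q v 0 T)
    (h3 : sg φ q v 0 T ≤ R + e) : Good φ R e (dn q v T) q := by
  obtain ⟨g1, g2⟩ := h.hull_of_dfct_le hT hl h1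
  have e1 := abs_pos_le_len (φ q) (φ (dn q v T))
  have e2 : sg φ q v 0 T = hi (φ q) (φ (dn q v T)) - lo (φ q) (φ (dn q v T)) := by
    rw [sg, dn_zero, len]
  refine Good.symm ⟨by omega, by omega, ?_, ?_⟩
  · rcases le_total (pos (φ q)) (pos (φ (dn q v T))) with h' | h'
    · rw [abs_of_nonpos (by omega)]; omega
    · rw [abs_of_nonneg (by omega)]; omega
  · unfold len at e1
    omega

lemma scale_ineqs {κ u : ℕ} (hκ : 1 ≤ κ) (hu : 1 ≤ u) :
    κ * (3 * u) + 3 * κ < 7 * κ * u ∧ u + 2 * (κ * (7 * κ * u) + κ) ≤ 17 * κ ^ 2 * u ∧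
      u ≤ 7 * κ * u ∧ 3 * (7 * κ * u) ≤ 2 * (17 * κ ^ 2 * u) ∧ u ≤ 17 * κ ^ 2 * u := by
  have h1 : κ ≤ κ * u := Nat.le_mul_of_pos_right _ hu
  have h2 : u ≤ κ * u := Nat.le_mul_of_pos_left _ hκ
  have h3 : κ * u ≤ κ ^ 2 * u := Nat.mul_le_mul_right _ (by nlinarith)
  have e1 : κ * (3 * u) = 3 * (κ * u) := by ring
  have e2 : 7 * κ * u = 7 * (κ * u) := by ring
  have e3 : κ * (7 * κ * u) = 7 * (κ ^ 2 * u) := by ring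
  have e4 : 17 * κ ^ 2 * u = 17 * (κ ^ 2 * u) := by ring
  rw [e1, e3, e2, e4]
  omega

/-- Most vertical lines of a fixed large length starting at a point are good. -/
theorem QIPair.Pr_not_good_le {κ : ℕ} (h : QIPair (κ : ℤ) φ ψ) (hF : 2 ≤ Fintype.card F)
    (hF' : 2 ≤ Fintype.card F') {N : ℕ} (hN : 2 ≤ N) {η : ℝ} (hη : 0 < η) :
    ∃ u0 : ℕ, ∀ u ≥ u0, ∀ q, Pr (N * (17 * κ ^ 2 * u)) (fun v =>
      ¬ Good φ ⌊rate F F' * (N * (17 * κ ^ 2 * u) : ℕ)⌋ (17 * κ ^ 2 * u : ℕ)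
        (dn q v (N * (17 * κ ^ 2 * u))) q) ≤ η := by
  have hκ : 1 ≤ κ := by exact_mod_cast h.one_le
  have hκ' : (1 : ℝ) ≤ κ := by exact_mod_cast hκ
  have hN' : (2 : ℝ) ≤ N := by exact_mod_cast hN
  have hρ := rate_pos hF hF'
  obtain ⟨b, hb⟩ : ∃ b : ℝ, b = η / (40 * N * κ ^ 2) := ⟨_, rfl⟩
  have hb0 : 0 < b := by rw [hb]; positivity
  obtain ⟨ε, hε0, hε1, hε2, hε3⟩ : ∃ ε : ℝ, 0 < ε ∧ ε ≤ b / 4 ∧ ε ≤ rate F F' ∧ ε ≤ 1 / N :=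
    ⟨min (b / 4) (min (rate F F') (1 / N)), by positivity, min_le_left _ _,
      (min_le_right _ _).trans (min_le_left _ _), (min_le_right _ _).trans (min_le_right _ _)⟩
  obtain ⟨θ, hθ0, hθ1, hθ2⟩ : ∃ θ : ℝ, 0 < θ ∧ rate F F' * θ ≤ b / 2 ∧ θ ≤ η / 4 :=
    ⟨min (b / 2 / rate F F') (η / 4), by positivity, by
      rw [mul_comm, ← le_div_iff₀ hρ]; exact min_le_left _ _, min_le_right _ _⟩
  obtain ⟨L0, hL0⟩ := h.lower_bound hF hF' hε0 hθ0
  have hbd : BddBelow (Set.range fun n => beta φ n / n) :=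
    ⟨0, by rintro _ ⟨n, rfl⟩; exact div_nonneg (h.beta_nonneg n) (Nat.cast_nonneg n)⟩
  obtain ⟨N0, hN0⟩ := Filter.eventually_atTop.1 ((tendsto_order.1
    (h.subadditive_beta.tendsto_lim hbd)).2 (rate F F' + ε)
      (by linarith [h.beta_lim_le hF hF']))
  have hB : ∀ t ≥ N0 + 1, beta φ t ≤ (rate F F' + ε) * t := fun t ht => by
    have := hN0 t (by omega)
    rw [div_lt_iff₀ (by exact_mod_cast (by omega : 0 < t))] at this
    exact this.le
  refine ⟨L0 + N0 + 1, fun u hu q => ?_⟩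
  obtain ⟨i1, i2, i3, i4, i5⟩ := scale_ineqs hκ (by omega : 1 ≤ u)
  obtain ⟨l, hl⟩ : ∃ l, l = 7 * κ * u := ⟨_, rfl⟩
  obtain ⟨e, he⟩ : ∃ e, e = 17 * κ ^ 2 * u := ⟨_, rfl⟩
  obtain ⟨T, hT⟩ : ∃ T, T = N * e := ⟨_, rfl⟩
  rw [← hl] at i1 i2 i3 i4
  rw [← he] at i2 i4 i5
  rw [← he, ← hT]
  have hTe : 2 * e ≤ T := by rw [hT]; exact Nat.mul_le_mul_right _ hN
  have hl3 : 3 * l ≤ T := i4.trans hTe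
  have hTe' : (T : ℝ) = N * e := by rw [hT]; push_cast; rfl
  have hee : (e : ℝ) = 17 * κ ^ 2 * u := by rw [he]; push_cast; rfl
  have hu0 : (0 : ℝ) < u := by exact_mod_cast (by omega : 0 < u)
  have he0 : (0 : ℝ) < e := by exact_mod_cast (by omega : 0 < e)
  have hT0 : (0 : ℝ) < T := by exact_mod_cast (by omega : 0 < T)
  have a1 := hL0 T (by omega) q
  have a1' : Pr T (fun v => (sg φ q v 0 T : ℝ) ≤ (rate F F' - ε) * T) ≤ θ := by
    simpa only [sg, dn_zero] using a1
  have hS0 : ∀ v, (0 : ℝ) ≤ (sg φ q v 0 T : ℝ) := fun v => by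
    exact_mod_cast sg_nonneg φ q v 0 T
  have hES : EL T (fun v => (sg φ q v 0 T : ℝ)) ≤ (rate F F' + ε) * T := by
    have := (h.EL_sg_le_beta q (Nat.zero_le T) le_rfl).trans (hB _ (by omega))
    simpa using this
  have hd0 : 0 ≤ (rate F F' - ε) * T := mul_nonneg (by linarith) hT0.le
  have arith : (rate F F' + ε) * T - (rate F F' - ε) * T * (1 - θ) ≤ b * T := by
    have : (rate F F' + ε) * T - (rate F F' - ε) * T * (1 - θ) =
      (2 * ε + rate F F' * θ - ε * θ) * T := by ring
    rw [this]
    refine mul_le_mul_of_nonneg_right ?_ hT0.le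
    nlinarith
  have c1 := mul_Pr_lt_le hS0 hd0 he0.le hES a1'
  have c2 := mul_Pr_lt_le hS0 hd0 le_rfl le_rfl a1'
  rw [zero_mul] at c2
  have c3 := h.EL_dfct_le hB q (l := l) (T := T) (by omega) hl3
  have c4 : (u : ℝ) * Pr T (fun v => (u : ℤ) < dfct φ q v 0 l (T - l) T) ≤
      EL T fun v => (dfct φ q v 0 l (T - l) T : ℝ) :=
    Pr_le_EL (fun v => by exact_mod_cast dfct_nonneg φ q v _ _ _ _) fun v hv => by
      exact_mod_cast hv.le
  have d1 : Pr T (fun v => (rate F F' - ε) * T + e < (sg φ q v 0 T : ℝ)) ≤ η / 4 := by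
    refine le_of_mul_le_mul_left (c1.trans (arith.trans ?_)) he0
    rw [hTe', hb]
    have : η / (40 * N * κ ^ 2) * (N * e) = e * (η / (40 * κ ^ 2)) := by field_simp
    rw [this]
    refine mul_le_mul_of_nonneg_left ?_ he0.le
    exact div_le_div_of_nonneg_left hη.le (by norm_num) (by nlinarith)
  have d2 : Pr T (fun v => (u : ℤ) < dfct φ q v 0 l (T - l) T) ≤ η / 2 := by
    refine le_of_mul_le_mul_left ((by linarith : _ ≤ b * T).trans ?_) hu0
    rw [hTe', hb, hee]
    have : η / (40 * N * κ ^ 2) * (N * (17 * κ ^ 2 * u)) = u * (η * (17 / 40)) := by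
      field_simp
    rw [this]
    exact mul_le_mul_of_nonneg_left (by linarith) hu0.le
  have f1 : (rate F F' - ε) * T ≥ rate F F' * T - e := by
    have : ε * T ≤ e := by
      rw [hTe']
      calc ε * (N * e) ≤ 1 / N * (N * e) := mul_le_mul_of_nonneg_right hε3 (by positivity)
        _ = e := by field_simp
    linarith
  have f2 : (rate F F' - ε) * T ≤ rate F F' * T := by nlinarith
  refine le_trans (Pr_mono (Q := fun v => ((sg φ q v 0 T : ℝ) ≤ (rate F F' - ε) * T ∨
    (rate F F' - ε) * T + e < (sg φ q v 0 T : ℝ)) ∨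
    (u : ℤ) < dfct φ q v 0 l (T - l) T) fun v hv => ?_)
    ((Pr_or _ _ _).trans ((add_le_add_left (Pr_or _ _ _) _).trans ?_))
  · by_contra hcon
    push Not at hcon
    obtain ⟨⟨b1, b2⟩, b3⟩ := hcon
    refine hv (h.good_of_dfct_le hl3 ?_ ?_ b3 ?_ ?_)
    · exact_mod_cast i1
    · exact_mod_cast i2
    · have : (⌊rate F F' * T⌋ : ℝ) ≤ rate F F' * T := Int.floor_le _
      have : ((⌊rate F F' * T⌋ - e : ℤ) : ℝ) ≤ sg φ q v 0 T := by push_cast; linarith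
      exact_mod_cast this
    · rw [← sub_le_iff_le_add, Int.le_floor]
      push_cast
      linarith
  · linarith

end

section

variable {F F' : Type} [Group F] [Group F'] [Fintype F] [Fintype F']
variable {K : ℤ} {φ : Lamplighter F → Lamplighter F'} {ψ : Lamplighter F' → Lamplighter F}

/-- `p` lies vertically below `q`. -/
def Blw (p q : Lamplighter F) : Prop :=
  pos p ≤ pos q ∧ ∀ i, i < pos p ∨ pos q ≤ i → lamp p i = lamp q i

lemma blw_dn (q : Lamplighter F) (x : ℕ → F) (s : ℕ) : Blw (dn q x s) q := by
  refine ⟨by rw [pos_dn]; omega, fun i hi => lamp_dn_of_not_mem x ?_⟩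
  rw [pos_dn] at hi
  omega

lemma blw_iff {p q : Lamplighter F} : Blw p q ↔ pos p ≤ lo p q ∧ hi p q ≤ pos q := by
  rw [le_lo, hi_le]
  constructor
  · rintro ⟨h1, h2⟩
    exact ⟨⟨le_rfl, h1, fun i hi => h2 i (.inl hi)⟩, ⟨h1, le_rfl, fun i hi => h2 i (.inr hi)⟩⟩
  · rintro ⟨⟨_, h1, h2⟩, _, _, h3⟩
    exact ⟨h1, fun i hi => hi.elim (h2 i) (h3 i)⟩

lemma Blw.eq_dn {p q : Lamplighter F} (h : Blw p q) {s : ℕ} (hs : pos p = pos q - s) :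
    p = dn q (word q p) s :=
  Lamp.eq_dn (blw_iff.1 h).1 (blw_iff.1 h).2 hs

lemma Blw.rf {p q : Lamplighter F} (h : Blw p q) : Blw (rf q) (rf p) := by
  have := h.1
  refine ⟨by rw [pos_rf, pos_rf]; omega, fun i hi => ?_⟩
  rw [pos_rf, pos_rf] at hi
  rw [lamp_rf, lamp_rf, h.2 _ (by omega)]

/-- `p` and `q` have the same position and only differ on `[a, b)`. -/
def Par (a b : ℤ) (p q : Lamplighter F) : Prop :=
  pos p = pos q ∧ ∀ i, i < a ∨ b ≤ i → lamp p i = lamp q i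

lemma Par.symm {a b : ℤ} {p q : Lamplighter F} (h : Par a b p q) : Par a b q p :=
  ⟨h.1.symm, fun i hi => (h.2 i hi).symm⟩

lemma Blw.par_left {p p' q : Lamplighter F} (h : Blw p q) (h' : Blw p' q) (hp : pos p = pos p') :
    Par (pos p) (pos q) p p' :=
  ⟨hp, fun i hi => by rw [h.2 i hi, h'.2 i (by omega)]⟩

lemma Blw.par_right {p q q' : Lamplighter F} (h : Blw p q) (h' : Blw p q')
    (hp : pos q = pos q') : Par (pos p) (pos q) q q' :=
  ⟨hp, fun i hi => by rw [← h.2 i hi, h'.2 i (by omega)]⟩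

lemma Par.dn_eq {q q' : Lamplighter F} {T : ℕ} (h : Par (pos q - T) (pos q) q q')
    (v : ℕ → F) : dn q v T = dn q' v T := by
  refine ext_pt (fun i => ?_) (by rw [pos_dn, pos_dn, h.1])
  rw [lamp_dn, lamp_dn, ← h.1]
  split_ifs with hi
  · rfl
  · exact h.2 i (by omega)

/-- Both ends `q`, `q'` of lines from `p` are on the same side of `p` after applying `φ`. -/
def SameSide (φ : Lamplighter F → Lamplighter F') (p q q' : Lamplighter F) : Prop :=
  (pos (φ p) ≤ pos (φ q) ∧ pos (φ p) ≤ pos (φ q')) ∨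
    (pos (φ q) ≤ pos (φ p) ∧ pos (φ q') ≤ pos (φ p))

lemma QIPair.Pr_opposite_le (h : QIPair K φ ψ) {q q' : Lamplighter F} {T e r : ℕ} {R : ℤ}
    (hr : K * T + K ≤ r) :
    Pr T (fun v => Good φ R e (dn q v T) q ∧ Good φ R e (dn q v T) q' ∧
      pos (φ q) < pos (φ (dn q v T)) ∧ pos (φ (dn q v T)) < pos (φ q')) *
      (Fintype.card F : ℝ) ^ T ≤
      (mult F K * ((2 * r + 1) * Fintype.card F' ^ (2 * e)) : ℕ) := by
  refine le_trans (mul_le_mul_of_nonneg_right (Pr_mono fun v hv => ?_) (by positivity))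
    (h.Pr_sandwich_le q T r e (pos (φ q)) (lamp (φ q')) (lamp (φ q)))
  obtain ⟨⟨a1, a2, a3, a4⟩, ⟨b1, b2, b3, b4⟩, h1, h2⟩ := hv
  exact ⟨(h.abs_pos_sub_le q v le_rfl).trans hr, fun i hi => lamp_eq_of_lt (by omega),
    fun i hi => lamp_eq_of_le (by omega)⟩

lemma QIPair.exists_good_below (h : QIPair K φ ψ) {T e r : ℕ} {R : ℤ} (hr : K * T + K ≤ r)
    (hg : ∀ q, Pr T (fun v => ¬ Good φ R e (dn q v T) q) ≤ 1 / 8)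
    (hs : 8 * (mult F K * ((2 * r + 1) * Fintype.card F' ^ (2 * e))) ≤ Fintype.card F ^ T)
    {q q' : Lamplighter F} (hq : Par (pos q - T) (pos q) q q') :
    ∃ p, Blw p q ∧ Blw p q' ∧ pos p = pos q - T ∧ Good φ R e p q ∧ Good φ R e p q' ∧
      SameSide φ p q q' := by
  have hn : (0 : ℝ) < (Fintype.card F : ℝ) ^ T := by
    have : 0 < Fintype.card F := Fintype.card_pos
    positivity
  have hs' : 8 * ((mult F K * ((2 * r + 1) * Fintype.card F' ^ (2 * e)) : ℕ) : ℝ) ≤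
      (Fintype.card F : ℝ) ^ T := by exact_mod_cast hs
  have key : ∀ {q q' : Lamplighter F},
      Pr T (fun v => Good φ R e (dn q v T) q ∧ Good φ R e (dn q v T) q' ∧
      pos (φ q) < pos (φ (dn q v T)) ∧ pos (φ (dn q v T)) < pos (φ q')) ≤ 1 / 8 := by
    intro q q'
    refine le_of_mul_le_mul_right ((h.Pr_opposite_le hr).trans ?_) hn
    linarith
  have d1 := hq.dn_eq
  have c1 := key (q := q) (q' := q')
  have c2 := key (q := q') (q' := q)
  have c3 := hg q
  have c4 := hg q'
  simp only [← d1] at c2 c4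
  have := Pr_or T (fun v => ¬ Good φ R e (dn q v T) q) (fun v => ¬ Good φ R e (dn q v T) q')
  have t2 := Pr_or T (fun v => Good φ R e (dn q v T) q ∧ Good φ R e (dn q v T) q' ∧
      pos (φ q) < pos (φ (dn q v T)) ∧ pos (φ (dn q v T)) < pos (φ q'))
      (fun v => Good φ R e (dn q v T) q' ∧ Good φ R e (dn q v T) q ∧
      pos (φ q') < pos (φ (dn q v T)) ∧ pos (φ (dn q v T)) < pos (φ q))
  have t3 := Pr_or T (fun v => ¬ Good φ R e (dn q v T) q ∨ ¬ Good φ R e (dn q v T) q')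
    (fun v => (Good φ R e (dn q v T) q ∧ Good φ R e (dn q v T) q' ∧
      pos (φ q) < pos (φ (dn q v T)) ∧ pos (φ (dn q v T)) < pos (φ q')) ∨
      (Good φ R e (dn q v T) q' ∧ Good φ R e (dn q v T) q ∧
      pos (φ q') < pos (φ (dn q v T)) ∧ pos (φ (dn q v T)) < pos (φ q)))
  have t4 := Pr_not T (fun v => (¬ Good φ R e (dn q v T) q ∨ ¬ Good φ R e (dn q v T) q') ∨
    ((Good φ R e (dn q v T) q ∧ Good φ R e (dn q v T) q' ∧
      pos (φ q) < pos (φ (dn q v T)) ∧ pos (φ (dn q v T)) < pos (φ q')) ∨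
      (Good φ R e (dn q v T) q' ∧ Good φ R e (dn q v T) q ∧
      pos (φ q') < pos (φ (dn q v T)) ∧ pos (φ (dn q v T)) < pos (φ q))))
  obtain ⟨v, hv⟩ := exists_of_Pr_pos (lt_of_lt_of_eq (by linarith) t4.symm)
  push Not at hv
  obtain ⟨⟨g1, g2⟩, g3, g4⟩ := hv
  refine ⟨dn q v T, blw_dn _ _ _, d1 v ▸ blw_dn _ _ _, pos_dn _ _ _, g1, g2, ?_⟩
  have := g3 g1 g2
  have := g4 g2 g1
  unfold SameSide
  omega

/-- Vertical segments of length `T` are nearly mapped to vertical segments. -/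
structure Straight (φ : Lamplighter F → Lamplighter F') (T : ℕ) (R e : ℤ) : Prop where
  below : ∀ q q', Par (pos q - T) (pos q) q q' → ∃ p, Blw p q ∧ Blw p q' ∧
    pos p = pos q - T ∧ Good φ R e p q ∧ Good φ R e p q' ∧ SameSide φ p q q'
  above : ∀ p p', Par (pos p) (pos p + T) p p' → ∃ q, Blw p q ∧ Blw p' q ∧
    pos q = pos p + T ∧ Good φ R e p q ∧ Good φ R e p' q ∧ SameSide φ q p p'

lemma sq_le_two_pow {e : ℕ} (he : 4 ≤ e) : e * e ≤ 2 ^ e := by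
  induction e, he using Nat.le_induction with
  | base => norm_num
  | succ k hk ih => rw [pow_succ]; nlinarith

lemma exists_scale_le {n m M κ N : ℕ} (hn : 2 ≤ n) (hN : 2 * m ^ 2 ≤ N) :
    ∃ e0 : ℕ, ∀ e ≥ e0, 8 * (M * ((2 * (κ * (N * e) + κ) + 1) * m ^ (2 * e))) ≤ n ^ (N * e) := by
  refine ⟨8 * M * (2 * κ * N + 2 * κ + 1) + 4, fun e he => ?_⟩
  have h1 : (2 * m ^ 2) ^ e ≤ n ^ (N * e) := by
    rw [pow_mul]
    refine Nat.pow_le_pow_left (hN.trans ((Nat.lt_two_pow_self (n := N)).le.trans ?_)) e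
    exact Nat.pow_le_pow_left hn N
  refine le_trans ?_ h1
  have h2 := sq_le_two_pow (by omega : 4 ≤ e)
  rw [mul_pow, ← pow_mul]
  have h3 : 8 * (M * (2 * (κ * (N * e) + κ) + 1)) ≤ 2 ^ e := by
    refine le_trans ?_ h2
    have : 8 * (M * (2 * (κ * (N * e) + κ) + 1)) ≤ 8 * M * (2 * κ * N + 2 * κ + 1) * e := by
      have : 2 * (κ * (N * e) + κ) + 1 ≤ (2 * κ * N + 2 * κ + 1) * e := by
        have : 1 ≤ e := by omega
        nlinarith [Nat.mul_le_mul_left κ this]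
      calc _ = 8 * M * (2 * (κ * (N * e) + κ) + 1) := by ring
        _ ≤ 8 * M * ((2 * κ * N + 2 * κ + 1) * e) := Nat.mul_le_mul_left _ this
        _ = _ := by ring
    exact this.trans (Nat.mul_le_mul_right _ (by omega))
  calc _ = 8 * (M * (2 * (κ * (N * e) + κ) + 1)) * m ^ (2 * e) := by ring
    _ ≤ _ := Nat.mul_le_mul_right _ h3

lemma good_rf_iff {R e : ℤ} {p q : Lamplighter F} :
    Good (fun x => φ (rf x)) R e p q ↔ Good φ R e (rf p) (rf q) := Iff.rfl

theorem QIPair.exists_straight {κ : ℕ} (h : QIPair (κ : ℤ) φ ψ) (hF : 2 ≤ Fintype.card F)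
    (hF' : 2 ≤ Fintype.card F') : ∃ (T : ℕ) (R e : ℤ), 0 < T ∧ 2 * κ ≤ e ∧ 100 * e ≤ R ∧
      Straight φ T R e := by
  have hκ : 1 ≤ κ := by exact_mod_cast h.one_le
  have hρ := rate_pos hF hF'
  obtain ⟨N1, hN1⟩ := exists_nat_gt (101 / rate F F')
  obtain ⟨N, hN⟩ : ∃ N, N = N1 + 2 * Fintype.card F' ^ 2 + 2 := ⟨_, rfl⟩
  obtain ⟨u1, hu1⟩ := h.Pr_not_good_le hF hF' (by omega : 2 ≤ N) (by norm_num : (0 : ℝ) < 1 / 8)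
  obtain ⟨u2, hu2⟩ := h.comp_rf.Pr_not_good_le hF hF' (by omega : 2 ≤ N)
    (by norm_num : (0 : ℝ) < 1 / 8)
  obtain ⟨e0, he0⟩ := exists_scale_le (n := Fintype.card F) (m := Fintype.card F')
    (M := mult F κ) (κ := κ) (N := N) hF (by omega)
  obtain ⟨u, hu⟩ : ∃ u, u = u1 + u2 + e0 + 1 := ⟨_, rfl⟩
  have g1 := hu1 u (by omega)
  have g2 := hu2 u (by omega)
  have hue := (scale_ineqs hκ (by omega : 1 ≤ u)).2.2.2.2
  obtain ⟨e, he⟩ : ∃ e, e = 17 * κ ^ 2 * u := ⟨_, rfl⟩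
  obtain ⟨T, hT⟩ : ∃ T, T = N * e := ⟨_, rfl⟩
  obtain ⟨R, hR⟩ : ∃ R, R = ⌊rate F F' * (T : ℝ)⌋ := ⟨_, rfl⟩
  rw [← he] at hue
  rw [← he, ← hT, ← hR] at g1 g2
  have hs := he0 e (by omega)
  rw [← hT] at hs
  have hNe : (101 : ℝ) ≤ rate F F' * N := by
    rw [div_lt_iff₀ hρ] at hN1
    have : (N1 : ℝ) ≤ N := by exact_mod_cast (by omega : N1 ≤ N)
    nlinarith
  have hTe : (T : ℝ) = N * e := by rw [hT]; push_cast; rfl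
  have hR1 : 100 * (e : ℤ) ≤ R := by
    rw [hR, Int.le_floor, hTe]
    push_cast
    have : (0 : ℝ) ≤ e := by positivity
    nlinarith
  have down : ∀ {χ : Lamplighter F → Lamplighter F'} {χ' : Lamplighter F' → Lamplighter F},
      QIPair (κ : ℤ) χ χ' → (∀ q, Pr T (fun v => ¬ Good χ R e (dn q v T) q) ≤ 1 / 8) →
      ∀ q q', Par (pos q - T) (pos q) q q' → ∃ p, Blw p q ∧ Blw p q' ∧
        pos p = pos q - T ∧ Good χ R e p q ∧ Good χ R e p q' ∧ SameSide χ p q q' := by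
    intro χ χ' hχ hg q q' hq
    exact hχ.exists_good_below (by push_cast; exact le_rfl) hg hs hq
  refine ⟨T, R, e, ?_, ?_, hR1, ⟨down h g1, fun p p' hp => ?_⟩⟩
  · rw [hT]; exact Nat.mul_pos (by omega) (by omega)
  · have : 2 * κ ≤ e := by
      rw [he]
      have h1 : κ ≤ κ ^ 2 := by nlinarith
      have h2 : κ ^ 2 ≤ κ ^ 2 * u := Nat.le_mul_of_pos_right _ (by omega)
      rw [mul_assoc]
      omega
    exact_mod_cast this
  · obtain ⟨q, b1, b2, b3, b4, b5, b6⟩ := down h.comp_rf g2 (rf p) (rf p')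
      ⟨by rw [pos_rf, pos_rf, hp.1], fun i hi => by
        rw [pos_rf] at hi
        rw [lamp_rf, lamp_rf, hp.2 _ (by omega)]⟩
    refine ⟨rf q, ?_, ?_, ?_, Good.symm ?_, Good.symm ?_, ?_⟩
    · simpa using b1.rf
    · simpa using b2.rf
    · rw [pos_rf, b3, pos_rf]; omega
    · simpa [good_rf_iff] using b4
    · simpa [good_rf_iff] using b5
    · simpa [SameSide] using b6

end

section

variable {F F' : Type} [Group F] [Group F'] [Fintype F] [Fintype F']
variable {K : ℤ} {φ : Lamplighter F → Lamplighter F'} {ψ : Lamplighter F' → Lamplighter F}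

lemma Blw.len_eq {p q : Lamplighter F} (h : Blw p q) : len p q = pos q - pos p := by
  obtain ⟨h1, h2⟩ := blw_iff.1 h
  have := lo_le_left p q
  have := right_le_hi p q
  unfold len
  omega

lemma blw_mv {p q : Lamplighter F} {a b : ℤ} (h1 : pos p + a ≤ lo p q) (h2 : hi p q ≤ pos q + b) :
    Blw (mv p a) (mv q b) := by
  have := lo_le_hi p q
  refine ⟨by rw [pos_mv, pos_mv]; omega, fun i hi => ?_⟩
  rw [pos_mv, pos_mv] at hi
  rw [lamp_mv, lamp_mv]
  exact hi.elim (fun h => lamp_eq_of_lt (by omega)) fun h => lamp_eq_of_le (by omega)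

lemma blw_mv_self (q : Lamplighter F) {k : ℤ} (hk : 0 ≤ k) : Blw (mv q (-k)) q :=
  ⟨by rw [pos_mv]; omega, fun i _ => by rw [lamp_mv]⟩

lemma Blw.exists_between {p q : Lamplighter F} (h : Blw p q) {c : ℤ} (h1 : pos p ≤ c)
    (h2 : c ≤ pos q) : ∃ r, Blw p r ∧ Blw r q ∧ pos r = c := by
  obtain ⟨s, hs⟩ : ∃ s : ℕ, (s : ℤ) = pos q - c := ⟨(pos q - c).toNat, by omega⟩
  obtain ⟨t, ht⟩ : ∃ t : ℕ, (t : ℤ) = c - pos p := ⟨(c - pos p).toNat, by omega⟩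
  obtain ⟨w, e1⟩ : ∃ w, p = dn q w (s + t) := ⟨_, h.eq_dn (by push_cast; omega)⟩
  refine ⟨dn q w s, ?_, blw_dn _ _ _, by rw [pos_dn]; omega⟩
  rw [e1, dn_dn_sub q w (Nat.le_add_right s t)]
  exact blw_dn _ _ _

section Straight

variable {T : ℕ} {R e : ℤ}

lemma Straight.abs_top_le (hS : Straight φ T R e)
    {q q' : Lamplighter F} (h : Par (pos q - T) (pos q) q q') :
    pos (φ q) - pos (φ q') ≤ 4 * e := by
  obtain ⟨p, -, -, -, ⟨-, -, a1, a2⟩, ⟨-, -, b1, b2⟩, hs⟩ := hS.below q q' h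
  rw [le_abs] at a1 b1
  rw [abs_le] at a2 b2
  unfold SameSide at hs
  omega

lemma Straight.abs_bot_le (hS : Straight φ T R e)
    {p p' : Lamplighter F} (h : Par (pos p) (pos p + T) p p') :
    pos (φ p) - pos (φ p') ≤ 4 * e := by
  obtain ⟨q, -, -, -, ⟨-, -, a1, a2⟩, ⟨-, -, b1, b2⟩, hs⟩ := hS.above p p' h
  rw [le_abs] at a1 b1
  rw [abs_le] at a2 b2
  unfold SameSide at hs
  omega

lemma Straight.gap (hS : Straight φ T R e) (he : 100 * e ≤ R)
    {p q : Lamplighter F} (h : Blw p q) (hpq : pos p = pos q - T) :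
    min (pos (φ p)) (pos (φ q)) - 5 * e ≤ lo (φ p) (φ q) ∧
    hi (φ p) (φ q) ≤ max (pos (φ p)) (pos (φ q)) + 5 * e ∧
    R - 7 * e ≤ |pos (φ p) - pos (φ q)| := by
  obtain ⟨q', -, h1, h2, h3, -, -⟩ := hS.above p p ⟨rfl, fun _ _ => rfl⟩
  have hq : Par (pos p) (pos q) q q' := h.par_right h1 (by omega)
  rw [hpq] at hq
  obtain ⟨p', g1, g2, g3, g4, g5, g6⟩ := hS.below q q' hq
  have hp : Par (pos p) (pos q) p p' := h.par_left g1 (by omega)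
  have hp' : Par (pos p) (pos p + T) p p' := by convert hp using 1; omega
  have hp'' : Par (pos p') (pos p' + T) p' p := by
    convert hp.symm using 1
    · exact hp.1.symm
    · have := hp.1; omega
  have hq' : Par (pos q' - T) (pos q') q' q := by
    convert hq.symm using 1
    · rw [hq.1]
    · exact hq.1.symm
  have t1 := hS.abs_top_le hq
  have t2 := hS.abs_top_le hq'
  have t3 := hS.abs_bot_le hp'
  have t4 := hS.abs_bot_le hp''
  obtain ⟨a1, a2, a3, a4⟩ := h3
  obtain ⟨b1, b2, b3, b4⟩ := g4
  obtain ⟨c1, c2, c3, c4⟩ := g5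
  have l1 := lo_tri (φ p) (φ q') (φ q)
  have l2 := lo_tri (φ q') (φ p') (φ q)
  have l3 := hi_tri (φ p) (φ q') (φ q)
  have l4 := hi_tri (φ q') (φ p') (φ q)
  have s1 := lo_comm (φ p') (φ q')
  have s2 := hi_comm (φ p') (φ q')
  unfold SameSide at g6
  rw [le_abs] at a3 b3 c3 ⊢
  rw [abs_le] at a4 b4 c4
  omega

lemma Straight.lt_mv_iff (hS : Straight φ T R e) (he : 100 * e ≤ R) (he0 : 2 * K ≤ e)
    (h : QIPair K φ ψ) (q : Lamplighter F) (k : ℤ) :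
    pos (φ (mv (mv q k) (-T))) < pos (φ (mv q k)) ↔ pos (φ (mv q (-T))) < pos (φ q) := by
  have hK := h.one_le
  have step : ∀ q : Lamplighter F, pos (φ (mv (mv q 1) (-T))) < pos (φ (mv q 1)) ↔
      pos (φ (mv q (-T))) < pos (φ q) := by
    intro q
    have g1 := (hS.gap he (blw_mv_self q (Nat.cast_nonneg T))
      (by rw [pos_mv]; omega)).2.2
    have g2 := (hS.gap he (blw_mv_self (mv q 1) (Nat.cast_nonneg T))
      (by rw [pos_mv _ (-(T : ℤ))]; omega)).2.2
    have c1 := (abs_pos_le_len _ _).trans (h.len_left q (mv q 1))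
    have c2 := (abs_pos_le_len _ _).trans (h.len_left (mv q (-T)) (mv (mv q 1) (-T)))
    have d1 := len_mv q 1
    have d2 := len_mv (mv q (-T)) 1
    rw [mv_mv, add_comm, ← mv_mv] at d2
    rw [abs_one] at d1 d2
    have d3 := mul_le_mul_of_nonneg_left d1 (by omega : 0 ≤ K)
    have d4 := mul_le_mul_of_nonneg_left d2 (by omega : 0 ≤ K)
    have c1' := abs_le.1 (c1.trans (add_le_add_left d3 K))
    have c2' := abs_le.1 (c2.trans (add_le_add_left d4 K))
    rw [le_abs] at g1 g2
    omega
  induction k using Int.induction_on with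
  | zero => rw [mv_zero]
  | succ i ih =>
    refine Iff.trans ?_ ih
    rw [← step (mv q i), mv_mv q i 1]
  | pred i ih =>
    refine Iff.trans ?_ ih
    have := step (mv q (-i - 1))
    rw [mv_mv q _ 1, sub_add_cancel] at this
    exact this.symm

lemma Straight.lt_iff_of_blw (hS : Straight φ T R e) (he : 100 * e ≤ R)
    {p q : Lamplighter F} (h : Blw p q) (hpq : pos p = pos q - T) :
    pos (φ p) < pos (φ q) ↔ pos (φ (mv q (-T))) < pos (φ q) := by
  have h' := blw_mv_self q (Nat.cast_nonneg T)
  have g1 := (hS.gap he h hpq).2.2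
  have g2 := (hS.gap he h' (by rw [pos_mv]; omega)).2.2
  have g3 := hS.abs_bot_le (p := p) (p' := mv q (-T))
    (by convert h.par_left h' (by rw [pos_mv]; omega) using 1; omega)
  have g4 := hS.abs_bot_le (p := mv q (-T)) (p' := p)
    (by convert h'.par_left h (by rw [pos_mv]; omega) using 1; rw [pos_mv]; omega)
  rw [le_abs] at g1 g2
  omega

lemma Straight.lt_iff_below (hS : Straight φ T R e) (he : 100 * e ≤ R) (he0 : 2 * K ≤ e)
    (h : QIPair K φ ψ) (k : ℕ) {p q : Lamplighter F} (hb : Blw p q)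
    (hpq : pos p = pos q - k * T) :
    pos (φ (mv p (-T))) < pos (φ p) ↔ pos (φ (mv q (-T))) < pos (φ q) := by
  have hK := h.one_le
  induction k generalizing q with
  | zero =>
    have : p = q := by
      refine ext_pt (fun i => hb.2 i ?_) (by simpa using hpq)
      simp only [Nat.cast_zero, zero_mul] at hpq
      omega
    rw [this]
  | succ k ih =>
    push_cast at hpq
    have hkT : (0 : ℤ) ≤ k * T := by positivity
    have e1 : ((k : ℤ) + 1) * T = k * T + T := by ring
    rw [e1] at hpq
    obtain ⟨r, h1, h2, h3⟩ := hb.exists_between (c := pos q - T) (by omega) (by omega)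
    refine (ih h1 (by omega)).trans ?_
    have b1 : Blw r (mv r T) := by
      have := blw_mv_self (mv r T) (Nat.cast_nonneg T)
      rwa [mv_mv, add_neg_cancel, mv_zero] at this
    have g1 := hS.lt_iff_of_blw he h2 h3
    have g2 := hS.lt_mv_iff he he0 h r T
    rw [mv_mv, add_neg_cancel, mv_zero] at g2
    have hp := b1.par_right h2 (by rw [pos_mv]; omega)
    have g3 := hS.abs_top_le (q := mv r T) (q' := q)
      (by convert hp using 1; rw [pos_mv]; omega)
    have g4 := hS.abs_top_le (q := q) (q' := mv r T)
      (by convert hp.symm using 1; omega; rw [pos_mv]; omega)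
    have g5 := (hS.gap he h2 h3).2.2
    have g6 := (hS.gap he b1 (by rw [pos_mv]; omega)).2.2
    rw [← g2, ← g1]
    rw [le_abs] at g5 g6
    omega

lemma Straight.lt_iff (hS : Straight φ T R e) (hT : 0 < T) (he : 100 * e ≤ R)
    (he0 : 2 * K ≤ e) (h : QIPair K φ ψ) (q q' : Lamplighter F) :
    pos (φ (mv q (-T))) < pos (φ q) ↔ pos (φ (mv q' (-T))) < pos (φ q') := by
  obtain ⟨P, hP⟩ : ∃ P, P = hi q q' := ⟨_, rfl⟩
  rw [← hS.lt_mv_iff he he0 h q (P - pos q), ← hS.lt_mv_iff he he0 h q' (P - pos q')]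
  obtain ⟨k, hk⟩ : ∃ k : ℕ, (k : ℤ) = P - lo q q' :=
    ⟨(P - lo q q').toNat, by have := lo_le_hi q q'; omega⟩
  have hkT : (k : ℤ) ≤ k * T := by
    exact_mod_cast Nat.le_mul_of_pos_right k hT
  have b1 : ∀ i, i < P - k * T ∨ P ≤ i → lamp q i = lamp q' i := fun i hi =>
    hi.elim (fun h => lamp_eq_of_lt (by omega)) fun h => lamp_eq_of_le (by omega)
  have h1 := blw_mv_self (mv q (P - pos q)) (k := k * T) (by positivity)
  have h2 : Blw (mv (mv q (P - pos q)) (-(k * T))) (mv q' (P - pos q')) := by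
    have : (0 : ℤ) ≤ k * T := by positivity
    refine ⟨by simp only [pos_mv]; omega, fun i hi => ?_⟩
    simp only [pos_mv] at hi
    simp only [lamp_mv]
    exact b1 i (by omega)
  rw [← hS.lt_iff_below he he0 h k h1 (by rw [pos_mv]; ring),
    ← hS.lt_iff_below he he0 h k h2 (by simp only [pos_mv]; ring)]

/-- `φ` maps vertical lines going up to almost vertical lines going up. -/
structure Vert (φ : Lamplighter F → Lamplighter F') (c D : ℤ) : Prop where
  c_pos : 0 < c
  le_D : 0 ≤ D
  lo_ge : ∀ {p q}, Blw p q → pos (φ p) - D ≤ lo (φ p) (φ q)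
  hi_le : ∀ {p q}, Blw p q → hi (φ p) (φ q) ≤ pos (φ q) + D
  growth : ∀ {p q}, Blw p q → pos q - pos p ≤ c * (pos (φ q) - pos (φ p)) + D

lemma Straight.steps (hS : Straight φ T R e) (he : 100 * e ≤ R) (he0 : 0 < e)
    (hup : ∀ p q, Blw p q → pos p = pos q - T → pos (φ p) < pos (φ q)) (k : ℕ)
    {p q : Lamplighter F} (hb : Blw p q) (hpq : pos p = pos q - k * T) :
    pos (φ p) - 5 * e ≤ lo (φ p) (φ q) ∧ hi (φ p) (φ q) ≤ pos (φ q) + 5 * e ∧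
      k ≤ pos (φ q) - pos (φ p) := by
  induction k generalizing q with
  | zero =>
    have : p = q := by
      refine ext_pt (fun i => hb.2 i ?_) (by simpa using hpq)
      simp only [Nat.cast_zero, zero_mul] at hpq
      omega
    rw [this, lo_self, hi_self]
    push_cast
    omega
  | succ k ih =>
    push_cast at hpq
    have hkT : (0 : ℤ) ≤ k * T := by positivity
    have e1 : ((k : ℤ) + 1) * T = k * T + T := by ring
    rw [e1] at hpq
    obtain ⟨r, h1, h2, h3⟩ := hb.exists_between (c := pos q - T) (by omega) (by omega)
    obtain ⟨a1, a2, a3⟩ := ih h1 (by omega)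
    obtain ⟨b1, b2, b3⟩ := hS.gap he h2 h3
    have b4 := hup r q h2 h3
    have l1 := lo_tri (φ p) (φ r) (φ q)
    have l2 := hi_tri (φ p) (φ r) (φ q)
    push_cast
    omega

lemma Straight.vert (hS : Straight φ T R e) (hT : 0 < T) (he : 100 * e ≤ R) (he0 : 0 < e)
    (h : QIPair K φ ψ)
    (hup : ∀ p q, Blw p q → pos p = pos q - T → pos (φ p) < pos (φ q)) :
    ∃ D, Vert φ T D := by
  have hK := h.one_le
  obtain ⟨A, hA⟩ : ∃ A, A = K * T + K := ⟨_, rfl⟩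
  have hA0 : 0 ≤ A := by rw [hA]; positivity
  have hTA : 0 ≤ T * A := by positivity
  have key : ∀ {p q}, Blw p q → pos (φ p) - (A + 5 * e) ≤ lo (φ p) (φ q) ∧
      hi (φ p) (φ q) ≤ pos (φ q) + (A + 5 * e) ∧
      pos q - pos p ≤ T * (pos (φ q) - pos (φ p)) + (T * A + T) := by
    intro p q hb
    have hpq := hb.1
    obtain ⟨k, s, hs, hks⟩ : ∃ k s : ℕ, s < T ∧ pos q - pos p = k * T + s := by
      refine ⟨(pos q - pos p).toNat / T, (pos q - pos p).toNat % T, Nat.mod_lt _ hT, ?_⟩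
      have := Nat.div_add_mod' (pos q - pos p).toNat T
      have h2 : ((pos q - pos p).toNat : ℤ) = pos q - pos p := Int.toNat_of_nonneg (by omega)
      rw [← h2]
      exact_mod_cast this.symm
    have hkT : (0 : ℤ) ≤ k * T := by positivity
    obtain ⟨r, h1, h2, h3⟩ := hb.exists_between (c := pos p + s) (by omega) (by omega)
    obtain ⟨a1, a2, a3⟩ := hS.steps he he0 hup k h2 (by omega)
    have b1 := h.len_left p r
    rw [h1.len_eq] at b1
    have b2 : K * (pos r - pos p) ≤ K * T := mul_le_mul_of_nonneg_left (by omega) (by omega)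
    have l1 := lo_tri (φ p) (φ r) (φ q)
    have l2 := hi_tri (φ p) (φ r) (φ q)
    have l3 := lo_le_left (φ p) (φ r)
    have l4 := lo_le_right (φ p) (φ r)
    have l5 := left_le_hi (φ p) (φ r)
    have l6 := right_le_hi (φ p) (φ r)
    unfold len at b1
    refine ⟨by omega, by omega, ?_⟩
    have c1 : (T : ℤ) * k ≤ T * (pos (φ q) - pos (φ p) + A) :=
      mul_le_mul_of_nonneg_left (by omega) (by positivity)
    have c2 : (T : ℤ) * (pos (φ q) - pos (φ p) + A) = T * (pos (φ q) - pos (φ p)) + T * A := by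
      ring
    have c3 : (T : ℤ) * k = k * T := mul_comm _ _
    omega
  refine ⟨A + 5 * e + (T * A + T), ⟨by exact_mod_cast hT, by omega, fun hb => ?_, fun hb => ?_,
    fun hb => ?_⟩⟩
  · have := key hb; omega
  · have := key hb; omega
  · have := key hb; omega

lemma Good.rf_comp {p q : Lamplighter F} (h : Good φ R e p q) :
    Good (fun p => rf (φ p)) R e p q := by
  obtain ⟨h1, h2, h3, h4⟩ := h
  have e1 : -pos (φ p) - -pos (φ q) = -(pos (φ p) - pos (φ q)) := by ring
  simp only [Good, pos_rf, lo_rf, hi_rf, e1, abs_neg]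
  omega

lemma SameSide.rf_comp {p q q' : Lamplighter F} (h : SameSide φ p q q') :
    SameSide (fun p => rf (φ p)) p q q' := by
  simp only [SameSide, pos_rf] at *
  omega

lemma Straight.rf_comp (hS : Straight φ T R e) : Straight (fun p => rf (φ p)) T R e where
  below q q' h := by
    obtain ⟨p, h1, h2, h3, h4, h5, h6⟩ := hS.below q q' h
    exact ⟨p, h1, h2, h3, h4.rf_comp, h5.rf_comp, h6.rf_comp⟩
  above q q' h := by
    obtain ⟨p, h1, h2, h3, h4, h5, h6⟩ := hS.above q q' h
    exact ⟨p, h1, h2, h3, h4.rf_comp, h5.rf_comp, h6.rf_comp⟩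

end Straight

theorem QIPair.exists_vert {κ : ℕ} (h : QIPair (κ : ℤ) φ ψ) (hF : 2 ≤ Fintype.card F)
    (hF' : 2 ≤ Fintype.card F') :
    ∃ c D, Vert φ c D ∨ Vert (fun p => rf (φ p)) c D := by
  obtain ⟨T, R, e, hT, he, hR, hS⟩ := h.exists_straight hF hF'
  have hκ := h.one_le
  by_cases h0 : pos (φ (mv 1 (-T))) < pos (φ 1)
  · obtain ⟨D, hD⟩ := hS.vert hT hR (by omega) h fun p q hb hpq =>
      (hS.lt_iff_of_blw hR hb hpq).2 ((hS.lt_iff hT hR he h 1 q).1 h0)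
    exact ⟨_, D, .inl hD⟩
  · obtain ⟨D, hD⟩ := hS.rf_comp.vert hT hR (by omega) h.rf_comp fun p q hb hpq => by
      have g1 := (hS.gap hR hb hpq).2.2
      have g2 := mt (hS.lt_iff_of_blw hR hb hpq).1
        (mt (hS.lt_iff hT hR he h 1 q).2 h0)
      rw [le_abs] at g1
      simp only [pos_rf]
      omega
    exact ⟨_, D, .inr hD⟩

lemma QIPair.not_vert_rf (h : QIPair K φ ψ) {c D c' D' : ℤ} (hφ : Vert φ c D)
    (hψ : Vert (fun p => rf (ψ p)) c' D') : False := by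
  obtain ⟨M, hM⟩ : ∃ M, M = 2 * (K * D + 2 * K) := ⟨_, rfl⟩
  have hK := h.one_le
  have hD := hφ.le_D
  have hD' := hψ.le_D
  have hM0 : 0 ≤ M := by rw [hM]; positivity
  obtain ⟨L, hL⟩ : ∃ L, L = M + c * D' + D + 1 := ⟨_, rfl⟩
  have hcD : 0 ≤ c * D' := mul_nonneg hφ.c_pos.le hD'
  have hb := blw_mv_self (1 : Lamplighter F) (k := L) (by omega)
  have a1 := hφ.lo_ge hb
  have a2 := hφ.hi_le hb
  have a3 := hφ.growth hb
  obtain ⟨p, hp⟩ : ∃ p, p = mv (1 : Lamplighter F) (-L) := ⟨_, rfl⟩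
  have hp1 : pos p = -L := by rw [hp, pos_mv, pos_one]; ring
  rw [← hp] at hb a1 a2 a3
  rw [hp1, pos_one] at a3
  have hb' := blw_mv (p := φ p) (q := φ 1) (a := -D) (b := D) (by omega) a2
  have b3 := hψ.growth hb'
  simp only [pos_mv, pos_rf] at b3
  have near : ∀ (x : Lamplighter F) (k : ℤ), |k| ≤ D →
      |pos (ψ (mv (φ x) k)) - pos x| ≤ K * D + 2 * K := by
    intro x k hk
    have c1 := (abs_pos_le_len _ _).trans (h.len_right (mv (φ x) k) (φ x))
    have c2 := (abs_pos_le_len _ _).trans (h.inv_left x)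
    have c3 := len_mv (φ x) k
    rw [len_comm] at c3
    have c4 := mul_le_mul_of_nonneg_left (c3.trans hk) (by omega : 0 ≤ K)
    rw [abs_le] at *
    omega
  have n1 := abs_le.1 (near p (-D) (by rw [abs_neg, abs_of_nonneg hD]))
  have n2 := abs_le.1 (near 1 D (by rw [abs_of_nonneg hD]))
  rw [pos_one] at n2
  have e1 : c' * (-pos (ψ (mv (φ 1) D)) - -pos (ψ (mv (φ p) (-D)))) ≤ 0 :=
    mul_nonpos_of_nonneg_of_nonpos hψ.c_pos.le (by omega)
  have e2 : c * (pos (φ 1) - pos (φ p)) ≤ c * D' :=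
    mul_le_mul_of_nonneg_left (by omega) hφ.c_pos.le
  omega

/-- After possibly reflecting, a quasi-isometry and its inverse both preserve verticality. -/
theorem QIPair.exists_vert_pair {κ : ℕ} (h : QIPair (κ : ℤ) φ ψ) (hF : 2 ≤ Fintype.card F)
    (hF' : 2 ≤ Fintype.card F') :
    ∃ (φ' : Lamplighter F → Lamplighter F') (ψ' : Lamplighter F' → Lamplighter F),
      QIPair (κ : ℤ) φ' ψ' ∧ (∃ c D, Vert φ' c D) ∧ ∃ c D, Vert ψ' c D := by
  have key : ∀ {φ : Lamplighter F → Lamplighter F'} {ψ : Lamplighter F' → Lamplighter F},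
      QIPair (κ : ℤ) φ ψ → ∀ {c D}, Vert φ c D → ∃ c D, Vert ψ c D := by
    intro φ ψ h c D hφ
    obtain ⟨c', D', hψ | hψ⟩ := h.symm.exists_vert hF' hF
    · exact ⟨c', D', hψ⟩
    · exact (h.not_vert_rf hφ hψ).elim
  obtain ⟨c, D, hφ | hφ⟩ := h.exists_vert hF hF'
  · exact ⟨φ, ψ, h, ⟨c, D, hφ⟩, key h hφ⟩
  · exact ⟨_, _, h.rf_comp, ⟨c, D, hφ⟩, key h.rf_comp hφ⟩

end

section

variable {F F' : Type} [Group F] [Group F'] [Fintype F] [Fintype F']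
variable {K : ℤ} {φ : Lamplighter F → Lamplighter F'} {ψ : Lamplighter F' → Lamplighter F}

lemma Vert.conj {c D : ℤ} (h : Vert φ c D) : Vert (fun p => rf (φ (rf p))) c D where
  c_pos := h.c_pos
  le_D := h.le_D
  lo_ge hb := by
    have := h.hi_le hb.rf
    rw [lo_rf, pos_rf, hi_comm]
    omega
  hi_le hb := by
    have := h.lo_ge hb.rf
    rw [hi_rf, pos_rf, lo_comm]
    omega
  growth hb := by
    have := h.growth hb.rf
    rw [pos_rf, pos_rf] at this
    simp only [pos_rf]
    rw [neg_sub_neg] at this ⊢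
    exact this

/-- The height change between points at the same level which agree above this level. -/
lemma QIPair.pos_sub_le_of_hi_le (h : QIPair K φ ψ) (hF' : 2 ≤ Fintype.card F') {c D c' D' : ℤ}
    (hφ : Vert φ c D) (hψ : Vert ψ c' D') {p q : Lamplighter F} (hpq : pos p = pos q)
    (hhi : hi p q ≤ pos q) :
    pos (φ q) - pos (φ p) ≤ K * (K + D') + K + D := by
  by_contra hcon
  push Not at hcon
  have hK := h.one_le
  have hD := hφ.le_D
  have hD' := hψ.le_D
  obtain ⟨X, hX⟩ : ∃ X, X = K * (K + D') := ⟨_, rfl⟩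
  have hX0 : 0 ≤ X := by rw [hX]; positivity
  obtain ⟨Y, hY⟩ : ∃ Y, Y = K * D' := ⟨_, rfl⟩
  have hY0 : 0 ≤ Y := by rw [hY]; positivity
  rw [← hX] at hcon
  obtain ⟨i0, hi0⟩ : ∃ i0, i0 = pos (φ p) + (X + K + D) := ⟨_, rfl⟩
  have : Nontrivial F' := Fintype.one_lt_card_iff_nontrivial.1 hF'
  obtain ⟨g, hg⟩ := exists_ne (lamp (φ p) i0)
  obtain ⟨M, hM⟩ : ∃ M : ℤ, M = 2 * K + (pos q - lo p q) +
    (pos (φ q) - pos (φ p)) + Y := ⟨_, rfl⟩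
  have hlo := lo_le_right p q
  obtain ⟨S, hS⟩ : ∃ S : ℕ, (S : ℤ) = c' * M + D' :=
    ⟨(c' * M + D').toNat, Int.toNat_of_nonneg (by
      have := mul_nonneg hψ.c_pos.le (by omega : 0 ≤ M); omega)⟩
  have hMS : M ≤ c' * M := le_mul_of_one_le_left (by omega) hψ.c_pos
  obtain ⟨y, hy⟩ : ∃ y, y = dn (φ q) (fun _ => g) S := ⟨_, rfl⟩
  have hyq : Blw y (φ q) := hy ▸ blw_dn _ _ _
  have hypos : pos y = pos (φ q) - S := by rw [hy, pos_dn]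
  have hyl : lamp y i0 = g := by
    rw [hy, lamp_dn_of_mem _ (by omega) (by omega)]
  have a1 := hψ.lo_ge hyq
  have a2 := hψ.hi_le hyq
  have a3 := hψ.growth hyq
  have a4 : M ≤ pos (ψ (φ q)) - pos (ψ y) :=
    le_of_mul_le_mul_left (by omega) hψ.c_pos
  have b1 := h.inv_left q
  have b2 := lo_tri (ψ y) (ψ (φ q)) q
  have b3 := hi_tri (ψ y) (ψ (φ q)) q
  have b4 := lo_le_right (ψ (φ q)) q
  have b5 := right_le_hi (ψ (φ q)) q
  have b6 := lo_le_left (ψ (φ q)) q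
  have b7 := left_le_hi (ψ (φ q)) q
  unfold len at b1
  have c1 := lo_tri (ψ y) q p
  have c2 := hi_tri (ψ y) q p
  rw [lo_comm q p] at c1
  rw [hi_comm q p] at c2
  have hz := blw_mv (p := ψ y) (q := p) (a := -D') (b := K + D') (by omega) (by omega)
  have d1 := hφ.hi_le hz
  have d2 := h.len_left p (mv p (K + D'))
  have d3 := h.len_left (mv (ψ y) (-D')) (ψ y)
  have d4 := h.inv_right y
  have d5 := mul_le_mul_of_nonneg_left (len_mv p (K + D')) (by omega : 0 ≤ K)
  have d6 := mul_le_mul_of_nonneg_left (len_mv (ψ y) (-D')) (by omega : 0 ≤ K)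
  rw [abs_of_nonneg (by omega)] at d5
  rw [abs_neg, abs_of_nonneg hD'] at d6
  rw [len_comm (ψ y)] at d6
  rw [← hX] at d5
  rw [← hY] at d6
  replace d2 := d2.trans (add_le_add_left d5 K)
  replace d3 := d3.trans (add_le_add_left d6 K)
  have e1 := hi_tri y (φ (ψ y)) (φ p)
  have e2 := hi_tri (φ (ψ y)) (φ (mv (ψ y) (-D'))) (φ p)
  have e3 := hi_tri (φ (mv (ψ y) (-D'))) (φ (mv p (K + D'))) (φ p)
  have e4 := lo_le_left (φ p) (φ (mv p (K + D')))
  have e5 := right_le_hi (φ p) (φ (mv p (K + D')))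
  have e6 := lo_le_right (φ (ψ y)) y
  have e7 := left_le_hi (φ (ψ y)) y
  have e8 := lo_le_right (φ (mv (ψ y) (-D'))) (φ (ψ y))
  rw [hi_comm y (φ (ψ y))] at e1
  rw [hi_comm (φ (ψ y)) (φ (mv (ψ y) (-D')))] at e2
  rw [hi_comm (φ (mv p (K + D'))) (φ p)] at e3
  unfold len at d2 d3 d4
  refine hg ?_
  rw [← hyl]
  exact lamp_eq_of_le (by omega)

lemma QIPair.pos_sub_le_of_le_lo (h : QIPair K φ ψ) (hF' : 2 ≤ Fintype.card F') {c D c' D' : ℤ}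
    (hφ : Vert φ c D) (hψ : Vert ψ c' D') {p q : Lamplighter F} (hpq : pos p = pos q)
    (hlo : pos p ≤ lo p q) :
    pos (φ q) - pos (φ p) ≤ K * (K + D') + K + D := by
  have h' : QIPair K (fun p => rf (φ (rf p))) fun p => rf (ψ (rf p)) := h.rf_comp.comp_rf
  have := h'.pos_sub_le_of_hi_le hF' hφ.conj hψ.conj (p := rf q) (q := rf p)
    (by rw [pos_rf, pos_rf, hpq]) (by rw [hi_rf, pos_rf, lo_comm]; omega)
  rw [rf_rf, rf_rf, pos_rf, pos_rf] at this
  omega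

/-- Points at the same level are mapped to the same level, up to a bounded error. -/
theorem QIPair.exists_height (h : QIPair K φ ψ) (hF' : 2 ≤ Fintype.card F') {c D c' D' : ℤ}
    (hφ : Vert φ c D) (hψ : Vert ψ c' D') :
    ∃ H : ℤ, 0 ≤ H ∧ ∀ p q, pos p = pos q → pos (φ q) - pos (φ p) ≤ H := by
  have hK := h.one_le
  have hD := hφ.le_D
  have hD' := hψ.le_D
  refine ⟨2 * (K * (K + D') + K + D), by positivity, fun p q hpq => ?_⟩
  have hf : {i | (fun i => if i < pos p then lamp p i else lamp q i) i ≠ 1}.Finite := by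
    refine ((lamp_finite p).union (lamp_finite q)).subset fun i hi => ?_
    by_contra hc
    rw [mem_union, not_or, mem_ofPred_eq, mem_ofPred_eq, not_not, not_not] at hc
    refine hi ?_
    show (if i < pos p then lamp p i else lamp q i) = 1
    rw [hc.1, hc.2, ite_self]
  obtain ⟨z, hz⟩ : ∃ z, z = mkPt _ hf (pos p) := ⟨_, rfl⟩
  have hzp : pos z = pos p := by rw [hz, pos_mkPt]
  have hzl : ∀ i, lamp z i = if i < pos p then lamp p i else lamp q i := fun i => by
    rw [hz, lamp_mkPt]
  have h1 := h.pos_sub_le_of_le_lo hF' hφ hψ (p := p) (q := z) hzp.symm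
    (le_lo.2 ⟨le_rfl, hzp.ge, fun i hi => by rw [hzl, if_pos hi]⟩)
  have h2 := h.pos_sub_le_of_hi_le hF' hφ hψ (p := z) (q := q) (hzp.trans hpq)
    (hi_le.2 ⟨(hzp.trans hpq).le, le_rfl, fun i hi => by rw [hzl, if_neg (by omega)]⟩)
  omega

end

section

variable {F F' : Type} [Group F] [Group F'] [Fintype F] [Fintype F']
variable {K : ℤ} {φ : Lamplighter F → Lamplighter F'} {ψ : Lamplighter F' → Lamplighter F}

/-- Quasi-inverse quasi-isometries which preserve the levels and the vertical lines of the
lamplighter groups, up to bounded errors. -/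
structure LevelPair (K c c' D H : ℤ) (φ : Lamplighter F → Lamplighter F')
    (ψ : Lamplighter F' → Lamplighter F) : Prop where
  pair : QIPair K φ ψ
  vert : Vert φ c D
  vert' : Vert ψ c' D
  height_nonneg : 0 ≤ H
  height : ∀ p q, pos p = pos q → pos (φ q) - pos (φ p) ≤ H
  height' : ∀ p q, pos p = pos q → pos (ψ q) - pos (ψ p) ≤ H

variable {c c' D H : ℤ}

lemma LevelPair.symm (h : LevelPair K c c' D H φ ψ) : LevelPair K c' c D H ψ φ :=
  ⟨h.pair.symm, h.vert', h.vert, h.height_nonneg, h.height', h.height⟩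

lemma Vert.mono {D' : ℤ} (h : Vert φ c D) (hD : D ≤ D') : Vert φ c D' where
  c_pos := h.c_pos
  le_D := h.le_D.trans hD
  lo_ge hb := by have := h.lo_ge hb; omega
  hi_le hb := by have := h.hi_le hb; omega
  growth hb := by have := h.growth hb; omega

theorem QIPair.exists_levelPair {κ : ℕ} (h : QIPair (κ : ℤ) φ ψ) (hF : 2 ≤ Fintype.card F)
    (hF' : 2 ≤ Fintype.card F') :
    ∃ (c c' D H : ℤ) (φ' : Lamplighter F → Lamplighter F') (ψ' : Lamplighter F' → Lamplighter F),
      LevelPair κ c c' D H φ' ψ' := by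
  obtain ⟨φ', ψ', h', ⟨c, D, hφ⟩, c', D', hψ⟩ := h.exists_vert_pair hF hF'
  obtain ⟨H, hH, h1⟩ := h'.exists_height hF' hφ hψ
  obtain ⟨H', hH', h2⟩ := h'.symm.exists_height hF hψ hφ
  refine ⟨c, c', max D D', max H H', φ', ψ', h', hφ.mono (le_max_left _ _),
    hψ.mono (le_max_right _ _), by omega, fun p q hpq => (h1 p q hpq).trans (le_max_left _ _),
    fun p q hpq => (h2 p q hpq).trans (le_max_right _ _)⟩

/-- The depth of the image of the level `-i`. -/
def dep (φ : Lamplighter F → Lamplighter F') (i : ℤ) : ℤ := -pos (φ (mv 1 (-i)))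

namespace LevelPair

lemma pos_le (h : LevelPair K c c' D H φ ψ) {p : Lamplighter F} {i : ℤ} (hp : pos p = -i) :
    pos (φ p) ≤ -dep φ i + H := by
  have := h.height (mv 1 (-i)) p (by rw [pos_mv, pos_one, hp]; ring)
  unfold dep
  omega

lemma le_pos (h : LevelPair K c c' D H φ ψ) {p : Lamplighter F} {i : ℤ} (hp : pos p = -i) :
    -dep φ i - H ≤ pos (φ p) := by
  have := h.height p (mv 1 (-i)) (by rw [pos_mv, pos_one, hp]; ring)
  unfold dep
  omega

lemma dep_growth (h : LevelPair K c c' D H φ ψ) {i j : ℤ} (hij : i ≤ j) :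
    j - i ≤ c * (dep φ j - dep φ i) + D := by
  have hb : Blw (mv (1 : Lamplighter F) (-j)) (mv 1 (-i)) := by
    have := blw_mv_self (mv (1 : Lamplighter F) (-i)) (k := j - i) (by omega)
    rwa [mv_mv, show -i + -(j - i) = -j by ring] at this
  have := h.vert.growth hb
  rw [pos_mv, pos_mv] at this
  unfold dep
  rw [neg_sub_neg]
  omega

lemma le_dep_dep (h : LevelPair K c c' D H φ ψ) (j : ℤ) :
    j - H - K ≤ dep φ (dep ψ j) := by
  have h1 := h.le_pos (p := ψ (mv 1 (-j))) (i := dep ψ j) (by unfold dep; ring)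
  have h2 := (abs_pos_le_len _ _).trans (h.pair.inv_right (mv 1 (-j)))
  have h3 : pos (mv (1 : Lamplighter F') (-j)) = -j := by rw [pos_mv, pos_one]; ring
  have h4 := h.pos_le (p := ψ (mv 1 (-j))) (i := dep ψ j) (by unfold dep; ring)
  rw [abs_le] at h2
  omega

lemma dep_sub_le (h : LevelPair K c c' D H φ ψ) (i j : ℤ) :
    dep φ i - dep φ j ≤ K * |i - j| + K := by
  have hK := h.pair.one_le
  have h1 := (abs_pos_le_len _ _).trans (h.pair.len_left (mv 1 (-j)) (mv 1 (-i)))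
  have h2 := len_mv (mv (1 : Lamplighter F) (-j)) (j - i)
  rw [mv_mv, show -j + (j - i) = -i by ring, abs_sub_comm] at h2
  have h3 := mul_le_mul_of_nonneg_left h2 (by omega : 0 ≤ K)
  rw [abs_le] at h1
  unfold dep
  omega

lemma hi_le_of_blw (h : LevelPair K c c' D H φ ψ) {p r : Lamplighter F} (hb : Blw p r) {i : ℤ}
    (hr : pos r = -i) : hi (φ p) (φ r) ≤ -dep φ i + H + D := by
  have := h.vert.hi_le hb
  have := h.pos_le hr
  omega

lemma hi_le_aux (h : LevelPair K c c' D H φ ψ) {p : Lamplighter F} {r : Lamplighter F'} {t : ℤ}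
    (h1 : pos (φ p) - (H + D) ≤ lo (φ p) r) (h2 : hi (φ p) r ≤ t) :
    hi p (ψ (mv r (t - pos r))) ≤
      max (-dep ψ (-t) + H + D) (pos p + (K * (H + D) + 2 * K)) := by
  have hK := h.pair.one_le
  have hD := h.vert.le_D
  have hH := h.height_nonneg
  have hb : Blw (mv (φ p) (-(H + D))) (mv r (t - pos r)) := blw_mv (by omega) (by omega)
  have e1 := h.symm.hi_le_of_blw hb (i := -t) (by rw [pos_mv]; ring)
  have e2 := h.pair.len_right (φ p) (mv (φ p) (-(H + D)))
  have e3 := len_mv (φ p) (-(H + D))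
  rw [abs_neg, abs_of_nonneg (by omega)] at e3
  have e4 := mul_le_mul_of_nonneg_left e3 (by omega : 0 ≤ K)
  have e5 := h.pair.inv_left p
  have e6 := (len_tri p (ψ (φ p)) (ψ (mv (φ p) (-(H + D)))))
  rw [len_comm] at e5
  have e7 := hi_tri p (ψ (mv (φ p) (-(H + D)))) (ψ (mv r (t - pos r)))
  have e8 := lo_le_left p (ψ (mv (φ p) (-(H + D))))
  have e9 : len p (ψ (mv (φ p) (-(H + D)))) ≤ K * (H + D) + 2 * K := by
    generalize K * len (φ p) (mv (φ p) (-(H + D))) = A at *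
    generalize K * (H + D) = B at *
    omega
  unfold len at e9
  generalize K * (H + D) = B at *
  omega

lemma hi_le_of_hi_le (h : LevelPair K c c' D H φ ψ) {p p' q : Lamplighter F} (hp : Blw p q)
    (hp' : Blw p' q) (hpp : pos p = pos p') {t : ℤ} (ht : hi (φ p) (φ p') ≤ t) :
    hi p p' ≤ max (-dep ψ (-t) + H + D) (pos p + (K * (H + D) + 2 * K)) := by
  have e1 := h.vert.lo_ge hp
  have e2 := h.vert.lo_ge hp'
  have e3 := h.height p p' hpp
  have e4 := h.height p' p hpp.symm
  have e5 := lo_tri (φ p') (φ q) (φ p)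
  rw [lo_comm (φ q) (φ p)] at e5
  have e6 := right_le_hi (φ p) (φ p')
  have e7 := left_le_hi (φ p) (φ p')
  have hH := h.height_nonneg
  have hD := h.vert.le_D
  have a1 := h.hi_le_aux (p := p) (r := φ p) (t := t) (by rw [lo_self]; omega)
    (by rw [hi_self]; omega)
  have a2 := h.hi_le_aux (p := p') (r := φ p) (t := t) (by omega) (by rw [hi_comm]; omega)
  have a3 := hi_tri p (ψ (mv (φ p) (t - pos (φ p)))) p'
  rw [hi_comm p'] at a2
  rw [← hpp] at a2
  exact a3.trans (max_le a1 a2)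

lemma exists_dep_ge (h : LevelPair K c c' D H φ ψ) (M : ℤ) :
    ∃ I0 : ℕ, ∀ I : ℕ, I0 ≤ I → M ≤ dep φ I := by
  have hc := h.vert.c_pos
  refine ⟨(c * (M - dep φ 0) + D).toNat, fun I hI => ?_⟩
  have h1 := h.dep_growth (Int.natCast_nonneg I)
  have h2 := Int.self_le_toNat (c * (M - dep φ 0) + D)
  have h3 : c * (M - dep φ 0) ≤ c * (dep φ I - dep φ 0) := by omega
  have := le_of_mul_le_mul_left h3 hc
  omega

/-- The map induced by `φ` on the ends of the vertical lines through `1`. -/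
lemma exists_limit (h : LevelPair K c c' D H φ ψ) :
    ∃ Φ : (ℕ → F) → ℤ → F', ∀ x j (I : ℕ), -dep φ I + H + D ≤ j →
      Φ x j = lamp (φ (dn 1 x I)) j := by
  choose I0 hI0 using h.exists_dep_ge
  refine ⟨fun x j => lamp (φ (dn 1 x (I0 (H + D - j)))) j, fun x j I hI => ?_⟩
  have key : ∀ a b : ℕ, a ≤ b → -dep φ a + H + D ≤ j →
      lamp (φ (dn 1 x b)) j = lamp (φ (dn 1 x a)) j := fun a b hab ha => by
    have hb : Blw (dn 1 x b) (dn 1 x a) := by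
      rw [dn_dn_sub 1 x hab]
      exact blw_dn _ _ _
    exact lamp_eq_of_le ((h.hi_le_of_blw hb (by rw [pos_dn, pos_one, zero_sub])).trans ha)
  have := hI0 (H + D - j) _ le_rfl
  rcases le_total (I0 (H + D - j)) I with hl | hl
  · exact (key _ _ hl (by omega)).symm
  · exact key _ _ hl hI

end LevelPair

end

section

variable {F F' : Type} [Group F] [Group F'] [Fintype F] [Fintype F']
variable {K : ℤ} {φ : Lamplighter F → Lamplighter F'} {ψ : Lamplighter F' → Lamplighter F}
variable {c c' D H : ℤ}

lemma LevelPair.card_pow_le (h : LevelPair K c c' D H φ ψ) (J : ℕ) :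
    Fintype.card F' ^ J ≤ mult F' K * ((2 * H + 1).toNat *
      Fintype.card F ^ (dep ψ J + (pos (ψ 1) + H + 2 * D)).toNat) := by
  classical
  have hH := h.height_nonneg
  obtain ⟨s, hs⟩ : ∃ s : Finset (Lamplighter F'),
      s = Finset.univ.image fun v : Fin J → F' => dn (1 : Lamplighter F') (extw v) J := ⟨_, rfl⟩
  have hcard : s.card = Fintype.card F' ^ J := by
    rw [hs, Finset.card_image_of_injective _ (dn_injective 1 J), Finset.card_univ,
      Fintype.card_fun, Fintype.card_fin]
  rw [← hcard]
  refine (h.pair.symm.card_le s).trans (Nat.mul_le_mul_left _ ?_)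
  have := card_le_of_window (I := Fin (2 * H + 1).toNat)
    (fun i => -dep ψ J - H + (i : ℕ)) (fun _ => -dep ψ J - H - D) (fun _ => lamp (ψ 1))
    (dep ψ J + (pos (ψ 1) + H + 2 * D)).toNat (s.image ψ) (fun e he => by
      obtain ⟨p, hp, rfl⟩ := Finset.mem_image.1 he
      rw [hs, Finset.mem_image] at hp
      obtain ⟨v, -, rfl⟩ := hp
      have hpos : pos (dn (1 : Lamplighter F') (extw v) J) = -(J : ℤ) := by
        rw [pos_dn, pos_one, zero_sub]
      have e1 := h.symm.pos_le hpos
      have e2 := h.symm.le_pos hpos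
      have hb := blw_dn (1 : Lamplighter F') (extw v) J
      have e3 := h.vert'.lo_ge hb
      have e4 := h.vert'.hi_le hb
      refine ⟨⟨(pos (ψ (dn 1 (extw v) J)) + dep ψ J + H).toNat, by omega⟩, ?_, fun j hj => ?_⟩
      · show _ = -dep ψ J - H + ((pos (ψ (dn 1 (extw v) J)) + dep ψ J + H).toNat : ℤ)
        omega
      · by_cases hlt : j < -dep ψ J - H - D
        · exact lamp_eq_of_lt (by omega)
        · exact lamp_eq_of_le (by omega))
  rwa [Fintype.card_fin] at this

/-- A quasi-isometry preserving levels and vertical lines induces a bounded-to-one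
correspondence between the cylinders in the spaces of sequences in `F` and in `F'`. -/
theorem LevelPair.exists_code (h : LevelPair K c c' D H φ ψ) (hF : 2 ≤ Fintype.card F) :
    ∃ (Φ : (ℕ → F) → ℕ → F') (s : ℕ → ℕ) (C : ℕ),
      (∀ J x x', (∀ i < s J + C, x i = x' i) → ∀ k < J, Φ x k = Φ x' k) ∧
      (∀ J x x', (∀ k < J, Φ x k = Φ x' k) → ∀ i < s J, x i = x' i) ∧
      ∀ J, Fintype.card F' ^ J ≤ Fintype.card F ^ (s J + C) := by
  have hK := h.pair.one_le
  have hH := h.height_nonneg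
  have hD := h.vert.le_D
  have hc := h.vert.c_pos
  obtain ⟨Φ, hΦ⟩ := h.exists_limit
  obtain ⟨top, htop⟩ : ∃ top, top = -dep φ 0 + H + D := ⟨_, rfl⟩
  obtain ⟨B, hB⟩ : ∃ B, B = mult F' K * (2 * H + 1).toNat := ⟨_, rfl⟩
  obtain ⟨X, hX⟩ : ∃ X, X = c * (2 * H + K + D) := ⟨_, rfl⟩
  have hX0 : 0 ≤ X := by rw [hX]; positivity
  obtain ⟨Y, hY⟩ : ∃ Y, Y = K * |top| + K := ⟨_, rfl⟩
  have hY0 : 0 ≤ Y := by rw [hY]; positivity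
  obtain ⟨C, hC1, hC2⟩ : ∃ C : ℕ, H + D + X + D ≤ C ∧
      Y + |pos (ψ 1) + H + 2 * D| + (H + D) + B ≤ C :=
    ⟨(H + D + X + D + (Y + |pos (ψ 1) + H + 2 * D| + (H + D) + B)).toNat, by
      have := abs_nonneg (pos (ψ 1) + H + 2 * D); omega, by omega⟩
  refine ⟨fun x k => Φ x (top - 1 - k), fun J => (dep ψ (J - top) - (H + D)).toNat, C,
    fun J x x' hx k hk => ?_, fun J x x' hx i hlt => ?_, fun J => ?_⟩
  · obtain ⟨u, hu⟩ : ∃ u, u = dep ψ (J - top) := ⟨_, rfl⟩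
    beta_reduce at hx
    rw [← hu] at hx
    obtain ⟨I, hI⟩ : ∃ I, I = (u - (H + D)).toNat + C := ⟨_, rfl⟩
    rw [← hI] at hx
    have e1 := h.dep_growth (show u ≤ (I : ℤ) by omega)
    have e2 := h.le_dep_dep (J - top)
    rw [← hu] at e2
    have e3 : c * (2 * H + K + D) ≤ c * (dep φ I - dep φ u) := by omega
    have e4 := le_of_mul_le_mul_left e3 hc
    beta_reduce
    rw [hΦ x _ I (by omega), hΦ x' _ I (by omega), dn_congr 1 hx]
  · obtain ⟨u, hu⟩ : ∃ u, u = dep ψ (J - top) := ⟨_, rfl⟩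
    beta_reduce at hlt hx
    rw [← hu] at hlt
    obtain ⟨I0, hI0⟩ := h.exists_dep_ge (H + D + J - top)
    obtain ⟨I, hI1, hI2, hI3⟩ : ∃ I : ℕ, I0 ≤ I ∧ i < I ∧
        K * (H + D) + 2 * K + u - (H + D) ≤ I :=
      ⟨max (max I0 (i + 1)) (K * (H + D) + 2 * K + u - (H + D)).toNat, by omega, by omega,
        by omega⟩
    have e1 := hI0 I hI1
    have hpos : ∀ y, pos (dn (1 : Lamplighter F) y I) = -(I : ℤ) := fun y => by
      rw [pos_dn, pos_one, zero_sub]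
    have e2 : hi (φ (dn 1 x I)) (φ (dn 1 x' I)) ≤ top - J := by
      have p1 := h.pos_le (hpos x)
      have p2 := h.pos_le (hpos x')
      refine hi_le.2 ⟨by omega, by omega, fun j hj => ?_⟩
      rw [← hΦ x j I (by omega), ← hΦ x' j I (by omega)]
      by_cases hjt : top ≤ j
      · rw [hΦ x j 0 (by rw [Nat.cast_zero]; omega), hΦ x' j 0 (by rw [Nat.cast_zero]; omega),
          dn_zero, dn_zero]
      · have := hx (top - 1 - j).toNat (by omega)
        rwa [Int.toNat_of_nonneg (by omega), show top - 1 - (top - 1 - j) = j by ring] at this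
    have e3 := h.hi_le_of_hi_le (blw_dn 1 x I) (blw_dn 1 x' I) ((hpos x).trans (hpos x').symm) e2
    rw [neg_sub, ← hu, hpos] at e3
    have e4 : lamp (dn 1 x I) (-1 - i) = lamp (dn 1 x' I) (-1 - i) := by
      refine lamp_eq_of_le ?_
      generalize K * (H + D) = Z at *
      omega
    rw [lamp_dn_of_mem _ (by rw [pos_one]; omega) (by rw [pos_one]; omega),
      lamp_dn_of_mem _ (by rw [pos_one]; omega) (by rw [pos_one]; omega), pos_one,
      show ((0 : ℤ) - 1 - (-1 - i)).toNat = i by omega] at e4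
    exact e4
  · have e1 := h.symm.dep_sub_le J (J - top)
    rw [sub_sub_cancel, ← hY] at e1
    have e2 := le_abs_self (pos (ψ 1) + H + 2 * D)
    have e3 := abs_nonneg (pos (ψ 1) + H + 2 * D)
    calc Fintype.card F' ^ J ≤ _ := h.card_pow_le J
      _ ≤ 2 ^ B * Fintype.card F ^ (dep ψ J + (pos (ψ 1) + H + 2 * D)).toNat := by
          rw [← mul_assoc, ← hB]
          exact Nat.mul_le_mul_right _ Nat.lt_two_pow_self.le
      _ ≤ Fintype.card F ^ B * Fintype.card F ^ (dep ψ J + (pos (ψ 1) + H + 2 * D)).toNat :=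
          Nat.mul_le_mul_right _ (Nat.pow_le_pow_left hF B)
      _ ≤ Fintype.card F ^ ((dep ψ (J - top) - (H + D)).toNat + C) := by
          rw [← pow_add]
          exact Nat.pow_le_pow_right (by omega) (by omega)

end

section

variable {F F' : Type} [Group F'] [Fintype F'] [Group F] [Fintype F]

/-- The normalized measure of the set of sequences whose code starts with the first `J` letters
of `y`. -/
def dens (Φ : (ℕ → F) → ℕ → F') (s : ℕ → ℕ) (C J : ℕ) (y : ℕ → F') : ℝ :=
  Pr (s J + C) (fun x => ∀ k < J, Φ x k = y k) * (Fintype.card F' : ℝ) ^ J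

section Code

variable {Φ : (ℕ → F) → ℕ → F'} {s : ℕ → ℕ} {C : ℕ}

lemma dens_sub_le
    (h1 : ∀ J x x', (∀ i < s J + C, x i = x' i) → ∀ k < J, Φ x k = Φ x' k) (J : ℕ) (y : ℕ → F')
    {M : ℝ} (hM : ∀ J y, dens Φ s C J y ≤ M) :
    M - dens Φ s C (J + 1) y ≤ Fintype.card F' * (M - dens Φ s C J y) := by
  classical
  have hPr : ∀ (J : ℕ) (y : ℕ → F') (L : ℕ), s J + C ≤ L → Pr L (fun x => ∀ k < J, Φ x k = y k) =
      Pr (s J + C) (fun x => ∀ k < J, Φ x k = y k) := fun J y L hL =>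
    Pr_of_le hL fun x x' hx => forall₂_congr fun k hk => by rw [h1 J x x' hx k hk]
  obtain ⟨L, hL1, hL2⟩ : ∃ L, s J + C ≤ L ∧ s (J + 1) + C ≤ L :=
    ⟨_, le_max_left _ _, le_max_right _ _⟩
  have e1 : dens Φ s C J y * Fintype.card F' ≤
      ∑ g : F', dens Φ s C (J + 1) (Function.update y J g) := by
    have : Pr L (fun x => ∀ k < J, Φ x k = y k) ≤
        ∑ g : F', Pr L (fun x => ∀ k < J + 1, Φ x k = Function.update y J g k) := by
      refine le_trans (Pr_mono fun x hx => ?_) (Pr_exists Finset.univ L _)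
      refine ⟨Φ x J, Finset.mem_univ _, fun k hk => ?_⟩
      rcases Nat.lt_succ_iff_lt_or_eq.1 hk with h | rfl
      · rw [Function.update_of_ne h.ne, hx k h]
      · rw [Function.update_self]
    rw [hPr J y L hL1, Finset.sum_congr rfl fun g _ => hPr (J + 1) _ L hL2] at this
    unfold dens
    rw [← Finset.sum_mul, mul_assoc, ← pow_succ]
    exact mul_le_mul_of_nonneg_right this (by positivity)
  rw [← Finset.add_sum_erase _ _ (Finset.mem_univ (y J)), Function.update_eq_self] at e1
  have e2 := Finset.sum_le_card_nsmul (Finset.univ.erase (y J))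
    (fun g => dens Φ s C (J + 1) (Function.update y J g)) M fun g _ => hM _ _
  rw [Finset.card_erase_of_mem (Finset.mem_univ _), Finset.card_univ, nsmul_eq_mul,
    Nat.cast_sub Fintype.card_pos, Nat.cast_one] at e2
  linarith

lemma dens_sub_le_pow
    (h1 : ∀ J x x', (∀ i < s J + C, x i = x' i) → ∀ k < J, Φ x k = Φ x' k) (J : ℕ) (y : ℕ → F')
    {M : ℝ} (hM : ∀ J y, dens Φ s C J y ≤ M) (a : ℕ) :
    M - dens Φ s C (J + a) y ≤ (Fintype.card F' : ℝ) ^ a * (M - dens Φ s C J y) := by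
  induction a with
  | zero => simp
  | succ a ih =>
    refine (dens_sub_le h1 (J + a) y hM).trans ?_
    rw [pow_succ', mul_assoc]
    exact mul_le_mul_of_nonneg_left ih (by positivity)

lemma Pr_code_le (h2 : ∀ J x x', (∀ k < J, Φ x k = Φ x' k) → ∀ i < s J, x i = x' i)
    (J : ℕ) (y : ℕ → F') :
    Pr (s J + C) (fun x => ∀ k < J, Φ x k = y k) ≤ ((Fintype.card F : ℝ) ^ s J)⁻¹ := by
  by_cases hx : ∃ x0, ∀ k < J, Φ x0 k = y k
  · obtain ⟨x0, hx0⟩ := hx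
    exact (Pr_mono fun x hx => h2 J x x0 fun k hk => (hx k hk).trans (hx0 k hk).symm).trans
      (Pr_prefix_le _ _ (Nat.le_add_right _ _) x0)
  · by_contra hc
    have : 0 < Pr (s J + C) (fun x => ∀ k < J, Φ x k = y k) :=
      lt_of_le_of_lt (by positivity) (not_le.1 hc)
    exact hx (exists_of_Pr_pos this)

lemma eq_of_ratio {m A u v : ℕ} (hm : 1 ≤ m) (hu : u ≤ m ^ A) {η : ℝ}
    (hη : η = 1 / (4 * (m : ℝ) ^ A)) (h1 : (1 - η) * v ≤ u) (h2 : (1 - η) * u ≤ v) : u = v := by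
  have hP : (1 : ℝ) ≤ (m : ℝ) ^ A := one_le_pow₀ (by exact_mod_cast hm)
  have hu' : (u : ℝ) ≤ (m : ℝ) ^ A := by exact_mod_cast hu
  have hη0 : 0 < η := by rw [hη]; positivity
  have hηu : η * u ≤ 1 / 4 := by
    rw [hη, div_mul_eq_mul_div, div_le_div_iff₀ (by positivity) (by norm_num)]
    linarith
  have hη4 : η ≤ 1 / 4 := by
    rw [hη]
    exact one_div_le_one_div_of_le (by norm_num) (by linarith)
  have hv0 : (0 : ℝ) ≤ v := v.cast_nonneg
  have hv : (v : ℝ) ≤ 2 * u := by nlinarith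
  have hηv : η * v ≤ 1 / 2 := by nlinarith
  have e1 : (u : ℝ) < v + 1 := by linarith
  have e2 : (v : ℝ) < u + 1 := by linarith
  have e1' : u < v + 1 := by exact_mod_cast e1
  have e2' : v < u + 1 := by exact_mod_cast e2
  omega

theorem exists_pow_eq_pow_of_code (hF : 2 ≤ Fintype.card F) (hF' : 2 ≤ Fintype.card F')
    (h1 : ∀ J x x', (∀ i < s J + C, x i = x' i) → ∀ k < J, Φ x k = Φ x' k)
    (h2 : ∀ J x x', (∀ k < J, Φ x k = Φ x' k) → ∀ i < s J, x i = x' i)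
    (h3 : ∀ J, Fintype.card F' ^ J ≤ Fintype.card F ^ (s J + C)) :
    ∃ α β : ℕ, 0 < α ∧ 0 < β ∧ Fintype.card F' ^ α = Fintype.card F ^ β := by
  classical
  obtain ⟨n, hn⟩ : ∃ n, n = Fintype.card F := ⟨_, rfl⟩
  obtain ⟨m, hm⟩ : ∃ m, m = Fintype.card F' := ⟨_, rfl⟩
  have hn0 : (0 : ℝ) < n := by rw [hn]; exact_mod_cast (by omega : 0 < Fintype.card F)
  have hm0 : (0 : ℝ) < m := by rw [hm]; exact_mod_cast (by omega : 0 < Fintype.card F')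
  have hbd : ∀ J y, dens Φ s C J y ≤ (n : ℝ) ^ C := fun J y => by
    have e1 := Pr_code_le (C := C) h2 J y
    have e3 : ((m : ℝ)) ^ J ≤ (n : ℝ) ^ (s J + C) := by
      rw [hm, hn]
      exact_mod_cast h3 J
    unfold dens
    rw [← hn] at e1
    rw [← hm]
    calc _ ≤ ((n : ℝ) ^ s J)⁻¹ * (n : ℝ) ^ (s J + C) :=
          mul_le_mul e1 e3 (by positivity) (by positivity)
      _ = (n : ℝ) ^ C := by rw [pow_add]; field_simp
  have hne : (range fun p : ℕ × (ℕ → F') => dens Φ s C p.1 p.2).Nonempty :=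
    ⟨_, ⟨(0, fun _ => 1), rfl⟩⟩
  have hbdd : BddAbove (range fun p : ℕ × (ℕ → F') => dens Φ s C p.1 p.2) :=
    ⟨(n : ℝ) ^ C, by rintro _ ⟨p, rfl⟩; exact hbd p.1 p.2⟩
  obtain ⟨M, hM⟩ : ∃ M, M = sSup (range fun p : ℕ × (ℕ → F') => dens Φ s C p.1 p.2) := ⟨_, rfl⟩
  have hle : ∀ J y, dens Φ s C J y ≤ M := fun J y => hM ▸ le_csSup hbdd ⟨(J, y), rfl⟩
  have hM1 : 1 ≤ M := by
    have e := hle 0 fun _ => 1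
    have : Pr (s 0 + C) (fun x : ℕ → F => ∀ k < 0, Φ x k = 1) = 1 := by
      have := Pr_not (s 0 + C) (fun x : ℕ → F => ¬ ∀ k < 0, Φ x k = 1)
      have e0 : Pr (s 0 + C) (fun x : ℕ → F => ¬ ∀ k < 0, Φ x k = 1) = 0 := by
        by_contra hc
        obtain ⟨x, hx⟩ := exists_of_Pr_pos (lt_of_le_of_ne (Pr_nonneg _ _) (Ne.symm hc))
        exact hx fun k hk => absurd hk (Nat.not_lt_zero k)
      rw [e0, sub_zero] at this
      rw [← this]
      exact Pr_congr fun x => not_not.symm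
    rwa [dens, this, pow_zero, mul_one] at e
  obtain ⟨A, hA⟩ : ∃ A, A = n ^ C := ⟨_, rfl⟩
  obtain ⟨η, hη⟩ : ∃ η : ℝ, η = 1 / (4 * (m : ℝ) ^ A) := ⟨_, rfl⟩
  have hη0 : 0 < η := by rw [hη]; positivity
  obtain ⟨_, ⟨⟨J, y⟩, rfl⟩, hJ⟩ := exists_lt_of_lt_csSup hne
    (show M - η * M / (m : ℝ) ^ A < sSup _ by
      rw [← hM]; exact sub_lt_self _ (by positivity))
  have hlow : ∀ a ≤ A, (1 - η) * M ≤ dens Φ s C (J + a) y := fun a ha => by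
    have e1 := dens_sub_le_pow h1 J y hle a
    rw [← hm] at e1
    have e2 : (m : ℝ) ^ a * (M - dens Φ s C J y) ≤ (m : ℝ) ^ A * (η * M / (m : ℝ) ^ A) := by
      refine mul_le_mul (pow_le_pow_right₀ ?_ ha) (by linarith) (sub_nonneg.2 (hle J y))
        (by positivity)
      rw [hm]
      exact_mod_cast (by omega : 1 ≤ Fintype.card F')
    rw [mul_div_cancel₀ _ (by positivity)] at e2
    linarith
  obtain ⟨N, hN⟩ : ∃ N : ℕ → ℕ, ∀ a, N a = Nat.card
      {v : Fin (s (J + a) + C) → F // ∀ k < J + a, Φ (extw v) k = y k} := ⟨_, fun _ => rfl⟩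
  have hdens : ∀ a, dens Φ s C (J + a) y * (n : ℝ) ^ (s (J + a) + C) = N a * (m : ℝ) ^ (J + a) :=
    fun a => by
      have := Pr_eq_card (s (J + a) + C) (fun x : ℕ → F => ∀ k < J + a, Φ x k = y k)
      rw [hN, ← this, dens, hn, hm]
      ring
  have hNA : ∀ a, N a ≤ A := fun a => by
    have e1 := Pr_code_le (C := C) h2 (J + a) y
    have e2 := Pr_eq_card (s (J + a) + C) (fun x : ℕ → F => ∀ k < J + a, Φ x k = y k)
    rw [← hN, ← hn] at e2
    rw [← hn] at e1
    have e3 := mul_le_mul_of_nonneg_right e1 (by positivity : 0 ≤ (n : ℝ) ^ (s (J + a) + C))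
    rw [e2, pow_add, inv_mul_cancel_left₀ (by positivity)] at e3
    rw [hA]
    exact_mod_cast e3
  have hm1 : (1 : ℝ) ≤ (m : ℝ) ^ A := one_le_pow₀ (by
    rw [hm]
    exact_mod_cast (by omega : 1 ≤ Fintype.card F'))
  have hη4 : η ≤ 1 / 4 := by
    rw [hη]
    exact one_div_le_one_div_of_le (by norm_num) (by linarith)
  have hdpos : ∀ a ≤ A, 0 < dens Φ s C (J + a) y := fun a ha =>
    lt_of_lt_of_le (mul_pos (by linarith) (by linarith)) (hlow a ha)
  have hNpos : ∀ a ≤ A, 0 < N a := fun a ha => by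
    have e1 := mul_pos (hdpos a ha) (pow_pos hn0 (s (J + a) + C))
    rw [hdens] at e1
    exact_mod_cast pos_of_mul_pos_left e1 (by positivity)
  have hcmp : ∀ a ≤ A, ∀ b ≤ A, (1 - η) * dens Φ s C (J + a) y ≤ dens Φ s C (J + b) y :=
    fun a _ b hb => (mul_le_mul_of_nonneg_left (hle _ _) (by linarith)).trans (hlow b hb)
  obtain ⟨a, ha, b, hb, hab, hNab⟩ : ∃ a ≤ A, ∃ b ≤ A, a < b ∧ N a = N b := by
    obtain ⟨a, ha, b, hb, hab, h⟩ := Finset.exists_ne_map_eq_of_card_lt_of_maps_to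
      (s := Finset.range (A + 1)) (t := Finset.Icc 1 A) (f := N) (by simp) fun a ha => by
        rw [Finset.mem_coe, Finset.mem_range] at ha
        exact Finset.mem_coe.2 (Finset.mem_Icc.2 ⟨hNpos a (by omega), hNA a⟩)
    rw [Finset.mem_range] at ha hb
    rcases hab.lt_or_gt with hlt | hlt
    · exact ⟨a, by omega, b, by omega, hlt, h⟩
    · exact ⟨b, by omega, a, by omega, hlt, h.symm⟩
  have hkey : dens Φ s C (J + b) y * (n : ℝ) ^ s (J + b) =
      dens Φ s C (J + a) y * (n : ℝ) ^ s (J + a) * (m : ℝ) ^ (b - a) := by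
    have e1 := hdens a
    have e2 := hdens b
    rw [pow_add] at e1 e2
    have e3 : (m : ℝ) ^ (J + b) = (m : ℝ) ^ (J + a) * (m : ℝ) ^ (b - a) := by
      rw [← pow_add]
      congr 1
      omega
    rw [← hNab, e3] at e2
    have : (n : ℝ) ^ C ≠ 0 := by positivity
    refine mul_right_cancel₀ this ?_
    linear_combination e2 - (m : ℝ) ^ (b - a) * e1
  have hda := hdpos a ha
  have hdb := hdpos b hb
  have hma : 2 ≤ m ^ (b - a) := (hm ▸ hF').trans (Nat.le_self_pow (by omega) m)
  refine ⟨b - a, s (J + b) - s (J + a), by omega, ?_⟩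
  rw [← hm, ← hn]
  by_cases hs : s (J + a) ≤ s (J + b)
  · have e1 : (n : ℝ) ^ s (J + b) = (n : ℝ) ^ s (J + a) * (n : ℝ) ^ (s (J + b) - s (J + a)) := by
      rw [← pow_add]
      congr 1
      omega
    have e2 : dens Φ s C (J + b) y * (n : ℝ) ^ (s (J + b) - s (J + a)) =
        dens Φ s C (J + a) y * (m : ℝ) ^ (b - a) := by
      have : (n : ℝ) ^ s (J + a) ≠ 0 := by positivity
      refine mul_right_cancel₀ this ?_
      rw [e1] at hkey
      linarith
    have e3 : m ^ (b - a) = n ^ (s (J + b) - s (J + a)) := by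
      refine eq_of_ratio (A := A) (by rw [hm]; omega)
        (Nat.pow_le_pow_right (by rw [hm]; omega) (by omega)) hη ?_ ?_
      · push_cast
        refine le_of_mul_le_mul_left ?_ hda
        have := mul_le_mul_of_nonneg_right (hcmp a ha b hb)
          (by positivity : 0 ≤ (n : ℝ) ^ (s (J + b) - s (J + a)))
        linarith
      · push_cast
        refine le_of_mul_le_mul_left ?_ hdb
        have := mul_le_mul_of_nonneg_right (hcmp b hb a ha)
          (by positivity : 0 ≤ (m : ℝ) ^ (b - a))
        linarith
    refine ⟨Nat.pos_of_ne_zero fun h0 => ?_, e3⟩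
    rw [h0, pow_zero] at e3
    omega
  · exfalso
    have e1 : (n : ℝ) ^ s (J + b) ≤ (n : ℝ) ^ s (J + a) := by
      refine pow_le_pow_right₀ ?_ (by omega)
      rw [hn]
      exact_mod_cast (by omega : 1 ≤ Fintype.card F)
    have e2 : dens Φ s C (J + a) y * (m : ℝ) ^ (b - a) ≤ dens Φ s C (J + b) y := by
      refine le_of_mul_le_mul_right ?_ (pow_pos hn0 (s (J + a)))
      have := mul_le_mul_of_nonneg_left e1 hdb.le
      linarith
    have e3 : (2 : ℝ) ≤ (m : ℝ) ^ (b - a) := by exact_mod_cast hma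
    have e4 := hcmp b hb a ha
    nlinarith

end Code

end

section

variable {F F' : Type} [Group F] [Group F'] [Fintype F] [Fintype F']

lemma exists_common_base {n m α β : ℕ} (hα : 0 < α) (hβ : 0 < β) (h : m ^ α = n ^ β) :
    ∃ d s r : ℕ, 0 < s ∧ 0 < r ∧ n = d ^ s ∧ m = d ^ r := by
  obtain ⟨g, a, b, hg, hco, rfl, rfl⟩ := Nat.exists_coprime' (Nat.gcd_pos_of_pos_left β hα)
  have h' : m ^ a = n ^ b := by
    rw [pow_mul, pow_mul] at h
    exact Nat.pow_left_injective hg.ne' h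
  obtain ⟨d, h1, h2⟩ := Nat.exists_eq_pow_of_exponent_coprime_of_pow_eq_pow hco h'
  exact ⟨d, a, b, Nat.pos_of_mul_pos_right hα, Nat.pos_of_mul_pos_right hβ, h2, h1⟩

lemma QIPair.not_trivial {κ : ℕ} {φ : Lamplighter F → Lamplighter F'}
    {ψ : Lamplighter F' → Lamplighter F} (h : QIPair (κ : ℤ) φ ψ) (hF : 2 ≤ Fintype.card F)
    (hF' : Fintype.card F' = 1) : False := by
  classical
  obtain ⟨M, hM⟩ : ∃ M, M = mult F κ := ⟨_, rfl⟩
  have key : ∀ J : ℕ, 2 ^ J ≤ M * (2 * (κ * J + κ) + 1) := fun J => by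
    obtain ⟨s, hs⟩ : ∃ s : Finset (Lamplighter F),
        s = Finset.univ.image fun v : Fin J → F => dn (1 : Lamplighter F) (extw v) J := ⟨_, rfl⟩
    have hcard : s.card = Fintype.card F ^ J := by
      rw [hs, Finset.card_image_of_injective _ (dn_injective 1 J), Finset.card_univ,
        Fintype.card_fun, Fintype.card_fin]
    refine (Nat.pow_le_pow_left hF J).trans (hcard ▸ (h.card_le s).trans ?_)
    rw [← hM]
    refine Nat.mul_le_mul_left _ ?_
    have := card_le_of_window (I := Fin (2 * (κ * J + κ) + 1))
      (fun i => pos (φ 1) - (κ * J + κ) + (i : ℕ)) (fun _ => 0) (fun _ _ => 1) 0 (s.image φ)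
      (fun e he => by
        obtain ⟨p, hp, rfl⟩ := Finset.mem_image.1 he
        rw [hs, Finset.mem_image] at hp
        obtain ⟨v, -, rfl⟩ := hp
        have e1 := (abs_pos_le_len _ _).trans (h.len_left 1 (dn 1 (extw v) J))
        rw [len_dn', abs_le] at e1
        refine ⟨⟨(pos (φ (dn 1 (extw v) J)) - pos (φ 1) + (κ * J + κ)).toNat, by
          generalize hz : κ * J = z
          have : (κ : ℤ) * J = z := by exact_mod_cast hz
          omega⟩, ?_, fun j _ => ?_⟩
        · show _ = pos (φ 1) - (κ * J + κ) +
            ((pos (φ (dn 1 (extw v) J)) - pos (φ 1) + (κ * J + κ)).toNat : ℤ)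
          rw [Int.toNat_of_nonneg (by omega)]
          ring
        · have := Fintype.card_le_one_iff_subsingleton.1 hF'.le
          exact Subsingleton.elim _ _)
    rwa [Fintype.card_fin, pow_zero, mul_one] at this
  obtain ⟨J, hJ⟩ : ∃ J, J = 4 + M * (4 * κ + 1) := ⟨_, rfl⟩
  have h1 := (sq_le_two_pow (e := J) (by omega)).trans (key J)
  have h2 : M * (2 * (κ * J + κ) + 1) ≤ M * (4 * κ + 1) * J := by
    rw [mul_assoc]
    refine Nat.mul_le_mul_left _ ?_
    have : κ ≤ κ * J := Nat.le_mul_of_pos_right _ (by omega)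
    nlinarith
  have h3 : M * (4 * κ + 1) * J < J * J := Nat.mul_lt_mul_of_pos_right (by omega) (by omega)
  omega

theorem QIPair.exists_base {κ : ℕ} {φ : Lamplighter F → Lamplighter F'}
    {ψ : Lamplighter F' → Lamplighter F} (h : QIPair (κ : ℤ) φ ψ) :
    ∃ d s r : ℕ, 0 < d ∧ 0 < s ∧ 0 < r ∧
      Fintype.card F = d ^ s ∧ Fintype.card F' = d ^ r := by
  have hc : 0 < Fintype.card F := Fintype.card_pos
  have hc' : 0 < Fintype.card F' := Fintype.card_pos
  rcases Nat.lt_or_ge (Fintype.card F) 2 with hF | hF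
  · rcases Nat.lt_or_ge (Fintype.card F') 2 with hF' | hF'
    · exact ⟨1, 1, 1, one_pos, one_pos, one_pos, by omega, by omega⟩
    · exact (h.symm.not_trivial hF' (by omega)).elim
  rcases Nat.lt_or_ge (Fintype.card F') 2 with hF' | hF'
  · exact (h.not_trivial hF (by omega)).elim
  obtain ⟨c, c', D, H, φ', ψ', h'⟩ := h.exists_levelPair hF hF'
  obtain ⟨Φ, s, C, h1, h2, h3⟩ := h'.exists_code hF
  obtain ⟨α, β, hα, hβ, hab⟩ := exists_pow_eq_pow_of_code hF hF' h1 h2 h3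
  obtain ⟨d, s, r, hs, hr, e1, e2⟩ := exists_common_base hα hβ hab
  refine ⟨d, s, r, Nat.pos_of_ne_zero fun h0 => ?_, hs, hr, e1, e2⟩
  rw [h0, zero_pow hs.ne'] at e1
  omega

end

section

section WordDist

variable {G : Type*} [Group G] {S : Set G}

lemma exists_word (hS : Subgroup.closure S = ⊤) (g : G) :
    ∃ l : List G, (∀ x ∈ l, x ∈ S ∨ x⁻¹ ∈ S) ∧ l.prod = g := by
  have h : g ∈ (Subgroup.closure S).toSubmonoid := by
    rw [hS]
    exact Subgroup.mem_top g
  rw [Subgroup.closure_toSubmonoid] at h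
  exact Submonoid.exists_list_of_mem_closure h

lemma wordDist_le {g h : G} {l : List G} (hl : ∀ x ∈ l, x ∈ S ∨ x⁻¹ ∈ S)
    (hp : l.prod = g⁻¹ * h) : wordDist S g h ≤ l.length :=
  csInf_le ⟨0, by rintro _ ⟨l, -, -, rfl⟩; positivity⟩ ⟨l, hl, hp, rfl⟩

lemma wordDist_nonneg (g h : G) : 0 ≤ wordDist S g h :=
  Real.sInf_nonneg (by rintro _ ⟨l, -, -, rfl⟩; positivity)

lemma exists_geodesic (hS : Subgroup.closure S = ⊤) (g h : G) :
    ∃ l : List G, (∀ x ∈ l, x ∈ S ∨ x⁻¹ ∈ S) ∧ l.prod = g⁻¹ * h ∧ wordDist S g h = l.length := by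
  classical
  have hex : ∃ n : ℕ, ∃ l : List G, (∀ x ∈ l, x ∈ S ∨ x⁻¹ ∈ S) ∧ l.prod = g⁻¹ * h ∧
      l.length = n := by
    obtain ⟨l, h1, h2⟩ := exists_word hS (g⁻¹ * h)
    exact ⟨_, l, h1, h2, rfl⟩
  obtain ⟨l, h1, h2, h3⟩ := Nat.find_spec hex
  refine ⟨l, h1, h2, le_antisymm (wordDist_le h1 h2) (le_csInf ⟨_, l, h1, h2, rfl⟩ ?_)⟩
  rintro _ ⟨l', h1', h2', rfl⟩
  rw [h3]
  exact_mod_cast Nat.find_min' hex ⟨l', h1', h2', rfl⟩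

lemma wordDist_comm_le (hS : Subgroup.closure S = ⊤) (g h : G) :
    wordDist S g h ≤ wordDist S h g := by
  obtain ⟨l, h1, h2, h3⟩ := exists_geodesic hS h g
  have := wordDist_le (S := S) (g := g) (h := h) (l := (l.map fun x => x⁻¹).reverse)
    (fun x hx => by
      rw [List.mem_reverse, List.mem_map] at hx
      obtain ⟨y, hy, rfl⟩ := hx
      rw [inv_inv]
      exact (h1 y hy).symm)
    (by rw [← List.prod_inv_reverse, h2]; simp)
  rwa [List.length_reverse, List.length_map, ← h3] at this

lemma wordDist_triangle (hS : Subgroup.closure S = ⊤) (g h k : G) :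
    wordDist S g k ≤ wordDist S g h + wordDist S h k := by
  obtain ⟨l, h1, h2, h3⟩ := exists_geodesic hS g h
  obtain ⟨l', h1', h2', h3'⟩ := exists_geodesic hS h k
  have := wordDist_le (S := S) (g := g) (h := k) (l := l ++ l')
    (fun x hx => (List.mem_append.1 hx).elim (h1 x) (h1' x))
    (by rw [List.prod_append, h2, h2']; group)
  rwa [List.length_append, Nat.cast_add, ← h3, ← h3'] at this

lemma wordDist_eq_one (g h : G) : wordDist S g h = wordDist S 1 (g⁻¹ * h) := by
  simp [wordDist]

end WordDist

variable {F F' : Type} [Group F'] [Fintype F'] [Group F] [Fintype F]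

/-- A left-invariant metric on the lamplighter group is bounded by `len`. -/
lemma le_mul_len (d : Lamplighter F → Lamplighter F → ℝ) (M : ℝ)
    (d_self : ∀ p, d p p ≤ 0) (d_comm : ∀ p q, d p q ≤ d q p)
    (d_tri : ∀ p q r, d p r ≤ d p q + d q r) (h1 : ∀ p, d p (mv p 1) ≤ M)
    (h2 : ∀ p x, d (dn p x 1) p ≤ M) (p q : Lamplighter F) : d p q ≤ 3 * M * len p q := by
  have hM : 0 ≤ M := by
    have a1 := d_tri 1 (mv 1 1) 1
    have a2 := d_comm (mv 1 1) 1
    have a3 := d_tri 1 1 1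
    have a4 := h1 1
    linarith
  have hup : ∀ (n : ℕ) p, d p (mv p n) ≤ n * M := fun n p => by
    induction n with
    | zero => simpa using d_self p
    | succ n ih =>
      have := d_tri p (mv p n) (mv (mv p n) 1)
      have := h1 (mv p n)
      rw [mv_mv] at *
      push_cast
      linarith
  have hdn : ∀ (n : ℕ) p x, d (dn p x n) p ≤ n * M := fun n p x => by
    induction n with
    | zero => simpa using d_self p
    | succ n ih =>
      have a1 := d_tri (dn p x (n + 1)) (dn p x n) p
      have a2 := h2 (dn p x n) fun i => x (n + i)
      have a3 := dn_dn_sub p x (Nat.le_succ n)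
      rw [Nat.succ_sub (le_refl n), Nat.sub_self] at a3
      rw [← a3] at a2
      push_cast
      linarith
  have hlo := lo_le_left p q
  have hhi := right_le_hi p q
  have hlh := lo_le_hi p q
  have hb : Blw (mv p (lo p q - pos p)) (mv q (hi p q - pos q)) := blw_mv (by omega) (by omega)
  obtain ⟨a, ha⟩ : ∃ a : ℕ, (a : ℤ) = pos p - lo p q := ⟨(pos p - lo p q).toNat, by omega⟩
  obtain ⟨b, hb'⟩ : ∃ b : ℕ, (b : ℤ) = hi p q - lo p q := ⟨(hi p q - lo p q).toNat, by omega⟩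
  obtain ⟨c, hc⟩ : ∃ c : ℕ, (c : ℤ) = hi p q - pos q := ⟨(hi p q - pos q).toNat, by omega⟩
  have e1 := hup a (mv p (lo p q - pos p))
  rw [mv_mv, ha, sub_add_sub_cancel, sub_self, mv_zero] at e1
  have e2 := hdn b (mv q (hi p q - pos q)) (word (mv q (hi p q - pos q)) (mv p (lo p q - pos p)))
  rw [← hb.eq_dn (by rw [pos_mv, pos_mv]; omega)] at e2
  have e3 := hup c q
  rw [hc] at e3
  have e4 := d_comm p (mv p (lo p q - pos p))
  have e5 := d_comm (mv q (hi p q - pos q)) q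
  have e6 := d_tri p (mv p (lo p q - pos p)) q
  have e7 := d_tri (mv p (lo p q - pos p)) (mv q (hi p q - pos q)) q
  have e8 : (a : ℝ) + b + c ≤ 3 * len p q := by
    have := left_le_hi p q
    have := lo_le_right p q
    have : (a : ℤ) + b + c ≤ 3 * len p q := by unfold len; omega
    exact_mod_cast this
  have e9 := mul_le_mul_of_nonneg_right e8 hM
  linarith

lemma inv_mul_mv (p : Lamplighter F) (k : ℤ) : p⁻¹ * mv p k = mv 1 k := by
  rw [inv_mul_eq_iff_eq_mul]
  exact ext_pt (fun i => by simp) (by simp)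

lemma inv_mul_dn (p : Lamplighter F) (x : ℕ → F) :
    (dn p x 1)⁻¹ * p = (dn 1 (fun _ => (lamp p (pos p - 1))⁻¹ * x 0) 1)⁻¹ := by
  rw [inv_mul_eq_iff_eq_mul, eq_mul_inv_iff_mul_eq]
  refine ext_pt (fun i => ?_) (by simp; ring)
  rw [lamp_mul, lamp_dn, lamp_dn, pos_one]
  by_cases hi : i = pos p - 1
  · rw [if_pos (by push_cast; omega), if_pos (by push_cast; omega), hi,
      show (pos p - 1 - (pos p - 1)).toNat = 0 by omega]
    group
  · rw [if_neg (by push_cast; omega), if_neg (by push_cast; omega), lamp_one, mul_one]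

lemma exists_wordDist_le {S : Set (Lamplighter F)} (hS : Subgroup.closure S = ⊤) :
    ∃ M : ℕ, ∀ p q, wordDist S p q ≤ M * len p q := by
  obtain ⟨N, hN⟩ := (finite_range fun a : F => wordDist S (dn 1 (fun _ => a) 1) 1).bddAbove
  obtain ⟨M, hM⟩ := exists_nat_ge (max N (wordDist S 1 (mv 1 1)))
  refine ⟨3 * M, fun p q => ?_⟩
  push_cast
  refine le_mul_len (wordDist S) M (fun p => ?_) (wordDist_comm_le hS) (wordDist_triangle hS)
    (fun p => ?_) (fun p x => ?_) p q
  · simpa using wordDist_le (S := S) (g := p) (h := p) (l := []) (by simp) (by simp)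
  · rw [wordDist_eq_one, inv_mul_mv]
    exact (le_max_right _ _).trans hM
  · rw [wordDist_eq_one, inv_mul_dn]
    have := hN ⟨(lamp p (pos p - 1))⁻¹ * x 0, rfl⟩
    beta_reduce at this
    rw [wordDist_eq_one, mul_one] at this
    exact this.trans ((le_max_left _ _).trans hM)

lemma exists_len_le {S : Set (Lamplighter F)} (hfin : S.Finite) (hS : Subgroup.closure S = ⊤) :
    ∃ M : ℕ, ∀ p q, (len p q : ℝ) ≤ M * wordDist S p q := by
  obtain ⟨N, hN⟩ := (hfin.image fun x => len 1 x).bddAbove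
  have key : ∀ l : List (Lamplighter F), (∀ x ∈ l, x ∈ S ∨ x⁻¹ ∈ S) →
      len 1 l.prod ≤ l.length * max N 0 := fun l => by
    induction l with
    | nil => simp
    | cons x l ih =>
      intro hl
      have e1 := ih fun y hy => hl y (List.mem_cons_of_mem _ hy)
      have e2 := len_tri 1 x (x * l.prod)
      have e3 := len_mul x 1 l.prod
      rw [mul_one] at e3
      have e4 : len 1 x ≤ N := by
        rcases hl x List.mem_cons_self with h | h
        · exact hN ⟨x, h, rfl⟩
        · have := hN ⟨x⁻¹, h, rfl⟩
          beta_reduce at this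
          have e := len_mul x 1 x⁻¹
          rw [mul_one, mul_inv_cancel, len_comm] at e
          rwa [e]
      rw [List.prod_cons, List.length_cons]
      push_cast
      rw [add_one_mul]
      have := le_max_left N 0
      omega
  refine ⟨(max N 0).toNat, fun p q => ?_⟩
  obtain ⟨l, h1, h2, h3⟩ := exists_geodesic hS p q
  have e1 := key l h1
  have e2 := len_mul p⁻¹ p q
  rw [inv_mul_cancel, ← h2] at e2
  rw [h3, mul_comm, ← e2]
  have e3 : ((max N 0).toNat : ℤ) = max N 0 := Int.toNat_of_nonneg (le_max_right _ _)
  rw [← e3] at e1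
  exact_mod_cast e1

lemma exists_finite_generating (F : Type) [Group F] [Fintype F] :
    ∃ S : Set (Lamplighter F), S.Finite ∧ Subgroup.closure S = ⊤ := by
  classical
  obtain ⟨S, hS⟩ : ∃ S : Set (Lamplighter F),
      S = insert (mv 1 1) (range fun a : F => dn 1 (fun _ => a) 1) := ⟨_, rfl⟩
  refine ⟨S, hS ▸ (finite_range _).insert _, (Subgroup.eq_top_iff' _).2 fun g => ?_⟩
  have := le_mul_len (fun p q => if p⁻¹ * q ∈ Subgroup.closure S then 0 else 1) 0
    (fun p => by simp [one_mem]) (fun p q => ?_) (fun p q r => ?_) (fun p => ?_) (fun p x => ?_)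
    1 g
  · by_contra hg
    rw [inv_one, one_mul, if_neg hg] at this
    norm_num at this
  · have : p⁻¹ * q ∈ Subgroup.closure S ↔ q⁻¹ * p ∈ Subgroup.closure S := by
      rw [← inv_mem_iff, mul_inv_rev, inv_inv]
    rw [if_congr this rfl rfl]
  · by_cases h1 : p⁻¹ * q ∈ Subgroup.closure S
    · by_cases h2 : q⁻¹ * r ∈ Subgroup.closure S
      · have := mul_mem h1 h2
        rw [mul_assoc, mul_inv_cancel_left] at this
        rw [if_pos h1, if_pos h2, if_pos this, add_zero]
      · rw [if_neg h2]
        split_ifs <;> norm_num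
    · rw [if_neg h1]
      split_ifs <;> norm_num
  · have : mv 1 1 ∈ Subgroup.closure S := Subgroup.subset_closure (by rw [hS]; exact mem_insert _ _)
    rw [inv_mul_mv, if_pos this]
  · have (a : F) : dn 1 (fun _ => a) 1 ∈ Subgroup.closure S :=
      Subgroup.subset_closure (by rw [hS]; exact mem_insert_of_mem _ ⟨a, rfl⟩)
    rw [inv_mul_dn, if_pos (inv_mem (this _))]

/-- Between lamplighter groups, quasi-isometries for word metrics are the same as
quasi-isometries for `len`. -/
theorem exists_qiPair_of_groupsQI (h : GroupsQI (Lamplighter F) (Lamplighter F')) :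
    ∃ (κ : ℕ) (φ : Lamplighter F → Lamplighter F') (ψ : Lamplighter F' → Lamplighter F),
      QIPair (κ : ℤ) φ ψ := by
  obtain ⟨S, T, hSf, hTf, hS, hT, κ, C, φ, hκ, hC, hφ, hsurj⟩ := h
  choose ψ hψ using hsurj
  obtain ⟨a, ha⟩ := exists_len_le hSf hS
  obtain ⟨a', ha'⟩ := exists_len_le hTf hT
  obtain ⟨b, hb⟩ := exists_wordDist_le hS
  obtain ⟨b', hb'⟩ := exists_wordDist_le hT
  have hκ0 : 0 < κ := by linarith
  have hlow : ∀ p q, wordDist S p q ≤ κ * (wordDist T (φ p) (φ q) + C) := fun p q => by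
    have := (hφ p q).1
    rw [one_div, sub_le_iff_le_add, inv_mul_le_iff₀ hκ0] at this
    exact this
  obtain ⟨k, hk⟩ := exists_nat_ge
    (1 + a' * κ * b + a' * C + a * κ * b' + a * κ * (3 * C))
  have p1 : 0 ≤ a' * κ * b := by positivity
  have p2 : 0 ≤ a' * C := by positivity
  have p3 : 0 ≤ a * κ * b' := by positivity
  have p4 : 0 ≤ a * κ * (3 * C) := by positivity
  have p5 : 0 ≤ a * κ * C := by positivity
  refine ⟨k, φ, ψ, ?_, fun p q => ?_, fun p q => ?_, fun p => ?_, fun q => ?_⟩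
  · have : (1 : ℝ) ≤ k := by linarith
    exact_mod_cast this
  · have hl : (0 : ℝ) ≤ len p q := by exact_mod_cast len_nonneg p q
    have : (len (φ p) (φ q) : ℝ) ≤ k * len p q + k := by
      calc (len (φ p) (φ q) : ℝ) ≤ a' * (κ * (b * len p q) + C) :=
            (ha' _ _).trans (mul_le_mul_of_nonneg_left ((hφ p q).2.trans
              (add_le_add_left (mul_le_mul_of_nonneg_left (hb p q) hκ0.le) C)) (by positivity))
        _ = a' * κ * b * len p q + a' * C := by ring
        _ ≤ k * len p q + k := add_le_add
            (mul_le_mul_of_nonneg_right (by linarith) hl) (by linarith)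
    exact_mod_cast this
  · have hl : (0 : ℝ) ≤ len p q := by exact_mod_cast len_nonneg p q
    have e1 := wordDist_triangle hT (φ (ψ p)) p (φ (ψ q))
    have e2 := wordDist_triangle hT p q (φ (ψ q))
    have e3 := wordDist_comm_le hT q (φ (ψ q))
    have e4 := hψ p
    have e5 := hψ q
    have e6 := hb' p q
    have : (len (ψ p) (ψ q) : ℝ) ≤ k * len p q + k := by
      calc (len (ψ p) (ψ q) : ℝ) ≤ a * (κ * (b' * len p q + 2 * C + C)) :=
            (ha _ _).trans (mul_le_mul_of_nonneg_left ((hlow _ _).trans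
              (mul_le_mul_of_nonneg_left (by linarith) hκ0.le)) (by positivity))
        _ = a * κ * b' * len p q + a * κ * (3 * C) := by ring
        _ ≤ k * len p q + k := add_le_add
            (mul_le_mul_of_nonneg_right (by linarith) hl) (by linarith)
    exact_mod_cast this
  · have e1 := hψ (φ p)
    have : (len (ψ (φ p)) p : ℝ) ≤ k := by
      calc (len (ψ (φ p)) p : ℝ) ≤ a * (κ * (C + C)) :=
            (ha _ _).trans (mul_le_mul_of_nonneg_left ((hlow _ _).trans
              (mul_le_mul_of_nonneg_left (by linarith) hκ0.le)) (by positivity))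
        _ ≤ k := by linarith
    exact_mod_cast this
  · have : (len (φ (ψ q)) q : ℝ) ≤ k := by
      calc (len (φ (ψ q)) q : ℝ) ≤ a' * C :=
            (ha' _ _).trans (mul_le_mul_of_nonneg_left (hψ q) (by positivity))
        _ ≤ k := by linarith
    exact_mod_cast this

theorem groupsQI_of_qiPair {κ : ℕ} {φ : Lamplighter F → Lamplighter F'}
    {ψ : Lamplighter F' → Lamplighter F} (h : QIPair (κ : ℤ) φ ψ) :
    GroupsQI (Lamplighter F) (Lamplighter F') := by
  obtain ⟨S, hSf, hS⟩ := exists_finite_generating F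
  obtain ⟨T, hTf, hT⟩ := exists_finite_generating F'
  obtain ⟨a, ha⟩ := exists_len_le hSf hS
  obtain ⟨a', ha'⟩ := exists_len_le hTf hT
  obtain ⟨b, hb⟩ := exists_wordDist_le hS
  obtain ⟨b', hb'⟩ := exists_wordDist_le hT
  obtain ⟨k, hk⟩ : ∃ k : ℝ, k = 1 + b' * κ * a + b * κ * a' := ⟨_, rfl⟩
  have hk1 : 1 ≤ k := by
    rw [hk]
    have : (0 : ℝ) ≤ b' * κ * a := by positivity
    have : (0 : ℝ) ≤ b * κ * a' := by positivity
    linarith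
  obtain ⟨C, hC⟩ : ∃ C : ℝ, C = b' * κ + 3 * b * κ := ⟨_, rfl⟩
  have hbk : (0 : ℝ) ≤ b * κ := by positivity
  have hbk' : (0 : ℝ) ≤ b' * κ := by positivity
  refine ⟨S, T, hSf, hTf, hS, hT, k, C, φ, hk1, by linarith, fun p q => ⟨?_, ?_⟩,
    fun y => ⟨ψ y, ?_⟩⟩
  · have e1 : (len p q : ℝ) ≤ κ * len (φ p) (φ q) + 3 * κ := by exact_mod_cast h.lower p q
    have e2 := hb p q
    have e3 := ha' (φ p) (φ q)
    have hd := wordDist_nonneg (S := T) (φ p) (φ q)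
    have e4 : wordDist S p q ≤ b * κ * a' * wordDist T (φ p) (φ q) + 3 * b * κ := by
      calc wordDist S p q ≤ b * (κ * (a' * wordDist T (φ p) (φ q)) + 3 * κ) :=
            e2.trans (mul_le_mul_of_nonneg_left (e1.trans (add_le_add_left
              (mul_le_mul_of_nonneg_left e3 (by positivity)) _)) (by positivity))
        _ = _ := by ring
    have e5 : wordDist S p q ≤ k * (wordDist T (φ p) (φ q) + C) := by
      have e6 : b * κ * a' * wordDist T (φ p) (φ q) ≤ k * wordDist T (φ p) (φ q) := by
        refine mul_le_mul_of_nonneg_right ?_ hd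
        have : (0 : ℝ) ≤ b' * κ * a := by positivity
        linarith
      have e7 : C ≤ k * C := le_mul_of_one_le_left (by linarith) hk1
      rw [mul_add]
      linarith
    rw [one_div, sub_le_iff_le_add, inv_mul_le_iff₀ (by linarith)]
    exact e5
  · have e1 : (len (φ p) (φ q) : ℝ) ≤ κ * len p q + κ := by exact_mod_cast h.len_left p q
    have e2 := hb' (φ p) (φ q)
    have e3 := ha p q
    have hd := wordDist_nonneg (S := S) p q
    have e4 : wordDist T (φ p) (φ q) ≤ b' * κ * a * wordDist S p q + b' * κ := by
      calc wordDist T (φ p) (φ q) ≤ b' * (κ * (a * wordDist S p q) + κ) :=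
            e2.trans (mul_le_mul_of_nonneg_left (e1.trans (add_le_add_left
              (mul_le_mul_of_nonneg_left e3 (by positivity)) _)) (by positivity))
        _ = _ := by ring
    have e6 : b' * κ * a * wordDist S p q ≤ k * wordDist S p q := by
      refine mul_le_mul_of_nonneg_right ?_ hd
      have : (0 : ℝ) ≤ b * κ * a' := by positivity
      linarith
    linarith
  · have e1 : (len (φ (ψ y)) y : ℝ) ≤ κ := by exact_mod_cast h.inv_right y
    have e2 := (hb' (φ (ψ y)) y).trans (mul_le_mul_of_nonneg_left e1 (by positivity))
    linarith

end

section

variable {F F' : Type} [Group F'] [Fintype F'] [Group F] [Fintype F]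

/-- Read a sequence over `F` as a sequence over `A`, each letter of `F` being a block of
`s` letters of `A`. -/
def regroup {F A : Type} {s : ℕ} [NeZero s] (e : F ≃ (Fin s → A)) : (ℤ → F) ≃ (ℤ → A) where
  toFun f k := e (f (Int.divModEquiv s k).1) (Int.divModEquiv s k).2
  invFun u i := e.symm fun j => u ((Int.divModEquiv s).symm (i, j))
  left_inv f := by
    funext i
    simp only [Equiv.apply_symm_apply]
    exact e.symm_apply_apply _
  right_inv u := by
    funext k
    simp only [Equiv.apply_symm_apply, Prod.mk.eta, Equiv.symm_apply_apply]

section Transcode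

variable {F F' A : Type} {s r : ℕ} [NeZero s] [NeZero r]

/-- Read a sequence over `F` as a sequence over `F'`, through a common alphabet. -/
def transcode (e : F ≃ (Fin s → A)) (e' : F' ≃ (Fin r → A)) : (ℤ → F) ≃ (ℤ → F') :=
  (regroup e).trans (regroup e').symm

lemma transcode_congr (e : F ≃ (Fin s → A)) (e' : F' ≃ (Fin r → A)) {f g : ℤ → F} {i : ℤ}
    (h : ∀ k, r * i ≤ k → k < r * (i + 1) → f (k / s) = g (k / s)) :
    transcode e e' f i = transcode e e' g i := by
  refine congrArg e'.symm (funext fun j => ?_)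
  have hj : ((j : ℕ) : ℤ) < r := by exact_mod_cast j.2
  have := h (i * r + (j : ℕ)) (by rw [mul_comm]; omega) (by rw [mul_add, mul_comm]; omega)
  exact congrArg (fun x => e x _) this

lemma transcode_congr_lt (e : F ≃ (Fin s → A)) (e' : F' ≃ (Fin r → A)) {f g : ℤ → F} {x : ℤ}
    (h : ∀ i < x, f i = g i) {i : ℤ} (hx : i < s * x / r) :
    transcode e e' f i = transcode e e' g i := by
  have hs : (0 : ℤ) < s := by exact_mod_cast Nat.pos_of_neZero s
  have hr : (0 : ℤ) < r := by exact_mod_cast Nat.pos_of_neZero r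
  refine transcode_congr e e' fun k _ h2 => h _ ?_
  have := (Int.le_ediv_iff_mul_le hr).1 (Int.add_one_le_of_lt hx)
  rw [Int.ediv_lt_iff_lt_mul hs]
  linarith

lemma transcode_congr_ge (e : F ≃ (Fin s → A)) (e' : F' ≃ (Fin r → A)) {f g : ℤ → F} {x : ℤ}
    (h : ∀ i, x ≤ i → f i = g i) {i : ℤ} (hx : s * x / r + 1 ≤ i) :
    transcode e e' f i = transcode e e' g i := by
  have hs : (0 : ℤ) < s := by exact_mod_cast Nat.pos_of_neZero s
  have hr : (0 : ℤ) < r := by exact_mod_cast Nat.pos_of_neZero r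
  refine transcode_congr e e' fun k h1 _ => h _ ?_
  have := (Int.ediv_lt_iff_lt_mul hr).1 (Int.lt_of_add_one_le hx)
  rw [Int.le_ediv_iff_mul_le hs]
  linarith

end Transcode

variable {A : Type} {s r : ℕ} [NeZero s] [NeZero r]

lemma transcode_one {z : A} (e : F ≃ (Fin s → A)) (e' : F' ≃ (Fin r → A))
    (he : e 1 = fun _ => z) (he' : e' 1 = fun _ => z) : transcode e e' (fun _ => 1) = fun _ => 1 := by
  funext i
  have : transcode e e' (fun _ => 1) i = e'.symm fun j => z :=
    congrArg e'.symm (funext fun j => congrFun he _)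
  rw [this, ← he', Equiv.symm_apply_apply]

lemma transcode_finite {z : A} (e : F ≃ (Fin s → A)) (e' : F' ≃ (Fin r → A))
    (he : e 1 = fun _ => z) (he' : e' 1 = fun _ => z) (p : Lamplighter F) :
    {i | transcode e e' (lamp p) i ≠ 1}.Finite := by
  refine (finite_Ico ((s : ℤ) * lo p 1 / r) ((s : ℤ) * hi p 1 / r + 1)).subset fun i hp => ?_
  rw [mem_ofPred_eq] at hp
  have h1 : transcode e e' (lamp (1 : Lamplighter F)) i = 1 :=
    (congrArg (fun f => transcode e e' f i) (funext fun i => lamp_one i)).trans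
      (congrFun (transcode_one e e' he he') i)
  refine ⟨not_lt.1 fun h => hp ?_, not_le.1 fun h => hp ?_⟩
  · rw [transcode_congr_lt e e' (fun _ => lamp_eq_of_lt) h, h1]
  · rw [transcode_congr_ge e e' (fun _ => lamp_eq_of_le) h, h1]

/-- The map of lamplighter groups induced by `transcode`. -/
def transMap {z : A} (e : F ≃ (Fin s → A)) (e' : F' ≃ (Fin r → A))
    (he : e 1 = fun _ => z) (he' : e' 1 = fun _ => z) (p : Lamplighter F) : Lamplighter F' :=
  mkPt (transcode e e' (lamp p)) (transcode_finite e e' he he' p) (s * pos p / r)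

lemma len_transMap {z : A} (e : F ≃ (Fin s → A)) (e' : F' ≃ (Fin r → A))
    (he : e 1 = fun _ => z) (he' : e' 1 = fun _ => z) (p q : Lamplighter F) :
    len (transMap e e' he he' p) (transMap e e' he he' q) ≤ s * len p q + 2 := by
  have hs : (0 : ℤ) < s := by exact_mod_cast Nat.pos_of_neZero s
  have hr : (0 : ℤ) < r := by exact_mod_cast Nat.pos_of_neZero r
  have hmono : ∀ {x y : ℤ}, x ≤ y → (s : ℤ) * x / r ≤ s * y / r := fun h =>
    Int.ediv_le_ediv hr (mul_le_mul_of_nonneg_left h hs.le)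
  have h1 : (s : ℤ) * lo p q / r ≤ lo (transMap e e' he he' p) (transMap e e' he he' q) :=
    le_lo.2 ⟨hmono (lo_le_left p q), hmono (lo_le_right p q),
      fun i h => transcode_congr_lt e e' (fun _ => lamp_eq_of_lt) h⟩
  have h2 : hi (transMap e e' he he' p) (transMap e e' he he' q) ≤ (s : ℤ) * hi p q / r + 1 :=
    hi_le.2 ⟨(hmono (left_le_hi p q)).trans (lt_add_one _).le,
      (hmono (right_le_hi p q)).trans (lt_add_one _).le,
      fun i h => transcode_congr_ge e e' (fun _ => lamp_eq_of_le) h⟩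
  have h3 : (s : ℤ) * hi p q / r ≤ s * lo p q / r + s * len p q + 1 := by
    have e0 : (0 : ℤ) ≤ s * len p q := mul_nonneg hs.le (len_nonneg p q)
    have e1 : (s : ℤ) * hi p q = s * lo p q + s * len p q := by unfold len; ring
    have e2 := Int.mul_ediv_add_emod (s * lo p q) r
    have e3 := Int.emod_lt_of_pos (s * lo p q) hr
    refine Int.ediv_le_of_le_mul hr ?_
    rw [e1]
    nlinarith
  unfold len at *
  omega

lemma len_transMap_transMap {z : A} (e : F ≃ (Fin s → A)) (e' : F' ≃ (Fin r → A))
    (he : e 1 = fun _ => z) (he' : e' 1 = fun _ => z) (p : Lamplighter F) :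
    len (transMap e' e he' he (transMap e e' he he' p)) p ≤ r + 1 := by
  have hs : (0 : ℤ) < s := by exact_mod_cast Nat.pos_of_neZero s
  have hr : (0 : ℤ) < r := by exact_mod_cast Nat.pos_of_neZero r
  have hl : ∀ i, lamp (transMap e' e he' he (transMap e e' he he' p)) i = lamp p i := fun i =>
    congrFun ((transcode e e').symm_apply_apply (lamp p)) i
  have h1 : pos (transMap e' e he' he (transMap e e' he he' p)) ≤ pos p := by
    change (r : ℤ) * (s * pos p / r) / s ≤ pos p
    refine Int.ediv_le_of_le_mul hs ?_
    have := Int.mul_ediv_self_le (x := s * pos p) hr.ne'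
    linarith
  have h2 : pos p - (r + 1) ≤ pos (transMap e' e he' he (transMap e e' he he' p)) := by
    change pos p - (r + 1) ≤ (r : ℤ) * (s * pos p / r) / s
    rw [Int.le_ediv_iff_mul_le hs]
    have := Int.lt_mul_ediv_self_add (x := s * pos p) hr
    nlinarith
  have h3 := le_lo.2 ⟨h2, by omega, fun i _ => hl i⟩
  have h4 := hi_le.2 ⟨h1, le_rfl, fun i _ => hl i⟩
  unfold len
  omega

lemma qiPair_transMap {z : A} (e : F ≃ (Fin s → A)) (e' : F' ≃ (Fin r → A))
    (he : e 1 = fun _ => z) (he' : e' 1 = fun _ => z) :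
    QIPair ((s + r + 2 : ℕ) : ℤ) (transMap e e' he he') (transMap e' e he' he) := by
  refine ⟨by push_cast; omega, fun p q => ?_, fun p q => ?_, fun p => ?_, fun p => ?_⟩
  · have h1 := len_transMap e e' he he' p q
    have h2 := len_nonneg p q
    push_cast
    nlinarith
  · have h1 := len_transMap e' e he' he p q
    have h2 := len_nonneg p q
    push_cast
    nlinarith
  · have := len_transMap_transMap e e' he he' p
    push_cast
    omega
  · have := len_transMap_transMap e' e he' he p
    push_cast
    omega

lemma exists_equiv_const {d s : ℕ} (h : Fintype.card F = d ^ s) (z : Fin d) :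
    ∃ e : F ≃ (Fin s → Fin d), e 1 = fun _ => z := by
  classical
  have e := Fintype.equivOfCardEq (α := F) (β := Fin s → Fin d) (by simp [h])
  exact ⟨e.trans (Equiv.swap (e 1) fun _ => z), by simp⟩

theorem groupsQI_of_card {d s r : ℕ} (hd : 0 < d) (hs : 0 < s) (hr : 0 < r)
    (h : Fintype.card F = d ^ s) (h' : Fintype.card F' = d ^ r) :
    GroupsQI (Lamplighter F) (Lamplighter F') := by
  have : NeZero s := ⟨hs.ne'⟩
  have : NeZero r := ⟨hr.ne'⟩
  obtain ⟨e, he⟩ := exists_equiv_const h ⟨0, hd⟩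
  obtain ⟨e', he'⟩ := exists_equiv_const h' ⟨0, hd⟩
  exact groupsQI_of_qiPair (qiPair_transMap e e' he he')

end

end Lamp

/-- **Theorem (quasi-isometry classification of lamplighter groups).**
For finite groups `F` and `F'`, the lamplighter groups `ℤ ≀ F` and `ℤ ≀ F'` are
quasi-isometric if and only if there are positive integers `d, s, r` with `|F| = d^s`
and `|F'| = d^r`. -/
theorem lamplighter_qi_classification
    (F F' : Type) [Group F] [Group F'] [Fintype F] [Fintype F'] :
    GroupsQI (Lamplighter F) (Lamplighter F') ↔
      ∃ d s r : ℕ, 0 < d ∧ 0 < s ∧ 0 < r ∧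
        Fintype.card F = d ^ s ∧ Fintype.card F' = d ^ r := by
  refine ⟨fun h => ?_, fun ⟨_, _, _, hd, hs, hr, h, h'⟩ => Lamp.groupsQI_of_card hd hs hr h h'⟩
  obtain ⟨_, _, _, h⟩ := Lamp.exists_qiPair_of_groupsQI h
  exact h.exists_base
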